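/- arXiv:1507.03207 — 2 statements merged into one kernel-verified Lean document; each statement's English description precedes it below -/
import Mathlib

section
/- Let γ_n → ∞ and ρ^{γ_n} ∈ C([0,T];P(ℝ^{2d})) satisfy I^{γ_n}(ρ^{γ_n}) + F(ρ^{γ_n}_t|_{t=0}) ≤ C for a constant C independent of n. Assume ρ^{γ_n} → ρ narrowly in M([0,T]×ℝ^{2d}) and ξ^{γ_n}_#ρ^{γ_n} → ξ_#ρ =: σ in C([0,T];P(ℝ^d)), where ξ^γ(q,p) := q + p/γ and ξ(q,p) := q. Then liminf_{n→∞} I^{γ_n}(ρ^{γ_n}) ≥ I(σ), where I(σ) := sup over g ∈ C_b^{1,2}(ℝ×ℝ^d) of [∫_{ℝ^d} g_T dσ_T − ∫_{ℝ^d} g_0 dσ_0 − ∫_0^T∫_{ℝ^d} (∂_t g − ∇V·∇g − (∇ψ∗σ_t)·∇g + Δg) dσ_t dt − (1/2)∫_0^T∫_{ℝ^d} |∇g|² dσ_t dt]. -/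
open MeasureTheory Real Filter Topology Set
open scoped ENNReal NNReal

noncomputable section

/-- Phase space ℝ^{2d} = ℝ^d_q × ℝ^d_p. -/
abbrev Phase (d : ℕ) := (Fin d → ℝ) × (Fin d → ℝ)

/-- The unit direction in the `p_i` coordinate. -/
def dirP {d : ℕ} (i : Fin d) : Phase d := (0, Pi.single i 1)

/-- The unit direction in the `q_i` coordinate. -/
def dirQ {d : ℕ} (i : Fin d) : Phase d := (Pi.single i 1, 0)

/-- Partial derivative in the `p_i` variable. -/
def pdP {d : ℕ} (φ : Phase d → ℝ) (x : Phase d) (i : Fin d) : ℝ :=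
  fderiv ℝ φ x (dirP i)

/-- The Laplacian in the `p` variables. -/
def laplP {d : ℕ} (φ : Phase d → ℝ) (x : Phase d) : ℝ :=
  ∑ i, fderiv ℝ (fun y => pdP φ y i) x (dirP i)

/-- `φ ∈ C_c^∞(ℝ^{2d})`. -/
def IsTestFn {d : ℕ} (φ : Phase d → ℝ) : Prop :=
  ContDiff ℝ (⊤ : ℕ∞) φ ∧ HasCompactSupport φ

/-- The integrand of the duality formula for the relative Fisher information. -/
def fisherIntegrand {d : ℕ} (m : ℝ) (φ : Phase d → ℝ) (x : Phase d) : ℝ :=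
  laplP φ x - (1 / m) * ∑ i, x.2 i * pdP φ x i - (1 / 2) * ∑ i, (pdP φ x i) ^ 2

/-- The relative Fisher information (w.r.t. the `p`-variable). -/
def relFisher {d : ℕ} (m : ℝ) (ν : Measure (Phase d)) : ℝ≥0∞ :=
  ⨆ φ : {φ : Phase d → ℝ // IsTestFn φ},
    ENNReal.ofReal (2 * ∫ x, fisherIntegrand m φ.1 x ∂ν)

/-- Time derivative of a function on `ℝ × ℝ^{2d}`. -/
def tder {d : ℕ} (f : ℝ × Phase d → ℝ) (z : ℝ × Phase d) : ℝ :=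
  fderiv ℝ f z (1, 0)

/-- Partial derivative in `q_i` of a function on `ℝ × ℝ^{2d}`. -/
def qderT {d : ℕ} (f : ℝ × Phase d → ℝ) (z : ℝ × Phase d) (i : Fin d) : ℝ :=
  fderiv ℝ f z (0, dirQ i)

/-- Partial derivative in `p_i` of a function on `ℝ × ℝ^{2d}`. -/
def pderT {d : ℕ} (f : ℝ × Phase d → ℝ) (z : ℝ × Phase d) (i : Fin d) : ℝ :=
  fderiv ℝ f z (0, dirP i)

/-- Laplacian in the `p`-variables of a function on `ℝ × ℝ^{2d}`. -/
def laplPT {d : ℕ} (f : ℝ × Phase d → ℝ) (z : ℝ × Phase d) : ℝ :=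
  ∑ i, fderiv ℝ (fun w => pderT f w i) z ((0 : ℝ), dirP i)

/-- `f ∈ C_b^{1,2}(ℝ × ℝ^{2d})`: (jointly) twice continuously differentiable, bounded
together with its first and second derivatives. -/
def IsCb2 {E : Type*} [NormedAddCommGroup E] [NormedSpace ℝ E] (f : E → ℝ) : Prop :=
  ContDiff ℝ 2 f ∧ ∃ M : ℝ, ∀ z, |f z| ≤ M ∧ ‖fderiv ℝ f z‖ ≤ M ∧
    ‖fderiv ℝ (fderiv ℝ f) z‖ ≤ M

/-- The Hamiltonian `H(q,p) = p²/(2m) + V(q)`. -/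
def Hfun {d : ℕ} (m : ℝ) (V : (Fin d → ℝ) → ℝ) (x : Phase d) : ℝ :=
  (∑ i, (x.2 i) ^ 2) / (2 * m) + V x.1

/-- `(∂_i ψ ∗ ν)(q)` for a measure `ν` on phase space (convolution acts on `q` only). -/
def convGradPsi {d : ℕ} (ψ : (Fin d → ℝ) → ℝ) (ν : Measure (Phase d))
    (q : Fin d → ℝ) (i : Fin d) : ℝ :=
  ∫ y, fderiv ℝ ψ (q - y.1) (Pi.single i 1) ∂ν

/-- The generator `L_ν f = γ J∇(H+ψ∗ν)·∇f − γ²(p/m)·∇_p f + γ²Δ_p f`, acting on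
functions of `(t,x) ∈ ℝ × ℝ^{2d}` (derivatives in the spatial directions only). -/
def Lop {d : ℕ} (m γ : ℝ) (V ψ : (Fin d → ℝ) → ℝ) (ν : Measure (Phase d))
    (f : ℝ × Phase d → ℝ) (z : ℝ × Phase d) : ℝ :=
  γ * ((∑ i, (z.2.2 i / m) * qderT f z i)
      - ∑ i, (fderiv ℝ V z.2.1 (Pi.single i 1) + convGradPsi ψ ν z.2.1 i) * pderT f z i)
    - γ ^ 2 * ∑ i, (z.2.2 i / m) * pderT f z i
    + γ ^ 2 * laplPT f z

/-- The large-deviation rate functional `I^γ` of the VFP equation, in duality form. -/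
def RateI {d : ℕ} (m γ T : ℝ) (V ψ : (Fin d → ℝ) → ℝ)
    (ρ : ℝ → ProbabilityMeasure (Phase d)) : ℝ≥0∞ :=
  ⨆ f : {f : ℝ × Phase d → ℝ // IsCb2 f},
    ENNReal.ofReal (
      (∫ x, f.1 (T, x) ∂(ρ T : Measure (Phase d)))
      - (∫ x, f.1 (0, x) ∂(ρ 0 : Measure (Phase d)))
      - (∫ t in Icc (0 : ℝ) T,
          (∫ x, (tder f.1 (t, x) + Lop m γ V ψ (ρ t : Measure (Phase d)) f.1 (t, x))
            ∂(ρ t : Measure (Phase d))))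
      - γ ^ 2 / 2 * ∫ t in Icc (0 : ℝ) T,
          (∫ x, (∑ i, (pderT f.1 (t, x) i) ^ 2) ∂(ρ t : Measure (Phase d))))

/-- Relative entropy in Donsker–Varadhan duality form,
`H(ν|ζ) = sup_{φ ∈ C_c^∞} [∫ φ dν − log ∫ e^φ dζ]`. -/
def relEntDV {d : ℕ} (ν ζ : Measure (Phase d)) : ℝ≥0∞ :=
  ⨆ φ : {φ : Phase d → ℝ // IsTestFn φ},
    ENNReal.ofReal ((∫ x, φ.1 x ∂ν) - Real.log (∫ x, Real.exp (φ.1 x) ∂ζ))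

/-- Normalization constant `Z_H = ∫ e^{−H}`. -/
def gibbsZ (d : ℕ) (m : ℝ) (V : (Fin d → ℝ) → ℝ) : ℝ :=
  ∫ x : Phase d, Real.exp (-(Hfun m V x))

/-- The normalized Gibbs measure `Z_H⁻¹ e^{−H} dx`. -/
def gibbs (d : ℕ) (m : ℝ) (V : (Fin d → ℝ) → ℝ) : Measure (Phase d) :=
  (ENNReal.ofReal (gibbsZ d m V))⁻¹ •
    volume.withDensity (fun x => ENNReal.ofReal (Real.exp (-(Hfun m V x))))

/-- The interaction energy `∫ (ψ∗ν) dν`. -/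
def interactionEnergy {d : ℕ} (ψ : (Fin d → ℝ) → ℝ) (ν : Measure (Phase d)) : ℝ :=
  ∫ x, (∫ y, ψ (x.1 - y.1) ∂ν) ∂ν

/-- The free energy `F(ν) = H(ν | Z_H⁻¹e^{−H}dx) + ½∫(ψ∗ν)dν`. -/
def FreeEnergy {d : ℕ} (m : ℝ) (V ψ : (Fin d → ℝ) → ℝ) (ν : Measure (Phase d)) : ℝ≥0∞ :=
  relEntDV ν (gibbs d m V) + ENNReal.ofReal ((1 / 2) * interactionEnergy ψ ν)

/-- The standing assumptions (V1)–(V2) on the potentials `V` and `ψ`. -/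
structure PotentialHyp (d : ℕ) (m : ℝ) (V ψ : (Fin d → ℝ) → ℝ) : Prop where
  hd : 1 ≤ d
  hm : 0 < m
  V_smooth : ContDiff ℝ 2 V
  V_nonneg : ∀ q, 0 ≤ V q
  V_hess_bdd : ∃ K, ∀ q, ‖fderiv ℝ (fderiv ℝ V) q‖ ≤ K
  V_grad_growth : ∃ C > 0, ∀ q,
    (∑ i, (fderiv ℝ V q (Pi.single i 1)) ^ 2) ≤ C * (1 + V q)
  V_exp_int : Integrable (fun q => Real.exp (-V q)) (volume : Measure (Fin d → ℝ))
  ψ_smooth : ContDiff ℝ 2 ψ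
  ψ_int : Integrable ψ (volume : Measure (Fin d → ℝ))
  ψ_grad_int : ∀ i, Integrable (fun q => fderiv ℝ ψ q (Pi.single i 1))
    (volume : Measure (Fin d → ℝ))
  ψ_symm : ∀ q, ψ (-q) = ψ q
  ψ_deriv_bdd : ∃ K, ∀ q, ‖fderiv ℝ ψ q‖ ≤ K ∧ ‖fderiv ℝ (fderiv ℝ ψ) q‖ ≤ K
  ψ_conv_nonneg : ∀ ν : ProbabilityMeasure (Fin d → ℝ),
    0 ≤ ∫ q, (∫ q', ψ (q - q') ∂(ν : Measure (Fin d → ℝ))) ∂(ν : Measure (Fin d → ℝ))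

/-- The coarse-graining map `ξ^γ(q,p) = q + p/γ`. -/
def xiGamma {d : ℕ} (γ : ℝ) (x : Phase d) : Fin d → ℝ :=
  fun i => x.1 i + x.2 i / γ

/-- Time derivative of a function on `ℝ × ℝ^d`. -/
def tderQ {d : ℕ} (g : ℝ × (Fin d → ℝ) → ℝ) (z : ℝ × (Fin d → ℝ)) : ℝ :=
  fderiv ℝ g z (1, 0)

/-- Partial derivative in `q_i` of a function on `ℝ × ℝ^d`. -/
def qderQ {d : ℕ} (g : ℝ × (Fin d → ℝ) → ℝ) (z : ℝ × (Fin d → ℝ)) (i : Fin d) : ℝ :=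
  fderiv ℝ g z (0, Pi.single i 1)

/-- Spatial Laplacian of a function on `ℝ × ℝ^d`. -/
def laplQ {d : ℕ} (g : ℝ × (Fin d → ℝ) → ℝ) (z : ℝ × (Fin d → ℝ)) : ℝ :=
  ∑ i, fderiv ℝ (fun w => qderQ g w i) z ((0 : ℝ), Pi.single i 1)

/-- The limiting rate functional
`I(σ) = sup_g [∫g_T dσ_T − ∫g_0 dσ_0 − ∫∫(∂_t g − ∇V·∇g − (∇ψ∗σ_t)·∇g + Δg)dσ_t dt
 − ½∫∫|∇g|² dσ_t dt]` over `g ∈ C_b^{1,2}(ℝ×ℝ^d)`. -/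
def LimRate {d : ℕ} (T : ℝ) (V ψ : (Fin d → ℝ) → ℝ)
    (σ : ℝ → ProbabilityMeasure (Fin d → ℝ)) : ℝ≥0∞ :=
  ⨆ g : {g : ℝ × (Fin d → ℝ) → ℝ // IsCb2 g},
    ENNReal.ofReal (
      (∫ q, g.1 (T, q) ∂(σ T : Measure (Fin d → ℝ)))
      - (∫ q, g.1 (0, q) ∂(σ 0 : Measure (Fin d → ℝ)))
      - (∫ t in Icc (0 : ℝ) T,
          (∫ q, (tderQ g.1 (t, q)
              - (∑ i, fderiv ℝ V q (Pi.single i 1) * qderQ g.1 (t, q) i)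
              - (∑ i, (∫ q', fderiv ℝ ψ (q - q') (Pi.single i 1)
                  ∂(σ t : Measure (Fin d → ℝ))) * qderQ g.1 (t, q) i)
              + laplQ g.1 (t, q)) ∂(σ t : Measure (Fin d → ℝ))))
      - (1 / 2) * ∫ t in Icc (0 : ℝ) T,
          (∫ q, (∑ i, (qderQ g.1 (t, q) i) ^ 2) ∂(σ t : Measure (Fin d → ℝ))))

section Auxiliary

set_option maxSynthPendingDepth 3

/-- A bound on the second derivative makes the first derivative Lipschitz. -/
theorem norm_fderiv_sub_le_of_second {E : Type*} [NormedAddCommGroup E] [NormedSpace ℝ E]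
    {W : E → ℝ} (hW : ContDiff ℝ 2 W) {K : ℝ} (hK : ∀ q, ‖fderiv ℝ (fderiv ℝ W) q‖ ≤ K)
    (x y : E) : ‖fderiv ℝ W x - fderiv ℝ W y‖ ≤ K * ‖x - y‖ := by
  have h1 : ContDiff ℝ 1 (fderiv ℝ W) := hW.fderiv_right (by norm_num)
  exact (convex_univ).norm_image_sub_le_of_norm_fderiv_le
    (fun z _ => (h1.differentiable (by norm_num)).differentiableAt)
    (fun z _ => hK z) (mem_univ y) (mem_univ x)

theorem abs_taylor_le {E : Type*} [NormedAddCommGroup E] [NormedSpace ℝ E]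
    {W : E → ℝ} (hW : ContDiff ℝ 2 W) {K : ℝ} (hK : ∀ q, ‖fderiv ℝ (fderiv ℝ W) q‖ ≤ K)
    (x z : E) : |W (x + z) - W x - fderiv ℝ W x z| ≤ K * ‖z‖ ^ 2 := by
  have hK0 : 0 ≤ K := (norm_nonneg (fderiv ℝ (fderiv ℝ W) x)).trans (hK x)
  have := (convex_closedBall x ‖z‖).norm_image_sub_le_of_norm_fderiv_le'
    (f := W) (φ := fderiv ℝ W x) (C := K * ‖z‖) (x := x) (y := x + z)
    (fun y _ => (hW.differentiable (by norm_num)).differentiableAt)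
    (fun y hy => ?_) (by simp) (by simp)
  · rw [Real.norm_eq_abs] at this
    simpa [pow_two, mul_assoc] using this
  · refine (norm_fderiv_sub_le_of_second hW hK y x).trans ?_
    gcongr
    simpa [dist_eq_norm] using hy

theorem isCb2_iff_iteratedFDeriv {E : Type*} [NormedAddCommGroup E] [NormedSpace ℝ E]
    {f : E → ℝ} : IsCb2 f ↔ ContDiff ℝ 2 f ∧ ∃ M : ℝ, ∀ k ≤ 2, ∀ z,
      ‖iteratedFDeriv ℝ k f z‖ ≤ M := by
  have h2 : ∀ z, ‖iteratedFDeriv ℝ 2 f z‖ = ‖fderiv ℝ (fderiv ℝ f) z‖ := fun z => by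
    rw [← norm_iteratedFDeriv_fderiv, norm_iteratedFDeriv_one]
  constructor
  · rintro ⟨h, M, hM⟩
    refine ⟨h, M, fun k hk z => ?_⟩
    interval_cases k
    · simpa using (hM z).1
    · rw [norm_iteratedFDeriv_one]; exact (hM z).2.1
    · rw [h2]; exact (hM z).2.2
  · rintro ⟨h, M, hM⟩
    refine ⟨h, M, fun z => ⟨?_, ?_, ?_⟩⟩
    · simpa using hM 0 (by norm_num) z
    · rw [← norm_iteratedFDeriv_one]; exact hM 1 (by norm_num) z
    · rw [← h2]; exact hM 2 le_rfl z

theorem IsCb2.mul {E : Type*} [NormedAddCommGroup E] [NormedSpace ℝ E]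
    {f g : E → ℝ} (hf : IsCb2 f) (hg : IsCb2 g) : IsCb2 (fun x => f x * g x) := by
  rw [isCb2_iff_iteratedFDeriv] at *
  obtain ⟨hf, M, hM⟩ := hf
  obtain ⟨hg, N, hN⟩ := hg
  refine ⟨hf.mul hg, 4 * (|M| * |N|), fun k hk z => ?_⟩
  refine (norm_iteratedFDeriv_mul_le hf hg z (by exact_mod_cast hk)).trans ?_
  have : ∀ i ∈ Finset.range (k + 1), (k.choose i : ℝ) * ‖iteratedFDeriv ℝ i f z‖ *
      ‖iteratedFDeriv ℝ (k - i) g z‖ ≤ k.choose i * (|M| * |N|) := fun i hi => by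
    rw [mul_assoc]
    rw [Finset.mem_range] at hi
    gcongr
    · exact (hM i (by omega) z).trans (le_abs_self _)
    · exact (hN (k - i) (by omega) z).trans (le_abs_self _)
  refine (Finset.sum_le_sum this).trans ?_
  rw [← Finset.sum_mul, ← Nat.cast_sum, Nat.sum_range_choose]
  gcongr
  interval_cases k <;> norm_num

theorem IsCb2.comp_clm {E F : Type*} [NormedAddCommGroup E] [NormedSpace ℝ E]
    [NormedAddCommGroup F] [NormedSpace ℝ F] {f : E → ℝ} (hf : IsCb2 f) (A : F →L[ℝ] E) :
    IsCb2 (fun x => f (A x)) := by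
  rw [isCb2_iff_iteratedFDeriv] at *
  obtain ⟨hf, M, hM⟩ := hf
  refine ⟨hf.comp A.contDiff, |M| * (1 + ‖A‖) ^ 2, fun k hk z => ?_⟩
  have := A.iteratedFDeriv_comp_right hf z (i := k) (by exact_mod_cast hk)
  change ‖iteratedFDeriv ℝ k (f ∘ A) z‖ ≤ _
  rw [this]
  refine (ContinuousMultilinearMap.norm_compContinuousLinearMap_le _ _).trans ?_
  simp only [Finset.prod_const, Finset.card_univ, Fintype.card_fin]
  have h1 : (1 : ℝ) ≤ 1 + ‖A‖ := by simp
  gcongr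
  · exact (hM k hk _).trans (le_abs_self _)
  · calc ‖A‖ ^ k ≤ (1 + ‖A‖) ^ k := by gcongr; simp
      _ ≤ _ := pow_le_pow_right₀ h1 hk

theorem isCb2_of_hasDerivAt {c c₁ c₂ : ℝ → ℝ} (h1 : ∀ t, HasDerivAt c (c₁ t) t)
    (h2 : ∀ t, HasDerivAt c₁ (c₂ t) t) (h3 : Continuous c₂) {M : ℝ}
    (hM : ∀ t, |c t| ≤ M ∧ |c₁ t| ≤ M ∧ |c₂ t| ≤ M) : IsCb2 c := by
  have e1 : deriv c = c₁ := funext fun t => (h1 t).deriv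
  have e2 : deriv c₁ = c₂ := funext fun t => (h2 t).deriv
  rw [isCb2_iff_iteratedFDeriv]
  constructor
  · rw [show (2 : WithTop ℕ∞) = 1 + 1 by norm_num, contDiff_succ_iff_deriv]
    refine ⟨fun t => (h1 t).differentiableAt, by simp, ?_⟩
    rw [e1, contDiff_one_iff_deriv, e2]
    exact ⟨fun t => (h2 t).differentiableAt, h3⟩
  · refine ⟨M, fun k hk z => ?_⟩
    rw [norm_iteratedFDeriv_eq_norm_iteratedDeriv, Real.norm_eq_abs]
    interval_cases k
    · simpa using (hM z).1
    · rw [iteratedDeriv_one, e1]; exact (hM z).2.1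
    · rw [iteratedDeriv_succ, iteratedDeriv_one, e1, e2]; exact (hM z).2.2

theorem rateI_congr {d : ℕ} {m γ T : ℝ} {V ψ : (Fin d → ℝ) → ℝ} (hT : 0 ≤ T)
    {ρ ρ' : ℝ → ProbabilityMeasure (Phase d)} (h : ∀ t ∈ Icc (0 : ℝ) T, ρ t = ρ' t) :
    RateI m γ T V ψ ρ = RateI m γ T V ψ ρ' := by
  have key : ∀ G : ℝ → ProbabilityMeasure (Phase d) → ℝ,
      ∫ t in Icc (0 : ℝ) T, G t (ρ t) = ∫ t in Icc (0 : ℝ) T, G t (ρ' t) := fun G =>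
    setIntegral_congr_fun measurableSet_Icc (fun t ht => by simp only [h t ht])
  unfold RateI
  refine iSup_congr fun f => ?_
  rw [h T ⟨hT, le_rfl⟩, h 0 ⟨le_rfl, hT⟩]
  exact congrArg ENNReal.ofReal (congrArg₂ HSub.hSub (congrArg₂ HSub.hSub rfl
    (key fun t ν => ∫ x, (tder f.1 (t, x) +
      Lop m γ V ψ (ν : Measure (Phase d)) f.1 (t, x)) ∂(ν : Measure (Phase d))))
    (congrArg (γ ^ 2 / 2 * ·) (key fun t ν => ∫ x, (∑ i, (pderT f.1 (t, x) i) ^ 2)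
      ∂(ν : Measure (Phase d)))))

theorem limRate_congr {d : ℕ} {T : ℝ} {V ψ : (Fin d → ℝ) → ℝ} (hT : 0 ≤ T)
    {σ σ' : ℝ → ProbabilityMeasure (Fin d → ℝ)} (h : ∀ t ∈ Icc (0 : ℝ) T, σ t = σ' t) :
    LimRate T V ψ σ = LimRate T V ψ σ' := by
  have key : ∀ G : ℝ → ProbabilityMeasure (Fin d → ℝ) → ℝ,
      ∫ t in Icc (0 : ℝ) T, G t (σ t) = ∫ t in Icc (0 : ℝ) T, G t (σ' t) := fun G =>
    setIntegral_congr_fun measurableSet_Icc (fun t ht => by simp only [h t ht])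
  unfold LimRate
  refine iSup_congr fun g => ?_
  rw [h T ⟨hT, le_rfl⟩, h 0 ⟨le_rfl, hT⟩]
  exact congrArg ENNReal.ofReal (congrArg₂ HSub.hSub (congrArg₂ HSub.hSub rfl
    (key fun t ν => ∫ q, (tderQ g.1 (t, q)
              - (∑ i, fderiv ℝ V q (Pi.single i 1) * qderQ g.1 (t, q) i)
              - (∑ i, (∫ q', fderiv ℝ ψ (q - q') (Pi.single i 1)
                  ∂(ν : Measure (Fin d → ℝ))) * qderQ g.1 (t, q) i)
              + laplQ g.1 (t, q)) ∂(ν : Measure (Fin d → ℝ))))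
    (congrArg (1 / 2 * ·) (key fun t ν => ∫ q, (∑ i, (qderQ g.1 (t, q) i) ^ 2)
      ∂(ν : Measure (Fin d → ℝ)))))

section SpaceTime

variable {X : Type*} [TopologicalSpace X] [MeasurableSpace X] [BorelSpace X]
  [HasOuterApproxClosed X]

theorem measurable_toMeasure_of_continuous {ρ : ℝ → ProbabilityMeasure X} (hρ : Continuous ρ) :
    Measurable (fun t => (ρ t : Measure X)) := by
  refine Measurable.measure_of_isPiSystem_of_isProbabilityMeasure
    (BorelSpace.measurable_eq (α := X)) isPiSystem_isOpen ?_
  intro s hs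
  have : LowerSemicontinuous (fun t => (ρ t : Measure X) s) := by
    intro t
    refine lowerSemicontinuousAt_iff_le_liminf.2 ?_
    exact ProbabilityMeasure.le_liminf_measure_open_of_tendsto (hρ.tendsto t) hs
  exact this.measurable

/-- The Markov kernel `t ↦ ρ_t` of a narrowly continuous curve of probability measures. -/
def curveKernel (ρ : ℝ → ProbabilityMeasure X) (hρ : Continuous ρ) :
    ProbabilityTheory.Kernel ℝ X :=
  ⟨fun t => (ρ t : Measure X), measurable_toMeasure_of_continuous hρ⟩

@[simp] theorem curveKernel_apply (ρ : ℝ → ProbabilityMeasure X) (hρ : Continuous ρ) (t : ℝ) :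
    curveKernel ρ hρ t = (ρ t : Measure X) := rfl

instance (ρ : ℝ → ProbabilityMeasure X) (hρ : Continuous ρ) :
    ProbabilityTheory.IsMarkovKernel (curveKernel ρ hρ) :=
  ⟨fun t => by rw [curveKernel_apply]; infer_instance⟩

/-- The space-time measure `dt ⊗ ρ_t` on `[0,T] × X`. -/
def spaceTime (T : ℝ) (ρ : ℝ → ProbabilityMeasure X) (hρ : Continuous ρ) : Measure (ℝ × X) :=
  (volume.restrict (Icc (0 : ℝ) T)).compProd (curveKernel ρ hρ)

instance (T : ℝ) (ρ : ℝ → ProbabilityMeasure X) (hρ : Continuous ρ) :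
    IsFiniteMeasure (spaceTime T ρ hρ) := by
  unfold spaceTime; infer_instance

theorem integral_spaceTime {T : ℝ} {ρ : ℝ → ProbabilityMeasure X} {hρ : Continuous ρ}
    {F : ℝ × X → ℝ} (hF : Integrable F (spaceTime T ρ hρ)) :
    ∫ z, F z ∂(spaceTime T ρ hρ) = ∫ t in Icc (0 : ℝ) T, ∫ x, F (t, x) ∂(ρ t : Measure X) :=
  Measure.integral_compProd hF

theorem ae_spaceTime_of_forall {T : ℝ} {ρ : ℝ → ProbabilityMeasure X} {hρ : Continuous ρ}
    {p : ℝ × X → Prop} (hp : MeasurableSet {z | p z})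
    (h : ∀ t ∈ Icc (0 : ℝ) T, ∀ x, p (t, x)) :
    ∀ᵐ z ∂(spaceTime T ρ hρ), p z := by
  unfold spaceTime
  rw [Measure.ae_compProd_iff hp]
  filter_upwards [ae_restrict_mem measurableSet_Icc] with t ht
  exact Eventually.of_forall (h t ht)

theorem integrable_of_measurable_bdd {Y : Type*} [MeasurableSpace Y] {μ : Measure Y}
    [IsFiniteMeasure μ] {F : Y → ℝ} (hF : Measurable F) {M : ℝ} (hM : ∀ y, |F y| ≤ M) :
    Integrable F μ :=
  Integrable.of_bound hF.aestronglyMeasurable M (Eventually.of_forall hM)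

end SpaceTime

/-- The pushforward of a continuous curve of measures under a continuous map. -/
def pushCurve {X Y : Type*} [MeasurableSpace X] [MeasurableSpace Y] (f : X → Y)
    (hf : Measurable f) (ρ : ℝ → ProbabilityMeasure X) (t : ℝ) : ProbabilityMeasure Y :=
  (ρ t).map hf.aemeasurable

/-- Narrow convergence at almost every time implies convergence of space-time integrals of
bounded continuous functions. -/
theorem tendsto_integral_spaceTime {X : Type*} [TopologicalSpace X] [MeasurableSpace X]
    [BorelSpace X] [HasOuterApproxClosed X] [SecondCountableTopology X] {T : ℝ}
    {σs : ℕ → ℝ → ProbabilityMeasure X} {σ : ℝ → ProbabilityMeasure X}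
    (hs : ∀ n, Continuous (σs n)) (h : Continuous σ)
    (hconv : ∀ t ∈ Icc (0 : ℝ) T, Tendsto (fun n => σs n t) atTop (𝓝 (σ t)))
    {F : ℝ × X → ℝ} (hF : Continuous F) {M : ℝ} (hM : ∀ z, |F z| ≤ M) :
    Tendsto (fun n => ∫ z, F z ∂(spaceTime T (σs n) (hs n))) atTop
      (𝓝 (∫ z, F z ∂(spaceTime T σ h))) := by
  have hint : ∀ (ρ : ℝ → ProbabilityMeasure X) (hρ : Continuous ρ),
      Integrable F (spaceTime T ρ hρ) := fun ρ hρ =>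
    integrable_of_measurable_bdd hF.measurable hM
  simp_rw [integral_spaceTime (hint _ _)]
  refine tendsto_integral_of_dominated_convergence (fun _ => M) (fun n => ?_)
    (integrable_const M) (fun n => ?_) ?_
  · have : StronglyMeasurable (fun t => ∫ x, F (t, x) ∂(curveKernel (σs n) (hs n) t)) :=
      MeasureTheory.StronglyMeasurable.integral_kernel_prod_right'
        hF.measurable.stronglyMeasurable
    exact this.aestronglyMeasurable
  · refine Eventually.of_forall fun t => ?_
    have := norm_integral_le_of_norm_le_const (μ := (σs n t : Measure X)) (f := fun x => F (t, x))
      (C := M) (Eventually.of_forall fun x => hM (t, x))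
    simpa using this
  · filter_upwards [ae_restrict_mem measurableSet_Icc] with t ht
    have h1 := ProbabilityMeasure.tendsto_iff_forall_integral_tendsto.1 (hconv t ht)
      (BoundedContinuousFunction.ofNormedAddCommGroup (fun x => F (t, x))
        (by fun_prop) M (fun x => hM _))
    simpa using h1

theorem integrable_of_integrable_sq {Y : Type*} [MeasurableSpace Y] {ν : Measure Y}
    [IsFiniteMeasure ν] {h : Y → ℝ} (hh : Measurable h) (hν : Integrable (fun y => h y ^ 2) ν) :
    Integrable h ν := by
  refine Integrable.mono' (hν.add (integrable_const (1 : ℝ))) (by fun_prop)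
    (Eventually.of_forall fun y => ?_)
  rw [Real.norm_eq_abs, Pi.add_apply, ← sq_abs (h y)]
  nlinarith [sq_nonneg (|h y| - 1)]

/-- Convergence of integrals of a continuous function with uniformly bounded second moments. -/
theorem tendsto_integral_of_sq_bound {Y : Type*} [TopologicalSpace Y] [MeasurableSpace Y]
    [BorelSpace Y] {μs : ℕ → Measure Y} {μ : Measure Y} [∀ n, IsFiniteMeasure (μs n)]
    [IsFiniteMeasure μ]
    (hconv : ∀ F : Y → ℝ, Continuous F → (∃ M, ∀ y, |F y| ≤ M) →
      Tendsto (fun n => ∫ y, F y ∂(μs n)) atTop (𝓝 (∫ y, F y ∂μ)))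
    {h : Y → ℝ} (hh : Continuous h) {C : ℝ}
    (hb : ∀ᶠ n in atTop, Integrable (fun y => h y ^ 2) (μs n) ∧ ∫ y, h y ^ 2 ∂(μs n) ≤ C) :
    Integrable h μ ∧ Tendsto (fun n => ∫ y, h y ∂(μs n)) atTop (𝓝 (∫ y, h y ∂μ)) := by
  -- truncations of `h ^ 2` pass to the limit
  have h2 : ∀ N : ℕ, ∫ y, min (h y ^ 2) N ∂μ ≤ C := fun N => by
    refine le_of_tendsto (hconv (fun y => min (h y ^ 2) N) (by fun_prop) ⟨N, fun y => ?_⟩) ?_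
    · rw [abs_of_nonneg (by positivity)]; exact min_le_right _ _
    · filter_upwards [hb] with n hn
      refine (integral_mono_of_nonneg (Eventually.of_forall fun y => by positivity) hn.1
        (Eventually.of_forall fun y => min_le_left _ _)).trans hn.2
  have hC : 0 ≤ C := (integral_nonneg (fun y => by positivity)).trans (h2 0)
  have h3 : ∫⁻ y, ENNReal.ofReal (h y ^ 2) ∂μ ≤ ENNReal.ofReal C := by
    have : ∀ y, ENNReal.ofReal (h y ^ 2)
        = ⨆ N : ℕ, ENNReal.ofReal (min (h y ^ 2) N) := fun y => by
      refine le_antisymm ?_ (iSup_le fun N => ENNReal.ofReal_le_ofReal (min_le_left _ _))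
      obtain ⟨N, hN⟩ := exists_nat_ge (h y ^ 2)
      refine le_trans ?_ (le_iSup _ N)
      rw [min_eq_left hN]
    simp_rw [this]
    rw [lintegral_iSup (f := fun (N : ℕ) y => ENNReal.ofReal (min (h y ^ 2) N))
      (fun N => by fun_prop) (fun i j hij y =>
      ENNReal.ofReal_le_ofReal (min_le_min_left _ (by exact_mod_cast hij)))]
    refine iSup_le fun N => ?_
    rw [← ofReal_integral_eq_lintegral_ofReal]
    · exact ENNReal.ofReal_le_ofReal (h2 N)
    · refine integrable_of_measurable_bdd (M := N) (by fun_prop) fun y => ?_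
      rw [abs_of_nonneg (by positivity)]; exact min_le_right _ _
    · exact Eventually.of_forall fun y => by positivity
  have h4 : Integrable (fun y => h y ^ 2) μ := by
    refine ⟨by fun_prop, ?_⟩
    rw [hasFiniteIntegral_iff_ofReal (Eventually.of_forall fun y => by positivity)]
    exact h3.trans_lt ENNReal.ofReal_lt_top
  have h5 : ∫ y, h y ^ 2 ∂μ ≤ C := by
    rw [integral_eq_lintegral_of_nonneg_ae (Eventually.of_forall fun y => by positivity)
      (by fun_prop)]
    exact ENNReal.toReal_le_of_le_ofReal hC h3
  -- error of truncation
  let tr : ℝ → Y → ℝ := fun R y => max (-R) (min R (h y))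
  have htrb : ∀ R > 0, ∀ y, |tr R y| ≤ R := fun R hR y => by
    rw [abs_le]; exact ⟨le_max_left _ _, max_le (by linarith) (min_le_left _ _)⟩
  have htrc : ∀ R, Continuous (tr R) := fun R => by fun_prop
  have htre : ∀ R > 0, ∀ y, |h y - tr R y| ≤ h y ^ 2 / R := fun R hR y => by
    simp only [tr]
    rw [le_div_iff₀ hR]
    rcases le_total R (h y) with h1 | h1
    · rw [min_eq_left h1, max_eq_right (by linarith), abs_of_nonneg (by linarith)]
      nlinarith
    · rw [min_eq_right h1]
      rcases le_total (-R) (h y) with h2 | h2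
      · rw [max_eq_right h2]; simp; positivity
      · rw [max_eq_left h2, abs_of_nonpos (by linarith)]
        nlinarith
  have herr : ∀ (ν : Measure Y) [IsFiniteMeasure ν], Integrable (fun y => h y ^ 2) ν →
      ∫ y, h y ^ 2 ∂ν ≤ C → ∀ R > 0, |∫ y, h y ∂ν - ∫ y, tr R y ∂ν| ≤ C / R := by
    intro ν _ hν hνC R hR
    rw [← integral_sub (integrable_of_integrable_sq hh.measurable hν)
      (integrable_of_measurable_bdd (htrc R).measurable (htrb R hR))]
    refine (abs_integral_le_integral_abs).trans ?_
    refine (integral_mono_of_nonneg (Eventually.of_forall fun y => abs_nonneg _)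
      (hν.div_const R) (Eventually.of_forall (htre R hR))).trans ?_
    rw [integral_div]
    gcongr
  refine ⟨integrable_of_integrable_sq hh.measurable h4, ?_⟩
  rw [Metric.tendsto_atTop']
  intro ε hε
  obtain ⟨R, hR, hRε⟩ : ∃ R > 0, C / R < ε / 3 := by
    refine ⟨3 * (C + 1) / ε, by positivity, ?_⟩
    rw [div_div_eq_mul_div, div_lt_div_iff₀ (by positivity) (by positivity)]
    nlinarith
  have ht := hconv (tr R) (htrc R) ⟨R, htrb R hR⟩
  obtain ⟨N1, hN1⟩ := eventually_atTop.1 hb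
  obtain ⟨N2, hN2⟩ := Metric.tendsto_atTop.1 ht (ε / 3) (by positivity)
  refine ⟨max N1 N2, fun n hn => ?_⟩
  have e1 := hN1 n ((le_max_left _ _).trans hn.le)
  have e2 := hN2 n ((le_max_right _ _).trans hn.le)
  have e3 := herr (μs n) e1.1 e1.2 R hR
  have e4 := herr μ h4 h5 R hR
  rw [Real.dist_eq] at *
  rw [abs_lt] at *
  rw [abs_le] at e3 e4
  constructor <;> linarith [e3.1, e3.2, e4.1, e4.2, e2.1, e2.2]

theorem sq_norm_le_sum_sq {d : ℕ} (z : Fin d → ℝ) : ‖z‖ ^ 2 ≤ ∑ i, z i ^ 2 := by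
  have h : ‖z‖ ≤ √(∑ i, z i ^ 2) := by
    rw [pi_norm_le_iff_of_nonneg (Real.sqrt_nonneg _)]
    intro i
    rw [Real.norm_eq_abs]
    exact Real.abs_le_sqrt (Finset.single_le_sum (f := fun i => z i ^ 2)
      (fun j _ => sq_nonneg _) (Finset.mem_univ i))
  calc ‖z‖ ^ 2 ≤ √(∑ i, z i ^ 2) ^ 2 := by gcongr
    _ = _ := Real.sq_sqrt (Finset.sum_nonneg fun i _ => sq_nonneg _)

theorem fderiv_apply_eq_sum {d : ℕ} (A : (Fin d → ℝ) →L[ℝ] ℝ) (z : Fin d → ℝ) :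
    A z = ∑ i, z i * A (Pi.single i 1) := by
  have := LinearMap.pi_apply_eq_sum_univ (A : (Fin d → ℝ) →ₗ[ℝ] ℝ) z
  simp only [smul_eq_mul, ContinuousLinearMap.coe_coe] at this
  rw [this]
  refine Finset.sum_congr rfl fun i _ => ?_
  congr 2
  ext j
  simp [Pi.single_apply, eq_comm]

theorem integrable_exp_neg_mul_sum_sq {d : ℕ} {b : ℝ} (hb : 0 < b) :
    Integrable (fun z : Fin d → ℝ => Real.exp (-b * ∑ i, z i ^ 2)) volume := by
  have := Integrable.fintype_prod (ι := Fin d) (f := fun _ (x : ℝ) => Real.exp (-b * x ^ 2))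
    (μ := fun _ => volume) (fun i => integrable_exp_neg_mul_sq hb)
  refine this.congr (Eventually.of_forall fun z => ?_)
  simp only [← Real.exp_sum, Finset.mul_sum]

theorem lintegral_exp_grad_sq_lt_top {d : ℕ} {V : (Fin d → ℝ) → ℝ} (hV : ContDiff ℝ 2 V)
    {K : ℝ} (hK0 : 0 ≤ K) (hK : ∀ q, ‖fderiv ℝ (fderiv ℝ V) q‖ ≤ K)
    (hint : Integrable (fun q => Real.exp (-V q)) (volume : Measure (Fin d → ℝ))) :
    ∫⁻ q, ENNReal.ofReal (Real.exp
      ((∑ i, (fderiv ℝ V q (Pi.single i 1)) ^ 2) / (4 * (K + 1)) - V q)) < ⊤ := by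
  set b := K + 1 with hb
  have hb0 : 0 < b := by positivity
  have hVc : Continuous V := hV.continuous
  have hGc : Continuous (fun z : Fin d → ℝ => Real.exp (-b * ∑ i, z i ^ 2)) := by fun_prop
  set c := ∫⁻ z : Fin d → ℝ, ENNReal.ofReal (Real.exp (-b * ∑ i, z i ^ 2)) with hc
  have hc0 : c ≠ 0 := by
    rw [hc, Ne, lintegral_eq_zero_iff (by fun_prop)]
    intro h
    obtain ⟨z, hz⟩ := h.exists
    simp only [Pi.zero_apply, ENNReal.ofReal_eq_zero] at hz
    exact absurd (Real.exp_pos _) (not_lt.2 hz)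
  have hctop : c ≠ ⊤ := (integrable_exp_neg_mul_sum_sq hb0).lintegral_lt_top.ne
  have key : ∀ q, c * ENNReal.ofReal (Real.exp
      ((∑ i, (fderiv ℝ V q (Pi.single i 1)) ^ 2) / (4 * b) - V q)) ≤
      ∫⁻ z, ENNReal.ofReal (Real.exp (-V (q + z))) *
        ENNReal.ofReal (Real.exp (-1 * ∑ i, z i ^ 2)) := by
    intro q
    set a : Fin d → ℝ := fun i => fderiv ℝ V q (Pi.single i 1) with ha
    rw [hc, ← lintegral_add_right_eq_self _ (fun i => a i / (2 * b)),
      ← lintegral_mul_const' _ _ ENNReal.ofReal_ne_top]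
    refine lintegral_mono fun z => ?_
    simp only
    rw [← ENNReal.ofReal_mul (Real.exp_nonneg _), ← ENNReal.ofReal_mul (Real.exp_nonneg _),
      ← Real.exp_add, ← Real.exp_add]
    refine ENNReal.ofReal_le_ofReal (Real.exp_le_exp.2 ?_)
    have h1 := (abs_le.1 (abs_taylor_le hV hK q z)).2
    have h2 := sq_norm_le_sum_sq z
    have h3 : fderiv ℝ V q z = ∑ i, z i * a i := fderiv_apply_eq_sum _ _
    have h4 : -b * ∑ i, (z + fun i => a i / (2 * b)) i ^ 2 + ((∑ i, a i ^ 2) / (4 * b)) =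
        -b * ∑ i, z i ^ 2 - ∑ i, z i * a i := by
      rw [Finset.sum_div, Finset.mul_sum, Finset.mul_sum, ← Finset.sum_add_distrib,
        ← Finset.sum_sub_distrib]
      refine Finset.sum_congr rfl fun i _ => ?_
      simp only [Pi.add_apply]
      field_simp
      ring
    have h5 : K * ‖z‖ ^ 2 ≤ K * ∑ i, z i ^ 2 := by gcongr
    have h6 : b * ∑ i, z i ^ 2 = K * ∑ i, z i ^ 2 + ∑ i, z i ^ 2 := by rw [hb]; ring
    linarith
  have h1 : c * ∫⁻ q, ENNReal.ofReal (Real.exp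
      ((∑ i, (fderiv ℝ V q (Pi.single i 1)) ^ 2) / (4 * b) - V q)) < ⊤ := by
    rw [← lintegral_const_mul' _ _ hctop]
    refine (lintegral_mono key).trans_lt ?_
    rw [lintegral_lintegral_swap (by fun_prop)]
    have : ∀ z : Fin d → ℝ, ∫⁻ q, ENNReal.ofReal (Real.exp (-V (q + z))) *
        ENNReal.ofReal (Real.exp (-1 * ∑ i, z i ^ 2)) =
        (∫⁻ q, ENNReal.ofReal (Real.exp (-V q))) *
          ENNReal.ofReal (Real.exp (-1 * ∑ i, z i ^ 2)) := fun z => by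
      rw [lintegral_mul_const' _ _ ENNReal.ofReal_ne_top,
        lintegral_add_right_eq_self (fun q => ENNReal.ofReal (Real.exp (-V q)))]
    simp_rw [this]
    rw [lintegral_const_mul' _ _ hint.lintegral_lt_top.ne]
    exact ENNReal.mul_lt_top hint.lintegral_lt_top
      (integrable_exp_neg_mul_sum_sq one_pos).lintegral_lt_top
  refine lt_top_iff_ne_top.2 fun h => ?_
  rw [h, ENNReal.mul_top hc0] at h1
  exact lt_irrefl _ h1

/-- The finite difference `V(q + e_i) - V(q)`, a smooth substitute for `∂_i V`. -/
def unitDiff {d : ℕ} (V : (Fin d → ℝ) → ℝ) (i : Fin d) (q : Fin d → ℝ) : ℝ :=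
  V (q + Pi.single i 1) - V q

theorem abs_unitDiff_sub_le {d : ℕ} {V : (Fin d → ℝ) → ℝ} (hV : ContDiff ℝ 2 V)
    {K : ℝ} (hK : ∀ q, ‖fderiv ℝ (fderiv ℝ V) q‖ ≤ K) (i : Fin d) (q : Fin d → ℝ) :
    |unitDiff V i q - fderiv ℝ V q (Pi.single i 1)| ≤ K := by
  have := abs_taylor_le hV hK q (Pi.single i 1)
  rw [Pi.norm_single] at this
  simpa [unitDiff] using this

theorem contDiff_unitDiff {d : ℕ} {V : (Fin d → ℝ) → ℝ} (hV : ContDiff ℝ 2 V) (i : Fin d) :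
    ContDiff ℝ 2 (unitDiff V i) := by
  unfold unitDiff; fun_prop

/-- The weight `∑ B_i(q)² + |p|²`. -/
def phaseWeight {d : ℕ} (V : (Fin d → ℝ) → ℝ) (x : Phase d) : ℝ :=
  ∑ i, unitDiff V i x.1 ^ 2 + ∑ i, x.2 i ^ 2

theorem integrable_exp_phaseWeight {d : ℕ} {m : ℝ} {V ψ : (Fin d → ℝ) → ℝ}
    (hyp : PotentialHyp d m V ψ) : IsFiniteMeasure (gibbs d m V) ∧
    ∃ δ > 0, Integrable (fun x => Real.exp (δ * phaseWeight V x)) (gibbs d m V) := by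
  obtain ⟨K, hK⟩ := hyp.V_hess_bdd
  have hK0 : 0 ≤ K := (norm_nonneg (fderiv ℝ (fderiv ℝ V) 0)).trans (hK 0)
  have hm := hyp.hm
  have hVc : Continuous V := hyp.V_smooth.continuous
  have hBc : ∀ i, Continuous (unitDiff V i) := fun i => (contDiff_unitDiff hyp.V_smooth i).continuous
  have hHc : Continuous (Hfun m V) := by unfold Hfun; fun_prop
  have hSc : Continuous (phaseWeight V) := by unfold phaseWeight; fun_prop
  set A : (Fin d → ℝ) → ℝ := fun q =>
    Real.exp ((∑ i, (fderiv ℝ V q (Pi.single i 1)) ^ 2) / (4 * (K + 1)) - V q) with hA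
  have hDc : Continuous (fderiv ℝ V) := hyp.V_smooth.continuous_fderiv (by norm_num)
  have hAc : Continuous A := by
    have : ∀ i : Fin d, Continuous fun q => fderiv ℝ V q (Pi.single i 1) :=
      fun i => hDc.clm_apply continuous_const
    rw [hA]; fun_prop
  have hAi : Integrable A volume := by
    refine ⟨hAc.aestronglyMeasurable, ?_⟩
    rw [hasFiniteIntegral_iff_ofReal (Eventually.of_forall fun q => Real.exp_nonneg _)]
    exact lintegral_exp_grad_sq_lt_top hyp.V_smooth hK0 hK hyp.V_exp_int
  have hprod : Integrable (fun x : Phase d => A x.1 * Real.exp (-(1 / (4 * m)) * ∑ i, x.2 i ^ 2))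
      volume :=
    hAi.mul_prod (integrable_exp_neg_mul_sum_sq (by positivity))
  set δ := min (1 / (8 * (K + 1))) (1 / (4 * m)) with hδ
  have hδ0 : 0 < δ := by positivity
  have hmain : ∀ s ∈ Icc 0 δ, Integrable
      (fun x : Phase d => Real.exp (s * phaseWeight V x) * Real.exp (-(Hfun m V x))) volume := by
    intro s hs
    refine Integrable.mono' (hprod.const_mul (Real.exp (δ * ∑ _i : Fin d, 2 * K ^ 2)))
      (by fun_prop) (Eventually.of_forall fun x => ?_)
    rw [Real.norm_eq_abs, abs_of_nonneg (by positivity), hA, ← Real.exp_add, ← Real.exp_add,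
      ← Real.exp_add, Real.exp_le_exp]
    have hS0 : 0 ≤ phaseWeight V x := by unfold phaseWeight; positivity
    have h1 : s * phaseWeight V x ≤ δ * phaseWeight V x := by gcongr; exact hs.2
    have h2 : ∑ i, unitDiff V i x.1 ^ 2 ≤ 2 * (∑ i, (fderiv ℝ V x.1 (Pi.single i 1)) ^ 2) +
        ∑ _i : Fin d, 2 * K ^ 2 := by
      rw [Finset.mul_sum, ← Finset.sum_add_distrib]
      refine Finset.sum_le_sum fun i _ => ?_
      have h := abs_le.1 (abs_unitDiff_sub_le hyp.V_smooth hK i x.1)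
      have h' : (unitDiff V i x.1 - fderiv ℝ V x.1 (Pi.single i 1)) ^ 2 ≤ K ^ 2 := by
        rw [sq_le_sq, abs_of_nonneg hK0]
        exact abs_unitDiff_sub_le hyp.V_smooth hK i x.1
      nlinarith [sq_nonneg (unitDiff V i x.1 - 2 * fderiv ℝ V x.1 (Pi.single i 1))]
    set g := ∑ i, (fderiv ℝ V x.1 (Pi.single i 1)) ^ 2
    set P := ∑ i, x.2 i ^ 2
    have hg : 0 ≤ g := by positivity
    have hP : 0 ≤ P := by positivity
    have h3 : δ * (2 * g) ≤ g / (4 * (K + 1)) := by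
      calc δ * (2 * g) ≤ (1 / (8 * (K + 1))) * (2 * g) := by gcongr; exact min_le_left _ _
        _ = _ := by field_simp; ring
    have h4 : δ * P ≤ P / (4 * m) := by
      calc δ * P ≤ (1 / (4 * m)) * P := by gcongr; exact min_le_right _ _
        _ = _ := by field_simp
    have h5 : δ * phaseWeight V x ≤ δ * (2 * g + ∑ _i : Fin d, 2 * K ^ 2 + P) := by
      unfold phaseWeight; gcongr
    have h6 : Hfun m V x = P / (4 * m) + P / (4 * m) + V x.1 := by
      unfold Hfun; simp only [P]; field_simp; ring
    have h7 : -(1 / (4 * m)) * P = - (P / (4 * m)) := by field_simp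
    rw [h6, h7]
    linarith
  have hZi : Integrable (fun x : Phase d => Real.exp (-(Hfun m V x))) volume := by
    simpa using hmain 0 ⟨le_rfl, hδ0.le⟩
  have hZ : 0 < gibbsZ d m V := integral_exp_pos hZi
  have hZ' : (ENNReal.ofReal (gibbsZ d m V))⁻¹ ≠ ⊤ := by simpa using hZ
  refine ⟨?_, δ, hδ0, ?_⟩
  · have := isFiniteMeasure_withDensity_ofReal hZi.2
    exact Measure.smul_finite _ hZ'
  · refine Integrable.smul_measure ?_ hZ'
    rw [integrable_withDensity_iff (by fun_prop) (Eventually.of_forall fun _ => ENNReal.ofReal_lt_top)]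
    refine (hmain δ ⟨hδ0.le, le_rfl⟩).congr (Eventually.of_forall fun x => ?_)
    simp only [ENNReal.toReal_ofReal (Real.exp_nonneg _)]

/-- Entropy inequality: exponential integrability bounds moments of measures with bounded
relative entropy. -/
theorem exists_lintegral_le_of_relEntDV_le {d : ℕ} {ζ : Measure (Phase d)} [IsFiniteMeasure ζ]
    {S : Phase d → ℝ} (hS : Continuous S) (hS0 : ∀ x, 0 ≤ S x)
    (hexp : Integrable (fun x => Real.exp (S x)) ζ) {C : ℝ≥0∞} (hC : C ≠ ⊤) :
    ∃ R : ℝ, ∀ ν : ProbabilityMeasure (Phase d), relEntDV (ν : Measure (Phase d)) ζ ≤ C →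
      ∫⁻ x, ENNReal.ofReal (S x) ∂(ν : Measure (Phase d)) ≤ ENNReal.ofReal R := by
  set I := ∫ x, Real.exp (S x + 1) ∂ζ with hI
  have hIi : Integrable (fun x => Real.exp (S x + 1)) ζ := by
    simp_rw [Real.exp_add]; exact hexp.mul_const _
  refine ⟨C.toReal + Real.log (max 1 I) + 1, fun ν hν => ?_⟩
  set χ : ℕ → Phase d → ℝ := fun N x => max 0 (min 1 ((N : ℝ) + 1 - ‖x‖)) with hχ
  have hχ0 : ∀ N x, 0 ≤ χ N x := fun N x => le_max_left _ _
  have hχ1 : ∀ N x, χ N x ≤ 1 := fun N x => max_le zero_le_one (min_le_left _ _)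
  have hχc : ∀ N, Continuous (χ N) := fun N => by fun_prop
  have hχs : ∀ N, HasCompactSupport (fun x => χ N x * S x) := fun N => by
    refine HasCompactSupport.of_support_subset_isCompact
      (isCompact_closedBall (0 : Phase d) ((N : ℝ) + 1)) fun x hx => ?_
    by_contra h
    rw [mem_closedBall_zero_iff, not_le] at h
    apply hx
    have : χ N x = 0 := by
      simp only [hχ]
      exact max_eq_left ((min_le_right _ _).trans (by linarith))
    simp [this]
  have hN : ∀ N, ∫ x, χ N x * S x ∂(ν : Measure (Phase d)) ≤
      C.toReal + Real.log (max 1 I) + 1 := fun N => by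
    have hfc : Continuous (fun x => χ N x * S x) := (hχc N).mul hS
    obtain ⟨φ, hφ, hφd, hφs⟩ := hfc.exists_contDiff_approx ⊤ (ε := fun _ => 1)
      continuous_const (fun _ => one_pos)
    have hφt : IsTestFn φ := ⟨hφ, (hχs N).mono hφs⟩
    have h1 : (∫ x, φ x ∂(ν : Measure (Phase d))) - Real.log (∫ x, Real.exp (φ x) ∂ζ)
        ≤ C.toReal := by
      have := (le_iSup (fun φ : {φ : Phase d → ℝ // IsTestFn φ} => ENNReal.ofReal
        ((∫ x, φ.1 x ∂(ν : Measure (Phase d))) - Real.log (∫ x, Real.exp (φ.1 x) ∂ζ)))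
        ⟨φ, hφt⟩).trans hν
      rwa [ENNReal.ofReal_le_iff_le_toReal hC] at this
    have hle : ∀ x, φ x ≤ S x + 1 := fun x => by
      have := (abs_lt.1 (Real.dist_eq _ _ ▸ hφd x)).2
      have h2 : χ N x * S x ≤ 1 * S x := by gcongr; exacts [hS0 x, hχ1 N x]
      linarith
    have h2 : Real.log (∫ x, Real.exp (φ x) ∂ζ) ≤ Real.log (max 1 I) := by
      have h3 : ∫ x, Real.exp (φ x) ∂ζ ≤ I :=
        integral_mono_of_nonneg (Eventually.of_forall fun x => Real.exp_nonneg _) hIi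
          (Eventually.of_forall fun x => Real.exp_le_exp.2 (hle x))
      have h0 : 0 ≤ ∫ x, Real.exp (φ x) ∂ζ := integral_nonneg fun x => Real.exp_nonneg _
      rcases h0.eq_or_lt with h0 | h0
      · rw [← h0, Real.log_zero]; exact Real.log_nonneg (le_max_left _ _)
      · exact Real.log_le_log h0 (h3.trans (le_max_right _ _))
    have hφi : Integrable φ (ν : Measure (Phase d)) :=
      hφ.continuous.integrable_of_hasCompactSupport hφt.2
    have h4 : ∫ x, χ N x * S x ∂(ν : Measure (Phase d)) ≤
        ∫ x, (φ x + 1) ∂(ν : Measure (Phase d)) := by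
      refine integral_mono (hfc.integrable_of_hasCompactSupport (hχs N))
        (hφi.add (integrable_const _)) fun x => ?_
      have := (abs_lt.1 (Real.dist_eq _ _ ▸ hφd x)).1
      simp only
      linarith
    rw [integral_add hφi (integrable_const _)] at h4
    simp at h4
    linarith
  have hsup : ∀ x, ENNReal.ofReal (S x) = ⨆ N : ℕ, ENNReal.ofReal (χ N x * S x) := fun x => by
    refine le_antisymm ?_ (iSup_le fun N => ENNReal.ofReal_le_ofReal
      (mul_le_of_le_one_left (hS0 x) (hχ1 N x)))
    obtain ⟨N, hN⟩ := exists_nat_ge ‖x‖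
    refine le_trans ?_ (le_iSup _ N)
    have : χ N x = 1 := by
      simp only [hχ]
      rw [min_eq_left (by linarith), max_eq_right zero_le_one]
    rw [this, one_mul]
  simp_rw [hsup]
  rw [lintegral_iSup (f := fun N x => ENNReal.ofReal (χ N x * S x))
    (fun N => by have := hχc N; fun_prop) ?_]
  · refine iSup_le fun N => ?_
    have hi : Integrable (fun x => χ N x * S x) (ν : Measure (Phase d)) :=
      ((hχc N).mul hS).integrable_of_hasCompactSupport (hχs N)
    rw [← ofReal_integral_eq_lintegral_ofReal hi
      (Eventually.of_forall fun x => mul_nonneg (hχ0 N x) (hS0 x))]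
    exact ENNReal.ofReal_le_ofReal (hN N)
  · intro i j hij x
    refine ENNReal.ofReal_le_ofReal (mul_le_mul_of_nonneg_right ?_ (hS0 x))
    simp only [hχ]
    have : (i : ℝ) ≤ j := by exact_mod_cast hij
    gcongr

section SumSq

variable {E ι : Type*} [NormedAddCommGroup E] [NormedSpace ℝ E] [Fintype ι]

/-- The function `1 + ∑ G_k²`. -/
def oneAddSumSq (G : ι → E → ℝ) (x : E) : ℝ := 1 + ∑ k, G k x ^ 2

omit [NormedAddCommGroup E] [NormedSpace ℝ E] in
theorem one_le_oneAddSumSq (G : ι → E → ℝ) (x : E) : 1 ≤ oneAddSumSq G x := by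
  unfold oneAddSumSq
  have : 0 ≤ ∑ k, G k x ^ 2 := Finset.sum_nonneg fun k _ => sq_nonneg _
  linarith

omit [NormedAddCommGroup E] [NormedSpace ℝ E] in
theorem abs_le_sqrt_oneAddSumSq (G : ι → E → ℝ) (x : E) (k : ι) :
    |G k x| ≤ √(oneAddSumSq G x) := by
  refine Real.abs_le_sqrt ?_
  have := Finset.single_le_sum (f := fun k => G k x ^ 2) (fun j _ => sq_nonneg _)
    (Finset.mem_univ k)
  unfold oneAddSumSq
  linarith

theorem contDiff_oneAddSumSq {G : ι → E → ℝ} (hG : ∀ k, ContDiff ℝ 2 (G k)) :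
    ContDiff ℝ 2 (oneAddSumSq G) := by
  unfold oneAddSumSq
  exact contDiff_const.add (ContDiff.sum fun k _ => (hG k).pow 2)

theorem fderiv_oneAddSumSq {G : ι → E → ℝ} (hG : ∀ k, ContDiff ℝ 2 (G k)) (x v : E) :
    fderiv ℝ (oneAddSumSq G) x v = ∑ k, 2 * G k x * fderiv ℝ (G k) x v := by
  have h : ∀ k, HasFDerivAt (fun y => G k y ^ 2) ((2 * G k x) • fderiv ℝ (G k) x) x := fun k => by
    have := (((hG k).differentiable (by norm_num)) x).hasFDerivAt.pow 2
    simpa using this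
  have h2 : HasFDerivAt (oneAddSumSq G) (∑ k, (2 * G k x) • fderiv ℝ (G k) x) x := by
    unfold oneAddSumSq
    exact (HasFDerivAt.fun_sum fun k _ => h k).const_add 1
  rw [h2.fderiv]
  simp

theorem fderiv_fderiv_apply {F : E → ℝ} (hF : ContDiff ℝ 2 F) (x v w : E) :
    fderiv ℝ (fun y => fderiv ℝ F y v) x w = fderiv ℝ (fderiv ℝ F) x w v := by
  have h1 : DifferentiableAt ℝ (fderiv ℝ F) x :=
    (hF.fderiv_right (m := 1) (by norm_num)).differentiable (by norm_num) x
  rw [(h1.hasFDerivAt.clm_apply (hasFDerivAt_const v x)).fderiv]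
  simp

theorem fderiv_fderiv_oneAddSumSq {G : ι → E → ℝ} (hG : ∀ k, ContDiff ℝ 2 (G k)) (x v w : E) :
    fderiv ℝ (fderiv ℝ (oneAddSumSq G)) x w v = ∑ k, 2 * (fderiv ℝ (G k) x w *
      fderiv ℝ (G k) x v + G k x * fderiv ℝ (fderiv ℝ (G k)) x w v) := by
  rw [← fderiv_fderiv_apply (contDiff_oneAddSumSq hG)]
  simp_rw [fderiv_oneAddSumSq hG]
  have h : ∀ k, HasFDerivAt (fun y => 2 * G k y * fderiv ℝ (G k) y v)
      ((2 * G k x) • fderiv ℝ (fun y => fderiv ℝ (G k) y v) x +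
        (fderiv ℝ (G k) x v) • ((2 : ℝ) • fderiv ℝ (G k) x)) x := fun k => by
    have h1 := (((hG k).differentiable (by norm_num)) x).hasFDerivAt.const_mul (2 : ℝ)
    have h2 : DifferentiableAt ℝ (fun y => fderiv ℝ (G k) y v) x :=
      (((hG k).fderiv_right (m := 1) (by norm_num)).differentiable (by norm_num) x).clm_apply
        (differentiableAt_const v)
    exact h1.mul h2.hasFDerivAt
  rw [(HasFDerivAt.fun_sum fun k (_ : k ∈ Finset.univ) => h k).fderiv,
    _root_.sum_apply]
  refine Finset.sum_congr rfl fun k _ => ?_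
  simp only [_root_.add_apply, _root_.smul_apply, smul_eq_mul,
    fderiv_fderiv_apply (hG k)]
  ring

variable {G : ι → E → ℝ} (hG : ∀ k, ContDiff ℝ 2 (G k)) {L : ℝ} (hL0 : 0 ≤ L)
  (hL1 : ∀ k x, ‖fderiv ℝ (G k) x‖ ≤ L) (hL2 : ∀ k x, ‖fderiv ℝ (fderiv ℝ (G k)) x‖ ≤ L)

include hG hL0 hL1 in
theorem norm_fderiv_oneAddSumSq_le (x : E) :
    ‖fderiv ℝ (oneAddSumSq G) x‖ ≤ 2 * Fintype.card ι * L * √(oneAddSumSq G x) := by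
  refine ContinuousLinearMap.opNorm_le_bound _ (by positivity) fun v => ?_
  rw [fderiv_oneAddSumSq hG]
  refine (norm_sum_le _ _).trans ((Finset.sum_le_card_nsmul _ _
    (2 * √(oneAddSumSq G x) * (L * ‖v‖)) fun k _ => ?_).trans_eq ?_)
  · rw [norm_mul, norm_mul, Real.norm_ofNat, Real.norm_eq_abs]
    gcongr
    · exact abs_le_sqrt_oneAddSumSq G x k
    · exact (fderiv ℝ (G k) x).le_of_opNorm_le (hL1 k x) v
  · rw [Finset.card_univ, nsmul_eq_mul]; ring

include hG hL0 hL1 hL2 in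
theorem norm_fderiv_fderiv_oneAddSumSq_le (x : E) :
    ‖fderiv ℝ (fderiv ℝ (oneAddSumSq G)) x‖ ≤
      2 * Fintype.card ι * (L ^ 2 + L) * oneAddSumSq G x := by
  have hU := one_le_oneAddSumSq G x
  have hs : √(oneAddSumSq G x) ≤ oneAddSumSq G x := by
    rw [Real.sqrt_le_left (by linarith)]; nlinarith
  refine ContinuousLinearMap.opNorm_le_bound₂ _ (by positivity) fun w v => ?_
  rw [fderiv_fderiv_oneAddSumSq hG]
  refine (norm_sum_le _ _).trans ((Finset.sum_le_card_nsmul _ _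
    (2 * ((L * ‖w‖) * (L * ‖v‖) * oneAddSumSq G x +
      oneAddSumSq G x * (L * ‖w‖ * ‖v‖))) fun k _ => ?_).trans_eq ?_)
  · rw [norm_mul, Real.norm_ofNat]
    refine mul_le_mul_of_nonneg_left ((norm_add_le _ _).trans (add_le_add ?_ ?_)) (by norm_num)
    · rw [norm_mul]
      refine le_trans ?_ (le_mul_of_one_le_right (by positivity) hU)
      gcongr
      · exact (fderiv ℝ (G k) x).le_of_opNorm_le (hL1 k x) w
      · exact (fderiv ℝ (G k) x).le_of_opNorm_le (hL1 k x) v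
    · rw [norm_mul, Real.norm_eq_abs]
      gcongr
      · exact (abs_le_sqrt_oneAddSumSq G x k).trans hs
      · exact (fderiv ℝ (fderiv ℝ (G k)) x).le_of_opNorm₂_le_of_le (hL2 k x) le_rfl le_rfl
  · rw [Finset.card_univ, nsmul_eq_mul]; ring

/-- The bounded truncation `u / (1 + εu)`. -/
def trunc (ε u : ℝ) : ℝ := u / (1 + ε * u)

theorem hasFDerivAt_trunc_comp {U : E → ℝ} {U' : E →L[ℝ] ℝ} {x : E} (hU : HasFDerivAt U U' x)
    {ε : ℝ} (h0 : 1 + ε * U x ≠ 0) :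
    HasFDerivAt (fun y => trunc ε (U y)) (((1 + ε * U x) ^ 2)⁻¹ • U') x := by
  have h1 : HasDerivAt (trunc ε) (((1 + ε * U x) ^ 2)⁻¹) (U x) := by
    have h2 : HasDerivAt (fun u : ℝ => 1 + ε * u) ε (U x) := by
      simpa using ((hasDerivAt_id (U x)).const_mul ε).const_add 1
    have := (hasDerivAt_id (U x)).div h2 h0
    refine this.congr_deriv ?_
    simp only [id]
    field_simp
    ring
  exact h1.comp_hasFDerivAt x hU

theorem hasFDerivAt_inv_sq_comp {U : E → ℝ} {U' : E →L[ℝ] ℝ} {x : E} (hU : HasFDerivAt U U' x)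
    {ε : ℝ} (h0 : 1 + ε * U x ≠ 0) :
    HasFDerivAt (fun y => ((1 + ε * U y) ^ 2)⁻¹)
      ((-(2 * ε) * ((1 + ε * U x) ^ 3)⁻¹) • U') x := by
  have h1 : HasDerivAt (fun u : ℝ => ((1 + ε * u) ^ 2)⁻¹)
      (-(2 * ε) * ((1 + ε * U x) ^ 3)⁻¹) (U x) := by
    have h2 : HasDerivAt (fun u : ℝ => 1 + ε * u) ε (U x) := by
      simpa using ((hasDerivAt_id (U x)).const_mul ε).const_add 1
    have := (h2.pow 2).inv (pow_ne_zero 2 h0)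
    refine this.congr_deriv ?_
    simp only [Pi.pow_apply]
    field_simp
    push_cast
    ring
  exact h1.comp_hasFDerivAt x hU

theorem fderiv_fderiv_trunc_comp {U : E → ℝ} (hU : ContDiff ℝ 2 U) {ε : ℝ} (hε : 0 ≤ ε)
    (hU1 : ∀ x, 1 ≤ U x) (x : E) :
    fderiv ℝ (fderiv ℝ (fun y => trunc ε (U y))) x =
      ((1 + ε * U x) ^ 2)⁻¹ • fderiv ℝ (fderiv ℝ U) x +
      ((-(2 * ε) * ((1 + ε * U x) ^ 3)⁻¹) • fderiv ℝ U x).smulRight (fderiv ℝ U x) := by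
  have h0 : ∀ x, 1 + ε * U x ≠ 0 := fun x => by have := hU1 x; positivity
  have hd : ∀ x, HasFDerivAt U (fderiv ℝ U x) x := fun x =>
    (hU.differentiable (by norm_num) x).hasFDerivAt
  have h1 : fderiv ℝ (fun y => trunc ε (U y)) =
      fun x => ((1 + ε * U x) ^ 2)⁻¹ • fderiv ℝ U x :=
    funext fun x => (hasFDerivAt_trunc_comp (hd x) (h0 x)).fderiv
  rw [h1]
  have h2 : HasFDerivAt (fderiv ℝ U) (fderiv ℝ (fderiv ℝ U) x) x :=
    ((hU.fderiv_right (m := 1) (by norm_num)).differentiable (by norm_num) x).hasFDerivAt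
  exact ((hasFDerivAt_inv_sq_comp (hd x) (h0 x)).smul h2).fderiv

include hG hL0 hL1 hL2 in
theorem isCb2_trunc_oneAddSumSq {ε : ℝ} (hε : 0 < ε) :
    IsCb2 (fun x => trunc ε (oneAddSumSq G x)) := by
  set U := oneAddSumSq G with hUdef
  have hU : ContDiff ℝ 2 U := contDiff_oneAddSumSq hG
  have hU1 : ∀ x, 1 ≤ U x := one_le_oneAddSumSq G
  have h0 : ∀ x, 0 < 1 + ε * U x := fun x => by have := hU1 x; positivity
  set n : ℝ := (Fintype.card ι : ℝ) with hn
  have hle : ∀ x, ε * U x ≤ 1 + ε * U x := fun x => by linarith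
  have h1le : ∀ x, 1 ≤ 1 + ε * U x := fun x => by
    have := hU1 x
    have : 0 ≤ ε * U x := by positivity
    linarith
  have hUN : ∀ x, ((1 + ε * U x) ^ 2)⁻¹ * U x ≤ 1 / ε := fun x => by
    rw [inv_mul_eq_div, div_le_div_iff₀ (by have := h0 x; positivity) hε]
    nlinarith [hle x, h1le x]
  refine ⟨?_, 1 / ε + 2 * n * L * (1 / ε) + (2 * n * (L ^ 2 + L) * (1 / ε) +
    2 * (2 * n * L) ^ 2 * (1 / ε)), fun x => ?_⟩
  · unfold trunc
    exact hU.div (contDiff_const.add (contDiff_const.mul hU)) fun x => (h0 x).ne'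
  have hsq : √(U x) ≤ U x := by
    have := hU1 x
    rw [Real.sqrt_le_left (by linarith)]; nlinarith
  have hU0 : 0 ≤ U x := zero_le_one.trans (hU1 x)
  have hN0 := h0 x
  have b1 : |trunc ε (U x)| ≤ 1 / ε := by
    unfold trunc
    rw [abs_of_nonneg (by positivity), div_le_div_iff₀ hN0 hε]
    linarith [hle x]
  have b2 : ‖fderiv ℝ (fun x => trunc ε (U x)) x‖ ≤ 2 * n * L * (1 / ε) := by
    rw [(hasFDerivAt_trunc_comp (hU.differentiable (by norm_num) x).hasFDerivAt (h0 x).ne').fderiv,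
      norm_smul, Real.norm_of_nonneg (by positivity)]
    calc ((1 + ε * U x) ^ 2)⁻¹ * ‖fderiv ℝ U x‖
        ≤ ((1 + ε * U x) ^ 2)⁻¹ * (2 * n * L * U x) := by
          gcongr
          exact (norm_fderiv_oneAddSumSq_le hG hL0 hL1 x).trans (by gcongr)
      _ = 2 * n * L * (((1 + ε * U x) ^ 2)⁻¹ * U x) := by ring
      _ ≤ _ := by gcongr; exact hUN x
  have b3 : ‖fderiv ℝ (fderiv ℝ (fun x => trunc ε (U x))) x‖ ≤ 2 * n * (L ^ 2 + L) * (1 / ε) +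
      2 * (2 * n * L) ^ 2 * (1 / ε) := by
    rw [fderiv_fderiv_trunc_comp hU hε.le hU1]
    refine (norm_add_le (((1 + ε * U x) ^ 2)⁻¹ • fderiv ℝ (fderiv ℝ U) x) _).trans
      (add_le_add ?_ ?_)
    · rw [norm_smul, Real.norm_of_nonneg (by positivity : 0 ≤ ((1 + ε * U x) ^ 2)⁻¹)]
      calc ((1 + ε * U x) ^ 2)⁻¹ * ‖fderiv ℝ (fderiv ℝ U) x‖
          ≤ ((1 + ε * U x) ^ 2)⁻¹ * (2 * n * (L ^ 2 + L) * U x) := by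
            gcongr
            exact norm_fderiv_fderiv_oneAddSumSq_le hG hL0 hL1 hL2 x
        _ = 2 * n * (L ^ 2 + L) * (((1 + ε * U x) ^ 2)⁻¹ * U x) := by ring
        _ ≤ _ := by gcongr; exact hUN x
    · rw [ContinuousLinearMap.norm_smulRight_apply, norm_smul, norm_mul, norm_neg,
        Real.norm_of_nonneg (by positivity : (0 : ℝ) ≤ 2 * ε),
        Real.norm_of_nonneg (by positivity : 0 ≤ ((1 + ε * U x) ^ 3)⁻¹)]
      have h3 : ((1 + ε * U x) ^ 3)⁻¹ * ε ≤ ((1 + ε * U x) ^ 2)⁻¹ := by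
        rw [inv_mul_eq_div, ← one_div, div_le_div_iff₀ (by positivity) (by positivity)]
        have : ε ≤ 1 + ε * U x := by nlinarith [hU1 x]
        calc ε * (1 + ε * U x) ^ 2 ≤ (1 + ε * U x) * (1 + ε * U x) ^ 2 := by gcongr
          _ = _ := by ring
      calc 2 * ε * ((1 + ε * U x) ^ 3)⁻¹ * ‖fderiv ℝ U x‖ * ‖fderiv ℝ U x‖
          = 2 * (((1 + ε * U x) ^ 3)⁻¹ * ε) * (‖fderiv ℝ U x‖ * ‖fderiv ℝ U x‖) := by ring
        _ ≤ 2 * ((1 + ε * U x) ^ 2)⁻¹ * ((2 * n * L * √(U x)) * (2 * n * L * √(U x))) := by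
          have := norm_fderiv_oneAddSumSq_le hG hL0 hL1 x
          gcongr
        _ = 2 * (2 * n * L) ^ 2 * (((1 + ε * U x) ^ 2)⁻¹ * (√(U x) * √(U x))) := by ring
        _ = 2 * (2 * n * L) ^ 2 * (((1 + ε * U x) ^ 2)⁻¹ * U x) := by
          rw [Real.mul_self_sqrt hU0]
        _ ≤ _ := by gcongr; exact hUN x
  have p1 : 0 ≤ 1 / ε := by positivity
  have p2 : 0 ≤ 2 * n * L * (1 / ε) := by positivity
  have p3 : 0 ≤ 2 * n * (L ^ 2 + L) * (1 / ε) + 2 * (2 * n * L) ^ 2 * (1 / ε) := by positivity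
  exact ⟨by linarith, by linarith, by linarith⟩

end SumSq

section Product

variable {d : ℕ} {c : ℝ → ℝ} {h : Phase d → ℝ}

theorem fderiv_mul_prod (hc : Differentiable ℝ c) (hh : Differentiable ℝ h) (z : ℝ × Phase d)
    (s : ℝ) (v : Phase d) : fderiv ℝ (fun z : ℝ × Phase d => c z.1 * h z.2) z (s, v) =
      c z.1 * fderiv ℝ h z.2 v + s * deriv c z.1 * h z.2 := by
  have h1 : HasFDerivAt (fun z : ℝ × Phase d => c z.1)
      ((fderiv ℝ c z.1).comp (ContinuousLinearMap.fst ℝ ℝ (Phase d))) z :=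
    (hc z.1).hasFDerivAt.comp z hasFDerivAt_fst
  have h2 : HasFDerivAt (fun z : ℝ × Phase d => h z.2)
      ((fderiv ℝ h z.2).comp (ContinuousLinearMap.snd ℝ ℝ (Phase d))) z :=
    (hh z.2).hasFDerivAt.comp z hasFDerivAt_snd
  rw [show fderiv ℝ (fun z : ℝ × Phase d => c z.1 * h z.2) z = _ from (h1.mul h2).fderiv]
  simp only [_root_.add_apply, _root_.smul_apply,
    ContinuousLinearMap.comp_apply, ContinuousLinearMap.coe_fst', ContinuousLinearMap.coe_snd',
    smul_eq_mul]
  have : fderiv ℝ c z.1 s = s * deriv c z.1 := by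
    rw [← fderiv_apply_one_eq_deriv]
    conv_lhs => rw [show s = s • (1 : ℝ) by simp, map_smul, smul_eq_mul]
  rw [this]; ring

theorem laplPT_mul_prod (hc : Differentiable ℝ c) (hh : ContDiff ℝ 2 h) (z : ℝ × Phase d) :
    laplPT (fun z : ℝ × Phase d => c z.1 * h z.2) z =
      c z.1 * ∑ i, fderiv ℝ (fderiv ℝ h) z.2 (dirP i) (dirP i) := by
  unfold laplPT pderT
  rw [Finset.mul_sum]
  refine Finset.sum_congr rfl fun i _ => ?_
  simp_rw [fderiv_mul_prod hc (hh.differentiable (by norm_num))]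
  simp only [zero_mul, add_zero]
  have : Differentiable ℝ (fun y => fderiv ℝ h y (dirP i)) :=
    ((hh.fderiv_right (m := 1) (by norm_num)).differentiable (by norm_num)).clm_apply
      (differentiable_const _)
  rw [fderiv_mul_prod hc this, fderiv_fderiv_apply hh]
  ring

end Product

section CompLinear

variable {E F : Type*} [NormedAddCommGroup E] [NormedSpace ℝ E] [NormedAddCommGroup F]
  [NormedSpace ℝ F] {B : E → ℝ} (A : F →L[ℝ] E)

theorem fderiv_comp_clm_apply {x : F} (hB : DifferentiableAt ℝ B (A x)) (v : F) :
    fderiv ℝ (fun y => B (A y)) x v = fderiv ℝ B (A x) (A v) := by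
  have := hB.hasFDerivAt.comp x A.hasFDerivAt
  rw [show fderiv ℝ (fun y => B (A y)) x = _ from this.fderiv]
  rfl

theorem fderiv_fderiv_comp_clm_apply (hB : ContDiff ℝ 2 B) (x w v : F) :
    fderiv ℝ (fderiv ℝ (fun y => B (A y))) x w v = fderiv ℝ (fderiv ℝ B) (A x) (A w) (A v) := by
  rw [← fderiv_fderiv_apply (F := fun y => B (A y)) (hB.comp A.contDiff)]
  simp_rw [fderiv_comp_clm_apply A (hB.differentiable (by norm_num) _)]
  have : Differentiable ℝ (fun y => fderiv ℝ B y (A v)) :=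
    ((hB.fderiv_right (m := 1) (by norm_num)).differentiable (by norm_num)).clm_apply
      (differentiable_const _)
  rw [fderiv_comp_clm_apply (B := fun y => fderiv ℝ B y (A v)) A (this _), fderiv_fderiv_apply hB]

end CompLinear

/-- The coarse-graining map as a continuous linear map. -/
def xiL {d : ℕ} (γ : ℝ) : Phase d →L[ℝ] (Fin d → ℝ) :=
  ContinuousLinearMap.fst ℝ _ _ + γ⁻¹ • ContinuousLinearMap.snd ℝ _ _

theorem xiL_apply {d : ℕ} (γ : ℝ) (x : Phase d) : xiL γ x = xiGamma γ x := by
  ext i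
  simp [xiL, xiGamma, div_eq_inv_mul]

theorem xiL_dirQ {d : ℕ} (γ : ℝ) (i : Fin d) : xiL γ (dirQ i) = Pi.single i (1 : ℝ) := by
  simp [xiL, dirQ]

theorem xiL_dirP {d : ℕ} (γ : ℝ) (i : Fin d) : xiL γ (dirP i) = γ⁻¹ • Pi.single i (1 : ℝ) := by
  simp [xiL, dirP]

/-- The momentum coordinate `p_j / γ` as a continuous linear map. -/
def scaledMom {d : ℕ} (γ : ℝ) (j : Fin d) : Phase d →L[ℝ] ℝ :=
  γ⁻¹ • (ContinuousLinearMap.proj (R := ℝ) (φ := fun _ : Fin d => ℝ) j).comp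
    (ContinuousLinearMap.snd ℝ _ _)

theorem scaledMom_apply {d : ℕ} (γ : ℝ) (j : Fin d) (x : Phase d) :
    scaledMom γ j x = x.2 j / γ := by
  simp [scaledMom, div_eq_inv_mul]

/-- The functions `B_j(ξ^γ x)` and `p_j/γ`, whose squares make up the Lyapunov function. -/
def lyapFamily {d : ℕ} (γ : ℝ) (V : (Fin d → ℝ) → ℝ) : Fin d ⊕ Fin d → Phase d → ℝ :=
  Sum.elim (fun j x => unitDiff V j (xiL γ x)) (fun j x => scaledMom γ j x)

/-- The Lyapunov function `1 + ∑ B_j(q + p/γ)² + |p/γ|²`. -/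
def lyap {d : ℕ} (γ : ℝ) (V : (Fin d → ℝ) → ℝ) : Phase d → ℝ :=
  oneAddSumSq (lyapFamily γ V)

section Lyapunov

variable {d : ℕ} {V : (Fin d → ℝ) → ℝ}

theorem lyap_eq (γ : ℝ) (x : Phase d) :
    lyap γ V x = 1 + (∑ j, unitDiff V j (xiL γ x) ^ 2 + ∑ j, (x.2 j / γ) ^ 2) := by
  simp [lyap, oneAddSumSq, lyapFamily, Fintype.sum_sum_type, scaledMom_apply]

theorem contDiff_lyapFamily (hV : ContDiff ℝ 2 V) (γ : ℝ) (k : Fin d ⊕ Fin d) :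
    ContDiff ℝ 2 (lyapFamily γ V k) := by
  rcases k with j | j
  · exact (contDiff_unitDiff hV j).comp (xiL γ).contDiff
  · exact (scaledMom γ j).contDiff

theorem contDiff_lyap (hV : ContDiff ℝ 2 V) (γ : ℝ) : ContDiff ℝ 2 (lyap γ V) :=
  contDiff_oneAddSumSq (contDiff_lyapFamily hV γ)

theorem fderiv_unitDiff (hV : ContDiff ℝ 2 V) (j : Fin d) :
    fderiv ℝ (unitDiff V j) = fun q => fderiv ℝ V (q + Pi.single j 1) - fderiv ℝ V q := by
  funext q
  have hd := hV.differentiable (by norm_num)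
  unfold unitDiff
  rw [fderiv_fun_sub (by fun_prop) (hd q), fderiv_comp_add_right]

variable {K : ℝ} (hV : ContDiff ℝ 2 V) (hK : ∀ q, ‖fderiv ℝ (fderiv ℝ V) q‖ ≤ K)

include hV hK in
theorem norm_fderiv_unitDiff_le (j : Fin d) (q : Fin d → ℝ) :
    ‖fderiv ℝ (unitDiff V j) q‖ ≤ K := by
  rw [fderiv_unitDiff hV]
  refine (norm_fderiv_sub_le_of_second hV hK _ _).trans ?_
  simp [Pi.norm_single]

include hV hK in
theorem norm_fderiv_fderiv_unitDiff_le (j : Fin d) (q : Fin d → ℝ) :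
    ‖fderiv ℝ (fderiv ℝ (unitDiff V j)) q‖ ≤ 2 * K := by
  have hd : Differentiable ℝ (fderiv ℝ V) :=
    (hV.fderiv_right (m := 1) (by norm_num)).differentiable (by norm_num)
  rw [fderiv_unitDiff hV, fderiv_fun_sub (by fun_prop) (hd q),
    fderiv_comp_add_right (f := fderiv ℝ V)]
  refine (norm_sub_le _ _).trans ?_
  linarith [hK q, hK (q + Pi.single j 1)]

include hV hK in
theorem isCb2_trunc_lyap (γ : ℝ) {ε : ℝ} (hε : 0 < ε) :
    IsCb2 (fun x => trunc ε (lyap γ V x)) := by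
  have hK0 : 0 ≤ K := (norm_nonneg (fderiv ℝ (fderiv ℝ V) 0)).trans (hK 0)
  have hs : ∀ j, fderiv ℝ (fun x => scaledMom γ j x : Phase d → ℝ) =
    fun _ => scaledMom γ j := fun j => funext fun x => (scaledMom γ j).fderiv
  set a := ‖(xiL γ : Phase d →L[ℝ] (Fin d → ℝ))‖ with ha
  set b := ∑ j : Fin d, ‖(scaledMom γ j : Phase d →L[ℝ] ℝ)‖ with hb
  have hb0 : 0 ≤ b := Finset.sum_nonneg fun _ _ => norm_nonneg _
  refine isCb2_trunc_oneAddSumSq (contDiff_lyapFamily hV γ) (L := K * a + 2 * K * a ^ 2 + b)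
    (by positivity) ?_ ?_ hε
  · rintro (j | j) x
    · refine le_trans (b := K * a) ?_ (by have : 0 ≤ 2 * K * a ^ 2 := by positivity
                                          linarith)
      refine ContinuousLinearMap.opNorm_le_bound _ (by positivity) fun v => ?_
      change ‖fderiv ℝ (fun y => unitDiff V j (xiL γ y)) x v‖ ≤ _
      rw [fderiv_comp_clm_apply _ ((contDiff_unitDiff hV j).differentiable (by norm_num) _),
        mul_assoc]
      exact (fderiv ℝ (unitDiff V j) _).le_of_opNorm_le_of_le (norm_fderiv_unitDiff_le hV hK j _)
        ((xiL γ).le_opNorm v)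
    · refine le_trans (b := b) ?_ (by have : 0 ≤ K * a + 2 * K * a ^ 2 := by positivity
                                      linarith)
      change ‖fderiv ℝ (fun x => scaledMom γ j x : Phase d → ℝ) x‖ ≤ _
      rw [hs]
      exact Finset.single_le_sum (f := fun j => ‖(scaledMom γ j : Phase d →L[ℝ] ℝ)‖)
        (fun _ _ => norm_nonneg _) (Finset.mem_univ j)
  · rintro (j | j) x
    · refine le_trans (b := 2 * K * a ^ 2) ?_ (by have : 0 ≤ K * a := by positivity
                                                  linarith)
      refine ContinuousLinearMap.opNorm_le_bound₂ _ (by positivity) fun w v => ?_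
      change ‖fderiv ℝ (fderiv ℝ (fun y => unitDiff V j (xiL γ y))) x w v‖ ≤ _
      rw [fderiv_fderiv_comp_clm_apply _ (contDiff_unitDiff hV j)]
      refine ((fderiv ℝ (fderiv ℝ (unitDiff V j)) _).le_of_opNorm₂_le_of_le
        (norm_fderiv_fderiv_unitDiff_le hV hK j _)
        ((xiL γ).le_opNorm w) ((xiL γ).le_opNorm v)).trans_eq ?_
      rw [← ha]; ring
    · change ‖fderiv ℝ (fderiv ℝ (fun x => scaledMom γ j x : Phase d → ℝ)) x‖ ≤ _
      rw [hs, fderiv_fun_const]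
      refine (norm_zero (E := Phase d →L[ℝ] Phase d →L[ℝ] ℝ)).le.trans ?_
      positivity

/-- `∂_{q_i}` of the Lyapunov function. -/
def lyapQ (γ : ℝ) (V : (Fin d → ℝ) → ℝ) (x : Phase d) (i : Fin d) : ℝ :=
  ∑ j, 2 * unitDiff V j (xiL γ x) * fderiv ℝ (unitDiff V j) (xiL γ x) (Pi.single i 1)

/-- `γ ∂_{p_i}` of the Lyapunov function. -/
def lyapR (γ : ℝ) (V : (Fin d → ℝ) → ℝ) (x : Phase d) (i : Fin d) : ℝ :=
  lyapQ γ V x i + 2 * (x.2 i / γ)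

/-- `γ² ∂²_{p_i}` of the Lyapunov function. -/
def lyapS (γ : ℝ) (V : (Fin d → ℝ) → ℝ) (x : Phase d) (i : Fin d) : ℝ :=
  ∑ j, 2 * (fderiv ℝ (unitDiff V j) (xiL γ x) (Pi.single i 1) ^ 2 + unitDiff V j (xiL γ x) *
    fderiv ℝ (fderiv ℝ (unitDiff V j)) (xiL γ x) (Pi.single i 1) (Pi.single i 1)) + 2

include hV in
theorem fderiv_lyap_dirQ (γ : ℝ) (x : Phase d) (i : Fin d) :
    fderiv ℝ (lyap γ V) x (dirQ i) = lyapQ γ V x i := by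
  unfold lyap
  rw [fderiv_oneAddSumSq (contDiff_lyapFamily hV γ), Fintype.sum_sum_type]
  have h1 : ∀ j, fderiv ℝ (lyapFamily γ V (Sum.inl j)) x (dirQ i) =
      fderiv ℝ (unitDiff V j) (xiL γ x) (Pi.single i 1) := fun j => by
    change fderiv ℝ (fun y => unitDiff V j (xiL γ y)) x _ = _
    rw [fderiv_comp_clm_apply _ ((contDiff_unitDiff hV j).differentiable (by norm_num) _),
      xiL_dirQ]
  have h2 : ∀ j, fderiv ℝ (lyapFamily γ V (Sum.inr j)) x (dirQ i) = 0 := fun j => by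
    change fderiv ℝ (scaledMom γ j) x _ = _
    rw [(scaledMom γ j).fderiv, scaledMom_apply]
    simp [dirQ]
  simp only [h1, h2, mul_zero, Finset.sum_const_zero, add_zero]
  rfl

include hV in
theorem fderiv_lyap_dirP (γ : ℝ) (x : Phase d) (i : Fin d) :
    fderiv ℝ (lyap γ V) x (dirP i) = γ⁻¹ * lyapR γ V x i := by
  unfold lyap
  rw [fderiv_oneAddSumSq (contDiff_lyapFamily hV γ), Fintype.sum_sum_type]
  have h1 : ∀ j, fderiv ℝ (lyapFamily γ V (Sum.inl j)) x (dirP i) =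
      γ⁻¹ * fderiv ℝ (unitDiff V j) (xiL γ x) (Pi.single i 1) := fun j => by
    change fderiv ℝ (fun y => unitDiff V j (xiL γ y)) x _ = _
    rw [fderiv_comp_clm_apply _ ((contDiff_unitDiff hV j).differentiable (by norm_num) _),
      xiL_dirP, map_smul, smul_eq_mul]
  have h2 : ∀ j, fderiv ℝ (lyapFamily γ V (Sum.inr j)) x (dirP i) =
      if j = i then γ⁻¹ else 0 := fun j => by
    change fderiv ℝ (scaledMom γ j) x _ = _
    rw [(scaledMom γ j).fderiv, scaledMom_apply]
    simp only [dirP, Pi.single_apply]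
    split_ifs <;> simp
  have h3 : ∀ j, lyapFamily γ V (Sum.inr j) x = x.2 j / γ := fun j => scaledMom_apply γ j x
  simp only [h1, h2, h3, mul_ite, mul_zero, Finset.sum_ite_eq', Finset.mem_univ, if_true]
  unfold lyapR lyapQ
  rw [mul_add, Finset.mul_sum]
  congr 1
  · refine Finset.sum_congr rfl fun j _ => ?_
    simp only [lyapFamily, Sum.elim_inl]
    ring
  · ring

include hV in
theorem fderiv_fderiv_lyap_dirP (γ : ℝ) (x : Phase d) (i : Fin d) :
    fderiv ℝ (fderiv ℝ (lyap γ V)) x (dirP i) (dirP i) = (γ⁻¹) ^ 2 * lyapS γ V x i := by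
  unfold lyap
  rw [fderiv_fderiv_oneAddSumSq (contDiff_lyapFamily hV γ), Fintype.sum_sum_type]
  have h1 : ∀ j, fderiv ℝ (lyapFamily γ V (Sum.inl j)) x (dirP i) =
      γ⁻¹ * fderiv ℝ (unitDiff V j) (xiL γ x) (Pi.single i 1) := fun j => by
    change fderiv ℝ (fun y => unitDiff V j (xiL γ y)) x _ = _
    rw [fderiv_comp_clm_apply _ ((contDiff_unitDiff hV j).differentiable (by norm_num) _),
      xiL_dirP, map_smul, smul_eq_mul]
  have h2 : ∀ j, fderiv ℝ (lyapFamily γ V (Sum.inr j)) x (dirP i) =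
      if j = i then γ⁻¹ else 0 := fun j => by
    change fderiv ℝ (scaledMom γ j) x _ = _
    rw [(scaledMom γ j).fderiv, scaledMom_apply]
    simp only [dirP, Pi.single_apply]
    split_ifs <;> simp
  have h3 : ∀ j, fderiv ℝ (fderiv ℝ (lyapFamily γ V (Sum.inl j))) x (dirP i) (dirP i) =
      γ⁻¹ ^ 2 * fderiv ℝ (fderiv ℝ (unitDiff V j)) (xiL γ x) (Pi.single i 1)
        (Pi.single i 1) := fun j => by
    change fderiv ℝ (fderiv ℝ (fun y => unitDiff V j (xiL γ y))) x _ _ = _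
    rw [fderiv_fderiv_comp_clm_apply _ (contDiff_unitDiff hV j), xiL_dirP]
    simp only [map_smul, _root_.smul_apply, smul_eq_mul]
    ring
  have h4 : ∀ j, fderiv ℝ (fderiv ℝ (lyapFamily γ V (Sum.inr j))) x (dirP i) (dirP i) = 0 :=
    fun j => by
    change fderiv ℝ (fderiv ℝ (fun x => scaledMom γ j x : Phase d → ℝ)) x _ _ = _
    rw [show fderiv ℝ (fun x => scaledMom γ j x : Phase d → ℝ) =
      fun _ => scaledMom γ j from funext fun x => (scaledMom γ j).fderiv, fderiv_fun_const]
    rfl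
  simp only [h1, h2, h3, h4, mul_ite, ite_mul, mul_zero, zero_mul, add_zero, Finset.sum_ite_eq',
    Finset.mem_univ, if_true]
  unfold lyapS
  rw [mul_add, Finset.mul_sum]
  congr 1
  · refine Finset.sum_congr rfl fun j _ => ?_
    simp only [lyapFamily, Sum.elim_inl]
    ring
  · simp; ring

end Lyapunov

/-- The space-time test function `c(t) U/(1+εU)`. -/
def lyapTest {d : ℕ} (c : ℝ → ℝ) (ε γ : ℝ) (V : (Fin d → ℝ) → ℝ) (z : ℝ × Phase d) : ℝ :=
  c z.1 * trunc ε (lyap γ V z.2)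

section Pointwise

variable {d : ℕ} {V : (Fin d → ℝ) → ℝ} (hV : ContDiff ℝ 2 V)
  {c : ℝ → ℝ} (hc : Differentiable ℝ c) {ε : ℝ} (hε : 0 ≤ ε)

theorem one_le_lyap (γ : ℝ) (x : Phase d) : 1 ≤ lyap γ V x := one_le_oneAddSumSq _ _

include hε in
theorem one_le_one_add_mul_lyap (γ : ℝ) (x : Phase d) : 1 ≤ 1 + ε * lyap γ V x := by
  have := one_le_lyap (V := V) γ x
  have : 0 ≤ ε * lyap γ V x := by positivity
  linarith

include hV hε in
theorem fderiv_trunc_lyap (γ : ℝ) (x v : Phase d) :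
    fderiv ℝ (fun y => trunc ε (lyap γ V y)) x v =
      ((1 + ε * lyap γ V x) ^ 2)⁻¹ * fderiv ℝ (lyap γ V) x v := by
  rw [(hasFDerivAt_trunc_comp (((contDiff_lyap hV γ).differentiable (by norm_num)) x).hasFDerivAt
    (by have := one_le_one_add_mul_lyap (V := V) hε γ x; positivity)).fderiv]
  rfl

include hV hε in
theorem contDiff_trunc_lyap (γ : ℝ) : ContDiff ℝ 2 (fun y => trunc ε (lyap γ V y)) := by
  unfold trunc
  exact (contDiff_lyap hV γ).div (contDiff_const.add (contDiff_const.mul (contDiff_lyap hV γ)))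
    fun x => by have := one_le_one_add_mul_lyap (V := V) hε γ x; positivity

include hV hc hε in
theorem lop_lyapTest {m γ : ℝ} (hγ : 0 < γ) (ψ : (Fin d → ℝ) → ℝ) (ν : Measure (Phase d))
    (z : ℝ × Phase d) :
    Lop m γ V ψ ν (lyapTest c ε γ V) z = c z.1 * ((1 + ε * lyap γ V z.2) ^ 2)⁻¹ *
      (∑ i, (-(2 / m) * z.2.2 i ^ 2 - (fderiv ℝ V z.2.1 (Pi.single i 1) +
        convGradPsi ψ ν z.2.1 i) * lyapR γ V z.2 i + lyapS γ V z.2 i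
        - 2 * ε * (1 + ε * lyap γ V z.2)⁻¹ * lyapR γ V z.2 i ^ 2)) := by
  have hh := contDiff_trunc_lyap hV hε γ
  have hhd := hh.differentiable (by norm_num)
  have hN := one_le_one_add_mul_lyap (V := V) hε γ z.2
  have e1 : ∀ i, qderT (lyapTest c ε γ V) z i =
      c z.1 * (((1 + ε * lyap γ V z.2) ^ 2)⁻¹ * lyapQ γ V z.2 i) := fun i => by
    unfold qderT lyapTest
    rw [fderiv_mul_prod hc hhd, fderiv_trunc_lyap hV hε, fderiv_lyap_dirQ hV]
    simp
  have e2 : ∀ i, pderT (lyapTest c ε γ V) z i =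
      c z.1 * (((1 + ε * lyap γ V z.2) ^ 2)⁻¹ * (γ⁻¹ * lyapR γ V z.2 i)) := fun i => by
    unfold pderT lyapTest
    rw [fderiv_mul_prod hc hhd, fderiv_trunc_lyap hV hε, fderiv_lyap_dirP hV]
    simp
  have e3 : laplPT (lyapTest c ε γ V) z = c z.1 * ∑ i, (((1 + ε * lyap γ V z.2) ^ 2)⁻¹ *
      ((γ⁻¹) ^ 2 * lyapS γ V z.2 i) + (-(2 * ε) * ((1 + ε * lyap γ V z.2) ^ 3)⁻¹ *
        (γ⁻¹ * lyapR γ V z.2 i)) * (γ⁻¹ * lyapR γ V z.2 i)) := by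
    unfold lyapTest
    rw [laplPT_mul_prod hc hh]
    congr 1
    refine Finset.sum_congr rfl fun i _ => ?_
    rw [fderiv_fderiv_trunc_comp (contDiff_lyap hV γ) hε (one_le_lyap γ)]
    simp only [_root_.add_apply, _root_.smul_apply, smul_eq_mul,
      ContinuousLinearMap.smulRight_apply, fderiv_lyap_dirP hV, fderiv_fderiv_lyap_dirP hV]
  unfold Lop
  simp_rw [e1, e2, e3, Finset.mul_sum]
  rw [← Finset.sum_sub_distrib, Finset.mul_sum, ← Finset.sum_sub_distrib,
    ← Finset.sum_add_distrib]
  refine Finset.sum_congr rfl fun i _ => ?_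
  rw [show lyapQ γ V z.2 i = lyapR γ V z.2 i - 2 * (z.2.2 i / γ) by unfold lyapR; ring]
  have hN0 : 1 + ε * lyap γ V z.2 ≠ 0 := by positivity
  have := hγ.ne'
  generalize lyapR γ V z.2 i = R
  generalize lyapS γ V z.2 i = S
  generalize (fderiv ℝ V z.2.1 (Pi.single i 1) + convGradPsi ψ ν z.2.1 i) = b
  rw [div_eq_mul_inv _ m, div_eq_mul_inv _ m]
  generalize m⁻¹ = m'
  generalize 1 + ε * lyap γ V z.2 = N at *
  field_simp
  ring

include hV hc hε in
theorem pderT_lyapTest {γ : ℝ} (z : ℝ × Phase d) (i : Fin d) :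
    pderT (lyapTest c ε γ V) z i =
      c z.1 * (((1 + ε * lyap γ V z.2) ^ 2)⁻¹ * (γ⁻¹ * lyapR γ V z.2 i)) := by
  unfold pderT lyapTest
  rw [fderiv_mul_prod hc ((contDiff_trunc_lyap hV hε γ).differentiable (by norm_num)),
    fderiv_trunc_lyap hV hε, fderiv_lyap_dirP hV]
  simp

include hV hc hε in
theorem tder_lyapTest {γ : ℝ} (z : ℝ × Phase d) :
    tder (lyapTest c ε γ V) z = deriv c z.1 * trunc ε (lyap γ V z.2) := by
  unfold tder lyapTest
  rw [fderiv_mul_prod hc ((contDiff_trunc_lyap hV hε γ).differentiable (by norm_num))]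
  simp

variable {K : ℝ} (hK1 : 1 ≤ K) (hK : ∀ q, ‖fderiv ℝ (fderiv ℝ V) q‖ ≤ K)

omit hV in
theorem abs_clm_single_le (A : (Fin d → ℝ) →L[ℝ] ℝ) {M : ℝ} (hA : ‖A‖ ≤ M) (i : Fin d) :
    |A (Pi.single i 1)| ≤ M := by
  have := A.le_of_opNorm_le hA (Pi.single i 1)
  simpa [Pi.norm_single] using this

theorem norm_mom_div_le (γ : ℝ) (x : Phase d) : ‖γ⁻¹ • x.2‖ ≤ √(lyap γ V x) := by
  rw [pi_norm_le_iff_of_nonneg (Real.sqrt_nonneg _)]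
  intro j
  have := abs_le_sqrt_oneAddSumSq (lyapFamily γ V) x (Sum.inr j)
  simpa [lyapFamily, scaledMom_apply, div_eq_inv_mul, lyap] using this

theorem abs_unitDiff_xiL_le (γ : ℝ) (x : Phase d) (j : Fin d) :
    |unitDiff V j (xiL γ x)| ≤ √(lyap γ V x) :=
  abs_le_sqrt_oneAddSumSq (lyapFamily γ V) x (Sum.inl j)

theorem one_le_sqrt_lyap (γ : ℝ) (x : Phase d) : 1 ≤ √(lyap γ V x) :=
  Real.one_le_sqrt.2 (one_le_lyap γ x)

theorem xiL_eq (γ : ℝ) (x : Phase d) : xiL γ x = x.1 + γ⁻¹ • x.2 := by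
  simp [xiL]

include hV hK1 hK in
theorem abs_fderiv_single_le (γ : ℝ) (x : Phase d) (i : Fin d) :
    |fderiv ℝ V x.1 (Pi.single i 1)| ≤ 3 * K * √(lyap γ V x) := by
  have h1 : |(fderiv ℝ V (xiL γ x) - fderiv ℝ V x.1) (Pi.single i 1)| ≤ K * √(lyap γ V x) := by
    refine abs_clm_single_le _ ((norm_fderiv_sub_le_of_second hV hK _ _).trans ?_) i
    rw [xiL_eq, add_sub_cancel_left]
    gcongr
    exact norm_mom_div_le γ x
  have h2 := abs_unitDiff_sub_le hV hK i (xiL γ x)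
  have h3 := abs_unitDiff_xiL_le (V := V) γ x i
  have h4 := one_le_sqrt_lyap (V := V) γ x
  simp only [_root_.sub_apply] at h1
  have h5 : K ≤ K * √(lyap γ V x) := le_mul_of_one_le_right (by linarith) h4
  have h6 : √(lyap γ V x) ≤ K * √(lyap γ V x) :=
    le_mul_of_one_le_left (by linarith) hK1
  rw [abs_le] at *
  constructor <;> linarith [h1.1, h1.2, h2.1, h2.2, h3.1, h3.2]

include hV hK in
theorem abs_lyapR_le (γ : ℝ) (x : Phase d) (i : Fin d) :
    |lyapR γ V x i| ≤ (2 * d * K + 2) * √(lyap γ V x) := by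
  unfold lyapR lyapQ
  have h1 : |x.2 i / γ| ≤ √(lyap γ V x) := by
    have := abs_le_sqrt_oneAddSumSq (lyapFamily γ V) x (Sum.inr i)
    simpa [lyapFamily, scaledMom_apply, lyap] using this
  have h2 : |∑ j, 2 * unitDiff V j (xiL γ x) * fderiv ℝ (unitDiff V j) (xiL γ x)
      (Pi.single i 1)| ≤ 2 * d * K * √(lyap γ V x) := by
    refine (Finset.abs_sum_le_sum_abs _ _).trans ((Finset.sum_le_card_nsmul _ _
      (2 * √(lyap γ V x) * K) fun j _ => ?_).trans_eq ?_)
    · rw [abs_mul, abs_mul, abs_two]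
      gcongr
      · exact abs_unitDiff_xiL_le γ x j
      · exact abs_clm_single_le _ (norm_fderiv_unitDiff_le hV hK j _) i
    · simp; ring
  rw [abs_le] at *
  constructor <;> linarith [h1.1, h1.2, h2.1, h2.2]

include hV hK1 hK in
theorem abs_lyapS_le (γ : ℝ) (x : Phase d) (i : Fin d) :
    |lyapS γ V x i| ≤ (6 * d * K ^ 2 + 2) * lyap γ V x := by
  unfold lyapS
  have hs1 := one_le_sqrt_lyap (V := V) γ x
  have hU1 := one_le_lyap (V := V) γ x
  have hss : √(lyap γ V x) ≤ lyap γ V x := by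
    rw [Real.sqrt_le_left (by linarith)]; nlinarith
  have h2 : |∑ j, 2 * (fderiv ℝ (unitDiff V j) (xiL γ x) (Pi.single i 1) ^ 2 +
      unitDiff V j (xiL γ x) *
    fderiv ℝ (fderiv ℝ (unitDiff V j)) (xiL γ x) (Pi.single i 1) (Pi.single i 1))| ≤
      d * (6 * K ^ 2 * lyap γ V x) := by
    refine (Finset.abs_sum_le_sum_abs _ _).trans ((Finset.sum_le_card_nsmul _ _
      (6 * K ^ 2 * lyap γ V x) fun j _ => ?_).trans_eq (by simp))
    have a1 : |fderiv ℝ (unitDiff V j) (xiL γ x) (Pi.single i 1)| ≤ K :=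
      abs_clm_single_le _ (norm_fderiv_unitDiff_le hV hK j _) i
    have a2 : |fderiv ℝ (fderiv ℝ (unitDiff V j)) (xiL γ x) (Pi.single i 1) (Pi.single i 1)|
        ≤ 2 * K := by
      have := (fderiv ℝ (fderiv ℝ (unitDiff V j)) (xiL γ x)).le_of_opNorm₂_le_of_le
        (norm_fderiv_fderiv_unitDiff_le hV hK j (xiL γ x)) (x := Pi.single i 1)
        (y := Pi.single i 1) (b := 1) (c := 1) (by simp [Pi.norm_single])
        (by simp [Pi.norm_single])
      simpa using this
    rw [abs_mul, abs_two]
    have a3 : |unitDiff V j (xiL γ x) *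
        fderiv ℝ (fderiv ℝ (unitDiff V j)) (xiL γ x) (Pi.single i 1) (Pi.single i 1)| ≤
        lyap γ V x * (2 * K) := by
      rw [abs_mul]
      gcongr
      exact (abs_unitDiff_xiL_le γ x j).trans hss
    have a4 : fderiv ℝ (unitDiff V j) (xiL γ x) (Pi.single i 1) ^ 2 ≤ K ^ 2 := by
      rw [sq_le_sq, abs_of_nonneg (by linarith : 0 ≤ K)]; exact a1
    have a5 := abs_add_le (fderiv ℝ (unitDiff V j) (xiL γ x) (Pi.single i 1) ^ 2)
      (unitDiff V j (xiL γ x) *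
        fderiv ℝ (fderiv ℝ (unitDiff V j)) (xiL γ x) (Pi.single i 1) (Pi.single i 1))
    rw [abs_of_nonneg (sq_nonneg (fderiv ℝ (unitDiff V j) (xiL γ x) (Pi.single i 1)))] at a5
    have a6 : K ^ 2 ≤ K ^ 2 * lyap γ V x := le_mul_of_one_le_right (by positivity) hU1
    have a7 : lyap γ V x * (2 * K) ≤ 2 * (K ^ 2 * lyap γ V x) := by
      nlinarith [mul_nonneg (by linarith : 0 ≤ K - 1) (by positivity : 0 ≤ K * lyap γ V x)]
    linarith
  rw [abs_le] at *
  constructor <;> nlinarith [h2.1, h2.2]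

/-- The growth constant in the Lyapunov estimate. -/
def lyapConst (d : ℕ) (K : ℝ) : ℝ :=
  d * (4 * K * (2 * d * K + 2) + (6 * d * K ^ 2 + 2) + (2 * d * K + 2) ^ 2)

include hV hK1 hK in
theorem sum_abs_le_lyapConst (γ : ℝ) (x : Phase d) {b : Fin d → ℝ} (hb : ∀ i, |b i| ≤ K) :
    ∑ i, (|fderiv ℝ V x.1 (Pi.single i 1) + b i| * |lyapR γ V x i| + |lyapS γ V x i| +
      lyapR γ V x i ^ 2) ≤ lyapConst d K * lyap γ V x := by
  unfold lyapConst
  refine (Finset.sum_le_card_nsmul _ _ ((4 * K * (2 * d * K + 2) + (6 * d * K ^ 2 + 2) +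
    (2 * d * K + 2) ^ 2) * lyap γ V x) fun i _ => ?_).trans_eq (by simp; ring)
  have hU : 0 ≤ lyap γ V x := zero_le_one.trans (one_le_lyap γ x)
  have hs := Real.mul_self_sqrt hU
  have h4 := one_le_sqrt_lyap (V := V) γ x
  have h1 : |fderiv ℝ V x.1 (Pi.single i 1) + b i| ≤ 4 * K * √(lyap γ V x) := by
    refine (abs_add_le _ _).trans ?_
    have h5 : K ≤ K * √(lyap γ V x) := le_mul_of_one_le_right (by linarith) h4
    linarith [abs_fderiv_single_le hV hK1 hK γ x i, hb i]
  have h2 := abs_lyapR_le hV hK γ x i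
  have h3 := abs_lyapS_le hV hK1 hK γ x i
  have e1 : |fderiv ℝ V x.1 (Pi.single i 1) + b i| * |lyapR γ V x i| ≤
      (4 * K * √(lyap γ V x)) * ((2 * d * K + 2) * √(lyap γ V x)) := by
    gcongr
  have e2 : lyapR γ V x i ^ 2 ≤ ((2 * d * K + 2) * √(lyap γ V x)) ^ 2 := by
    rw [sq_le_sq, abs_of_nonneg (by positivity : 0 ≤ (2 * d * K + 2) * √(lyap γ V x))]
    exact h2
  rw [mul_pow, Real.sq_sqrt hU] at e2
  have e3 : (4 * K * √(lyap γ V x)) * ((2 * d * K + 2) * √(lyap γ V x)) =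
    4 * K * (2 * d * K + 2) * lyap γ V x := by
    linear_combination (4 * K * (2 * d * K + 2)) * hs
  linarith

end Pointwise

section Pointwise

variable {d : ℕ} {V : (Fin d → ℝ) → ℝ} (hV : ContDiff ℝ 2 V) {K : ℝ} (hK1 : 1 ≤ K)
  (hK : ∀ q, ‖fderiv ℝ (fderiv ℝ V) q‖ ≤ K) {c : ℝ → ℝ} (hc : Differentiable ℝ c)
  {m γ ε : ℝ} (hm : 0 < m) (hγ : 0 < γ)
  {ψ : (Fin d → ℝ) → ℝ} {ν : Measure (Phase d)} {z : ℝ × Phase d}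
  (hb : ∀ i, |convGradPsi ψ ν z.2.1 i| ≤ K)

include hV hK1 hK hc hγ hb in
theorem generator_lyapTest_le (hε : 0 ≤ ε) (hc0 : 0 ≤ c z.1) (hc1 : c z.1 ≤ 1)
    (hc' : deriv c z.1 ≤ -(lyapConst d K + 1) * c z.1) :
    tder (lyapTest c ε γ V) z + Lop m γ V ψ ν (lyapTest c ε γ V) z +
      γ ^ 2 / 2 * ∑ i, pderT (lyapTest c ε γ V) z i ^ 2 ≤
    -(c z.1 * (((1 + ε * lyap γ V z.2) ^ 2)⁻¹ *
      (lyap γ V z.2 + 2 / m * ∑ i, z.2.2 i ^ 2))) := by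
  rw [tder_lyapTest hV hc hε, lop_lyapTest hV hc hε hγ]
  simp_rw [pderT_lyapTest hV hc hε]
  have hN1 := one_le_one_add_mul_lyap (V := V) hε γ z.2
  have hU1 := one_le_lyap (V := V) γ z.2
  have hsum := sum_abs_le_lyapConst hV hK1 hK γ z.2 hb
  unfold trunc
  set U := lyap γ V z.2
  set N := 1 + ε * U
  set w := (N ^ 2)⁻¹ with hw
  have hw0 : 0 ≤ w := by positivity
  have hw1 : w ≤ 1 := inv_le_one_of_one_le₀ (by nlinarith)
  have hwN : w ≤ N⁻¹ := inv_anti₀ (by linarith) (by nlinarith)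
  set R2 := ∑ i, lyapR γ V z.2 i ^ 2 with hR2
  have hR20 : 0 ≤ R2 := Finset.sum_nonneg fun _ _ => sq_nonneg _
  have hC0 : 0 ≤ lyapConst d K := by
    unfold lyapConst; have : 0 ≤ K := by linarith
    positivity
  have e1 : γ ^ 2 / 2 * ∑ i, (c z.1 * (w * (γ⁻¹ * lyapR γ V z.2 i))) ^ 2 =
      c z.1 * w * (c z.1 * w * (R2 / 2)) := by
    rw [hR2, Finset.sum_div, Finset.mul_sum, Finset.mul_sum, Finset.mul_sum]
    refine Finset.sum_congr rfl fun i _ => ?_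
    field_simp
  have e2 : c z.1 * w * (R2 / 2) ≤ R2 := by
    have : c z.1 * w ≤ 1 := mul_le_one₀ hc1 hw0 hw1
    nlinarith
  have e3 : deriv c z.1 * (U / N) ≤ c z.1 * w * (-(lyapConst d K + 1) * U) := by
    calc deriv c z.1 * (U / N) ≤ (-(lyapConst d K + 1) * c z.1) * (U / N) := by gcongr
      _ = -((lyapConst d K + 1) * c z.1 * U * N⁻¹) := by ring
      _ ≤ -((lyapConst d K + 1) * c z.1 * U * w) := by gcongr
      _ = _ := by ring
  have e4 : ∑ i, (-(2 / m) * z.2.2 i ^ 2 - (fderiv ℝ V z.2.1 (Pi.single i 1) +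
        convGradPsi ψ ν z.2.1 i) * lyapR γ V z.2 i + lyapS γ V z.2 i
        - 2 * ε * N⁻¹ * lyapR γ V z.2 i ^ 2) ≤
      lyapConst d K * U - R2 - 2 / m * ∑ i, z.2.2 i ^ 2 := by
    have : ∑ i, (-(2 / m) * z.2.2 i ^ 2 - (fderiv ℝ V z.2.1 (Pi.single i 1) +
        convGradPsi ψ ν z.2.1 i) * lyapR γ V z.2 i + lyapS γ V z.2 i
        - 2 * ε * N⁻¹ * lyapR γ V z.2 i ^ 2) ≤ ∑ i, ((|fderiv ℝ V z.2.1 (Pi.single i 1) +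
        convGradPsi ψ ν z.2.1 i| * |lyapR γ V z.2 i| + |lyapS γ V z.2 i| +
      lyapR γ V z.2 i ^ 2) - lyapR γ V z.2 i ^ 2 - 2 / m * z.2.2 i ^ 2) := by
      refine Finset.sum_le_sum fun i _ => ?_
      have h1 := neg_abs_le ((fderiv ℝ V z.2.1 (Pi.single i 1) +
        convGradPsi ψ ν z.2.1 i) * lyapR γ V z.2 i)
      rw [abs_mul] at h1
      have h2 := le_abs_self (lyapS γ V z.2 i)
      have h3 : 0 ≤ 2 * ε * N⁻¹ * lyapR γ V z.2 i ^ 2 := by positivity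
      linarith
    refine this.trans ?_
    rw [Finset.sum_sub_distrib, Finset.sum_sub_distrib, ← Finset.mul_sum]
    linarith
  rw [e1]
  have hcw : 0 ≤ c z.1 * w := mul_nonneg hc0 hw0
  have e5 := mul_le_mul_of_nonneg_left e4 hcw
  have e6 := mul_le_mul_of_nonneg_left e2 hcw
  nlinarith

theorem sum_sq_mom_le (hγ : 0 < γ) (x : Phase d) : ∑ i, x.2 i ^ 2 ≤ γ ^ 2 * lyap γ V x := by
  rw [lyap_eq]
  have : ∑ i, x.2 i ^ 2 = γ ^ 2 * ∑ i, (x.2 i / γ) ^ 2 := by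
    rw [Finset.mul_sum]
    refine Finset.sum_congr rfl fun i _ => ?_
    field_simp
  rw [this]
  gcongr
  have : 0 ≤ ∑ j, unitDiff V j (xiL γ x) ^ 2 := Finset.sum_nonneg fun _ _ => sq_nonneg _
  linarith

theorem inv_sq_mul_lyap_le (hε : 0 < ε) (x : Phase d) :
    ((1 + ε * lyap γ V x) ^ 2)⁻¹ * lyap γ V x ≤ 1 / ε := by
  have hN1 := one_le_one_add_mul_lyap (V := V) hε.le γ x
  rw [inv_mul_eq_div, div_le_div_iff₀ (by positivity) hε]
  nlinarith

include hV hK1 hK hc hm hγ hb in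
theorem abs_generator_lyapTest_le (hε : 0 < ε) (hc0 : 0 ≤ c z.1) (hc1 : c z.1 ≤ 1) {D : ℝ}
    (hc' : |deriv c z.1| ≤ D) :
    |tder (lyapTest c ε γ V) z + Lop m γ V ψ ν (lyapTest c ε γ V) z| ≤
      (D + (2 / m * γ ^ 2 + 2 * lyapConst d K)) * (1 / ε) := by
  rw [tder_lyapTest hV hc hε.le, lop_lyapTest hV hc hε.le hγ]
  have hN1 := one_le_one_add_mul_lyap (V := V) hε.le γ z.2
  have hU1 := one_le_lyap (V := V) γ z.2
  have hsum := sum_abs_le_lyapConst hV hK1 hK γ z.2 hb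
  have hP := sum_sq_mom_le (V := V) hγ z.2
  have hwU := inv_sq_mul_lyap_le (V := V) (γ := γ) hε z.2
  unfold trunc
  set U := lyap γ V z.2
  have hεN : ε ≤ 1 + ε * U := by nlinarith
  have hUN : U / (1 + ε * U) ≤ 1 / ε := by
    rw [div_le_div_iff₀ (by positivity) hε]; nlinarith
  set N := 1 + ε * U
  set w := (N ^ 2)⁻¹ with hw
  have hw0 : 0 ≤ w := by positivity
  have hC0 : 0 ≤ lyapConst d K := by
    unfold lyapConst; have : 0 ≤ K := by linarith
    positivity
  have hεN' : ε * N⁻¹ ≤ 1 := by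
    rw [← div_eq_mul_inv]; exact div_le_one_of_le₀ hεN (by positivity)
  have e4 : |∑ i, (-(2 / m) * z.2.2 i ^ 2 - (fderiv ℝ V z.2.1 (Pi.single i 1) +
        convGradPsi ψ ν z.2.1 i) * lyapR γ V z.2 i + lyapS γ V z.2 i
        - 2 * ε * N⁻¹ * lyapR γ V z.2 i ^ 2)| ≤
      (2 / m * γ ^ 2 + 2 * lyapConst d K) * U := by
    have : |∑ i, (-(2 / m) * z.2.2 i ^ 2 - (fderiv ℝ V z.2.1 (Pi.single i 1) +
        convGradPsi ψ ν z.2.1 i) * lyapR γ V z.2 i + lyapS γ V z.2 i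
        - 2 * ε * N⁻¹ * lyapR γ V z.2 i ^ 2)| ≤ ∑ i, (2 / m * z.2.2 i ^ 2 +
        2 * (|fderiv ℝ V z.2.1 (Pi.single i 1) +
        convGradPsi ψ ν z.2.1 i| * |lyapR γ V z.2 i| + |lyapS γ V z.2 i| +
      lyapR γ V z.2 i ^ 2)) := by
      refine (Finset.abs_sum_le_sum_abs _ _).trans (Finset.sum_le_sum fun i _ => ?_)
      rw [← abs_mul]
      have h1 := abs_le.1 (le_refl |(fderiv ℝ V z.2.1 (Pi.single i 1) +
        convGradPsi ψ ν z.2.1 i) * lyapR γ V z.2 i|)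
      have h2 := abs_le.1 (le_refl |lyapS γ V z.2 i|)
      have h3 : 0 ≤ 2 * ε * N⁻¹ * lyapR γ V z.2 i ^ 2 := by positivity
      have h4 : 2 * ε * N⁻¹ * lyapR γ V z.2 i ^ 2 ≤ 2 * lyapR γ V z.2 i ^ 2 := by
        gcongr; nlinarith
      have h5 : 0 ≤ 2 / m * z.2.2 i ^ 2 := by positivity
      have h6 := abs_nonneg ((fderiv ℝ V z.2.1 (Pi.single i 1) +
        convGradPsi ψ ν z.2.1 i) * lyapR γ V z.2 i)
      have h7 := abs_nonneg (lyapS γ V z.2 i)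
      have h8 := sq_nonneg (lyapR γ V z.2 i)
      rw [abs_le]
      constructor <;> linarith [h1.1, h1.2, h2.1, h2.2]
    refine this.trans ?_
    rw [Finset.sum_add_distrib, ← Finset.mul_sum, ← Finset.mul_sum]
    have : 2 / m * ∑ i, z.2.2 i ^ 2 ≤ 2 / m * (γ ^ 2 * U) := by gcongr
    linarith
  have hD : 0 ≤ D := (abs_nonneg _).trans hc'
  rw [add_mul]
  refine (abs_add_le _ _).trans (add_le_add ?_ ?_)
  · rw [abs_mul, abs_of_nonneg (by positivity : 0 ≤ U / N)]
    gcongr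
  · rw [abs_mul, abs_of_nonneg (mul_nonneg hc0 hw0)]
    calc c z.1 * w * _ ≤ c z.1 * w * ((2 / m * γ ^ 2 + 2 * lyapConst d K) * U) := by gcongr
      _ = c z.1 * ((2 / m * γ ^ 2 + 2 * lyapConst d K) * (w * U)) := by ring
      _ ≤ 1 * ((2 / m * γ ^ 2 + 2 * lyapConst d K) * (1 / ε)) := by gcongr
      _ = _ := one_mul _

end Pointwise

section Measurability

variable {d : ℕ} {T : ℝ} {ρ : ℝ → ProbabilityMeasure (Phase d)} (hρ : Continuous ρ)
  {V ψ : (Fin d → ℝ) → ℝ} (hV : ContDiff ℝ 2 V) (hψ : ContDiff ℝ 2 ψ) {m γ : ℝ}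
  {f : ℝ × Phase d → ℝ}

include hψ in
theorem continuous_fderiv_single (i : Fin d) :
    Continuous fun q => fderiv ℝ ψ q (Pi.single i 1) :=
  (hψ.continuous_fderiv (by norm_num)).clm_apply continuous_const

include hρ hψ in
theorem measurable_convGradPsi (i : Fin d) :
    Measurable fun z : ℝ × (Fin d → ℝ) => convGradPsi ψ (ρ z.1 : Measure (Phase d)) z.2 i := by
  have hc := continuous_fderiv_single hψ i
  have : Continuous fun y : (ℝ × (Fin d → ℝ)) × Phase d =>
      fderiv ℝ ψ (y.1.2 - y.2.1) (Pi.single i 1) := by fun_prop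
  exact (MeasureTheory.StronglyMeasurable.integral_kernel_prod_right'
    (κ := (curveKernel ρ hρ).comap Prod.fst measurable_fst)
    this.measurable.stronglyMeasurable).measurable

theorem continuous_fderiv_apply_of_contDiff {E : Type*} [NormedAddCommGroup E] [NormedSpace ℝ E]
    {f : E → ℝ} (hf : ContDiff ℝ 2 f) (v : E) : Continuous fun z => fderiv ℝ f z v :=
  (hf.continuous_fderiv (by norm_num)).clm_apply continuous_const

theorem continuous_fderiv_fderiv_apply {E : Type*} [NormedAddCommGroup E] [NormedSpace ℝ E]
    {f : E → ℝ} (hf : ContDiff ℝ 2 f) (v w : E) :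
    Continuous fun z => fderiv ℝ (fun y => fderiv ℝ f y v) z w := by
  simp_rw [fderiv_fderiv_apply hf]
  exact (((hf.fderiv_right (m := 1) (by norm_num)).continuous_fderiv
    (by norm_num)).clm_apply continuous_const).clm_apply continuous_const

include hρ hV hψ in
theorem measurable_generator (hf : ContDiff ℝ 2 f) : Measurable fun z =>
    tder f z + Lop m γ V ψ (ρ z.1 : Measure (Phase d)) f z := by
  have h1 : Measurable (tder f) := (continuous_fderiv_apply_of_contDiff hf _).measurable
  have h2 : ∀ i, Measurable fun z => qderT f z i := fun i =>
    (continuous_fderiv_apply_of_contDiff hf _).measurable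
  have h3 : ∀ i, Measurable fun z => pderT f z i := fun i =>
    (continuous_fderiv_apply_of_contDiff hf _).measurable
  have h4 : Measurable (laplPT f) := Finset.measurable_fun_sum _ fun i _ =>
    (continuous_fderiv_fderiv_apply hf _ _).measurable
  have h5 : ∀ i, Measurable fun z : ℝ × Phase d =>
      convGradPsi ψ (ρ z.1 : Measure (Phase d)) z.2.1 i := fun i =>
    (measurable_convGradPsi hρ hψ i).comp (measurable_fst.prodMk (measurable_fst.comp measurable_snd))
  have h6 : ∀ i : Fin d, Measurable fun z : ℝ × Phase d =>
      fderiv ℝ V z.2.1 (Pi.single i 1) := fun i =>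
    (continuous_fderiv_single hV i).measurable.comp (measurable_fst.comp measurable_snd)
  unfold Lop
  fun_prop

theorem abs_convGradPsi_le {K : ℝ} (hK : ∀ q, ‖fderiv ℝ ψ q‖ ≤ K) (ν : Measure (Phase d))
    [IsProbabilityMeasure ν] (q : Fin d → ℝ) (i : Fin d) : |convGradPsi ψ ν q i| ≤ K := by
  have := norm_integral_le_of_norm_le_const (μ := ν)
    (f := fun y => fderiv ℝ ψ (q - y.1) (Pi.single i 1)) (C := K)
    (Eventually.of_forall fun y => abs_clm_single_le _ (hK _) i)
  simpa [convGradPsi] using this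

theorem abs_pderT_le {M : ℝ} (hM : ∀ z, ‖fderiv ℝ f z‖ ≤ M) (z : ℝ × Phase d) (i : Fin d) :
    |pderT f z i| ≤ M := by
  have := (fderiv ℝ f z).le_of_opNorm_le (hM z) (0, dirP i)
  simpa [pderT, dirP, Pi.norm_single, Prod.norm_def] using this

theorem integrable_sum_sq_pderT (hf : IsCb2 f) :
    Integrable (fun z => ∑ i, pderT f z i ^ 2) (spaceTime T ρ hρ) := by
  obtain ⟨hf, M, hM⟩ := hf
  refine integrable_finsetSum _ fun i _ => integrable_of_measurable_bdd (M := M ^ 2) ?_ fun z => ?_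
  · have : Measurable fun z => pderT f z i :=
      (continuous_fderiv_apply_of_contDiff hf _).measurable
    fun_prop
  · rw [abs_of_nonneg (sq_nonneg _)]
    have := abs_pderT_le (fun z => (hM z).2.1) z i
    rw [sq_le_sq, abs_of_nonneg ((abs_nonneg _).trans this)]
    exact this

theorem ofReal_le_rateI (hf : IsCb2 f)
    (hA : Integrable (fun z => tder f z + Lop m γ V ψ (ρ z.1 : Measure (Phase d)) f z)
      (spaceTime T ρ hρ)) :
    ENNReal.ofReal ((∫ x, f (T, x) ∂(ρ T : Measure (Phase d)))
      - (∫ x, f (0, x) ∂(ρ 0 : Measure (Phase d)))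
      - (∫ z, (tder f z + Lop m γ V ψ (ρ z.1 : Measure (Phase d)) f z) ∂(spaceTime T ρ hρ))
      - γ ^ 2 / 2 * ∫ z, (∑ i, pderT f z i ^ 2) ∂(spaceTime T ρ hρ)) ≤
    RateI m γ T V ψ ρ := by
  rw [integral_spaceTime hA, integral_spaceTime (integrable_sum_sq_pderT hρ hf)]
  unfold RateI
  exact le_iSup (fun f : {f : ℝ × Phase d → ℝ // IsCb2 f} => ENNReal.ofReal (
      (∫ x, f.1 (T, x) ∂(ρ T : Measure (Phase d)))
      - (∫ x, f.1 (0, x) ∂(ρ 0 : Measure (Phase d)))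
      - (∫ t in Icc (0 : ℝ) T,
          (∫ x, (tder f.1 (t, x) + Lop m γ V ψ (ρ t : Measure (Phase d)) f.1 (t, x))
            ∂(ρ t : Measure (Phase d))))
      - γ ^ 2 / 2 * ∫ t in Icc (0 : ℝ) T,
          (∫ x, (∑ i, (pderT f.1 (t, x) i) ^ 2) ∂(ρ t : Measure (Phase d))))) ⟨f, hf⟩

end Measurability

/-- A bounded smooth weight that decays at rate at least `L` on `[0,T]`. -/
theorem exists_decaying_weight {T L : ℝ} (hT : 0 < T) (hL : 0 ≤ L) :
    ∃ (c : ℝ → ℝ) (a D : ℝ), 0 < a ∧ IsCb2 c ∧ (∀ t, 0 ≤ c t ∧ c t ≤ 1 ∧ |deriv c t| ≤ D) ∧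
      ∀ t ∈ Icc (0 : ℝ) T, a ≤ c t ∧ deriv c t ≤ -L * c t := by
  have hcos : 0 < cos 1 := cos_one_pos
  set l : ℝ := L * T / cos 1 with hl
  have hl0 : 0 ≤ l := by positivity
  set c : ℝ → ℝ := fun t => Real.exp (-(l * (1 + sin (t / T)))) with hc
  set c₁ : ℝ → ℝ := fun t => -(l / T) * cos (t / T) * c t with hc1
  set c₂ : ℝ → ℝ := fun t => ((l / T) ^ 2 * cos (t / T) ^ 2 + l / T ^ 2 * sin (t / T)) * c t with hc2
  have h1 : ∀ t, HasDerivAt c (c₁ t) t := fun t => by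
    have := ((((hasDerivAt_id t).div_const T).sin.const_add 1).const_mul l).neg.exp
    refine this.congr_deriv ?_
    simp only [hc1, hc, id, Pi.neg_apply]
    ring
  have h2 : ∀ t, HasDerivAt c₁ (c₂ t) t := fun t => by
    have := ((((hasDerivAt_id t).div_const T).cos.const_mul (-(l / T)))).mul (h1 t)
    refine this.congr_deriv ?_
    simp only [hc2, hc1, id]
    ring
  have hcp : ∀ t, 0 < c t := fun t => Real.exp_pos _
  have hcle : ∀ t, c t ≤ 1 := fun t => by
    simp only [hc]
    rw [Real.exp_le_one_iff]
    have := neg_one_le_sin (t / T)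
    have : 0 ≤ l * (1 + sin (t / T)) := mul_nonneg hl0 (by linarith)
    linarith
  have hc1le : ∀ t, |c₁ t| ≤ l / T := fun t => by
    simp only [hc1]
    rw [abs_mul, abs_mul, abs_neg, abs_of_nonneg (by positivity : 0 ≤ l / T),
      abs_of_pos (hcp t)]
    calc l / T * |cos (t / T)| * c t ≤ l / T * 1 * 1 := by
          gcongr
          exacts [abs_cos_le_one _, hcle t]
      _ = l / T := by ring
  have hc2le : ∀ t, |c₂ t| ≤ (l / T) ^ 2 + l / T ^ 2 := fun t => by
    simp only [hc2]
    rw [abs_mul, abs_of_pos (hcp t)]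
    have e1 : |(l / T) ^ 2 * cos (t / T) ^ 2 + l / T ^ 2 * sin (t / T)| ≤
        (l / T) ^ 2 + l / T ^ 2 := by
      refine (abs_add_le _ _).trans (add_le_add ?_ ?_)
      · rw [abs_of_nonneg (by positivity)]
        exact mul_le_of_le_one_right (by positivity) (cos_sq_le_one _)
      · rw [abs_mul, abs_of_nonneg (by positivity : 0 ≤ l / T ^ 2)]
        exact mul_le_of_le_one_right (by positivity) (abs_sin_le_one _)
    calc _ ≤ ((l / T) ^ 2 + l / T ^ 2) * 1 := by
          gcongr
          exact hcle t
      _ = _ := mul_one _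
  refine ⟨c, Real.exp (-(l * 2)), l / T, Real.exp_pos _,
    isCb2_of_hasDerivAt (M := 1 + l / T + ((l / T) ^ 2 + l / T ^ 2)) h1 h2 ?_ fun t => ⟨?_, ?_, ?_⟩,
    fun t => ⟨(hcp t).le, hcle t, by rw [(h1 t).deriv]; exact hc1le t⟩, fun t ht => ⟨?_, ?_⟩⟩
  · simp only [hc2, hc]; fun_prop
  · rw [abs_of_pos (hcp t)]
    have : 0 ≤ l / T + ((l / T) ^ 2 + l / T ^ 2) := by positivity
    linarith [hcle t]
  · have : 0 ≤ 1 + ((l / T) ^ 2 + l / T ^ 2) := by positivity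
    linarith [hc1le t]
  · have : 0 ≤ 1 + l / T := by positivity
    linarith [hc2le t]
  · simp only [hc]
    have := sin_le_one (t / T)
    gcongr
    linarith
  · rw [(h1 t).deriv]
    simp only [hc1]
    have e1 : cos 1 ≤ cos (t / T) := by
      refine cos_le_cos_of_nonneg_of_le_pi (div_nonneg ht.1 hT.le) (by linarith [pi_gt_three]) ?_
      rw [div_le_one hT]; exact ht.2
    have e2 : L ≤ l / T * cos (t / T) := by
      calc L = l / T * cos 1 := by rw [hl]; field_simp
        _ ≤ _ := by gcongr
    have := mul_le_mul_of_nonneg_right e2 (hcp t).le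
    linarith

section Energy

variable {d : ℕ} {T : ℝ} {V ψ : (Fin d → ℝ) → ℝ} (hV : ContDiff ℝ 2 V) {K : ℝ} (hK1 : 1 ≤ K)
  (hK : ∀ q, ‖fderiv ℝ (fderiv ℝ V) q‖ ≤ K) (hψ : ContDiff ℝ 2 ψ)
  (hψK : ∀ q, ‖fderiv ℝ ψ q‖ ≤ K) {m : ℝ} (hm : 0 < m)

include hV hK in
theorem isCb2_lyapTest {c : ℝ → ℝ} (hc : IsCb2 c) (γ : ℝ) {ε : ℝ} (hε : 0 < ε) :
    IsCb2 (lyapTest c ε γ V) :=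
  (hc.comp_clm (ContinuousLinearMap.fst ℝ ℝ (Phase d))).mul
    ((isCb2_trunc_lyap hV hK γ hε).comp_clm (ContinuousLinearMap.snd ℝ ℝ (Phase d)))

/-- The density controlled by the energy estimate. -/
def energyDensity (m γ : ℝ) (V : (Fin d → ℝ) → ℝ) (x : Phase d) : ℝ :=
  lyap γ V x + 2 / m * ∑ i, x.2 i ^ 2

include hm in
theorem energyDensity_nonneg (γ : ℝ) (x : Phase d) : 0 ≤ energyDensity m γ V x := by
  have := one_le_lyap (V := V) γ x
  unfold energyDensity
  positivity

include hV in
theorem continuous_energyDensity (γ : ℝ) : Continuous (energyDensity m γ V) := by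
  have := (contDiff_lyap hV γ).continuous
  unfold energyDensity
  fun_prop

include hV hK1 hK hψ hψK hm in
theorem exists_lintegral_energyDensity_le (hT : 0 < T) : ∃ B : ℝ, ∀ {γ : ℝ} (_ : 0 < γ)
    {ρ : ℝ → ProbabilityMeasure (Phase d)} (hρ : Continuous ρ) {C : ℝ≥0∞} (_ : C ≠ ⊤)
    (_ : RateI m γ T V ψ ρ ≤ C) {R : ℝ}
    (_ : ∫⁻ x, ENNReal.ofReal (lyap γ V x) ∂(ρ 0 : Measure (Phase d)) ≤ ENNReal.ofReal R),
    ∫⁻ z, ENNReal.ofReal (energyDensity m γ V z.2) ∂(spaceTime T ρ hρ) ≤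
      ENNReal.ofReal (B * (C.toReal + max R 0)) := by
  have hL : 0 ≤ lyapConst d K + 1 := by
    unfold lyapConst; have : 0 ≤ K := by linarith
    positivity
  obtain ⟨c, a, D, ha, hc, hcb, hcd⟩ := exists_decaying_weight hT hL
  have hcD : Differentiable ℝ c := hc.1.differentiable (by norm_num)
  refine ⟨a⁻¹, fun {γ} hγ {ρ} hρ {C} hC hI {R} hR => ?_⟩
  have hbd : ∀ z : ℝ × Phase d, ∀ i, |convGradPsi ψ (ρ z.1 : Measure (Phase d)) z.2.1 i| ≤ K :=
    fun z i => abs_convGradPsi_le hψK _ _ _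
  have main : ∀ ε : ℝ, 0 < ε →
      ∫⁻ z, ENNReal.ofReal (((1 + ε * lyap γ V z.2) ^ 2)⁻¹ * energyDensity m γ V z.2)
        ∂(spaceTime T ρ hρ) ≤ ENNReal.ofReal (a⁻¹ * (C.toReal + max R 0)) := by
    intro ε hε
    set f := lyapTest c ε γ V with hf
    have hfC : IsCb2 f := isCb2_lyapTest hV hK hc γ hε
    set A : ℝ × Phase d → ℝ := fun z =>
      tder f z + Lop m γ V ψ (ρ z.1 : Measure (Phase d)) f z with hA
    have hAi : Integrable A (spaceTime T ρ hρ) :=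
      integrable_of_measurable_bdd (measurable_generator hρ hV hψ hfC.1) fun z =>
        abs_generator_lyapTest_le hV hK1 hK hcD hm hγ (hbd z) hε (hcb z.1).1 (hcb z.1).2.1
          (hcb z.1).2.2
    have hSi := integrable_sum_sq_pderT (T := T) hρ hfC
    have hX := (ofReal_le_rateI hρ hfC hAi).trans hI
    rw [ENNReal.ofReal_le_iff_le_toReal hC] at hX
    have hf0 : ∀ z, 0 ≤ f z := fun z => by
      have h1 := one_le_one_add_mul_lyap (V := V) hε.le γ z.2
      have h2 := one_le_lyap (V := V) γ z.2
      have h3 := (hcb z.1).1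
      simp only [hf, lyapTest, trunc]
      positivity
    have hfl : ∀ x, f (0, x) ≤ lyap γ V x := fun x => by
      have h1 := one_le_one_add_mul_lyap (V := V) hε.le γ x
      have h2 := one_le_lyap (V := V) γ x
      simp only [hf, lyapTest, trunc]
      calc c 0 * (lyap γ V x / (1 + ε * lyap γ V x)) ≤ 1 * (lyap γ V x / 1) := by
            gcongr
            exact (hcb 0).2.1
        _ = _ := by ring
    have h0 : ∫ x, f (0, x) ∂(ρ 0 : Measure (Phase d)) ≤ max R 0 := by
      have hfm : Continuous fun x => f (0, x) := hfC.1.continuous.comp (by fun_prop)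
      rw [integral_eq_lintegral_of_nonneg_ae (Eventually.of_forall fun x => hf0 _)
        hfm.aestronglyMeasurable]
      refine ENNReal.toReal_le_of_le_ofReal (le_max_right _ _) ?_
      refine (lintegral_mono fun x => ENNReal.ofReal_le_ofReal (hfl x)).trans (hR.trans ?_)
      exact ENNReal.ofReal_le_ofReal (le_max_left _ _)
    have hT0 : 0 ≤ ∫ x, f (T, x) ∂(ρ T : Measure (Phase d)) := integral_nonneg fun x => hf0 _
    have hneg : ∫ z, a⁻¹ * -(A z + γ ^ 2 / 2 * ∑ i, pderT f z i ^ 2) ∂(spaceTime T ρ hρ) ≤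
        a⁻¹ * (C.toReal + max R 0) := by
      rw [integral_const_mul, integral_neg, integral_add hAi (hSi.const_mul _),
        integral_const_mul]
      gcongr
      linarith
    have hae : ∀ᵐ z ∂(spaceTime T ρ hρ), z.1 ∈ Icc (0 : ℝ) T :=
      ae_spaceTime_of_forall (measurable_fst measurableSet_Icc) fun t ht x => ht
    have hpt : ∀ z : ℝ × Phase d, z.1 ∈ Icc (0 : ℝ) T →
        ((1 + ε * lyap γ V z.2) ^ 2)⁻¹ * energyDensity m γ V z.2 ≤
          a⁻¹ * -(A z + γ ^ 2 / 2 * ∑ i, pderT f z i ^ 2) := fun z hz => by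
      have h1 := generator_lyapTest_le (m := m) hV hK1 hK hcD hγ (hbd z) hε.le (hcb z.1).1
        (hcb z.1).2.1 (hcd z.1 hz).2
      have h2 := energyDensity_nonneg (V := V) hm γ z.2
      have h3 : 0 ≤ ((1 + ε * lyap γ V z.2) ^ 2)⁻¹ := by positivity
      have h4 := mul_le_mul_of_nonneg_right (hcd z.1 hz).1 (mul_nonneg h3 h2)
      rw [le_inv_mul_iff₀ ha]
      unfold energyDensity at *
      simp only [hA, hf]
      linarith
    have hW0 : ∀ z : ℝ × Phase d,
        0 ≤ ((1 + ε * lyap γ V z.2) ^ 2)⁻¹ * energyDensity m γ V z.2 := fun z =>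
      mul_nonneg (by positivity) (energyDensity_nonneg (V := V) hm γ z.2)
    calc _ ≤ ∫⁻ z, ENNReal.ofReal (a⁻¹ * -(A z + γ ^ 2 / 2 * ∑ i, pderT f z i ^ 2))
          ∂(spaceTime T ρ hρ) := by
          refine lintegral_mono_ae ?_
          filter_upwards [hae] with z hz
          exact ENNReal.ofReal_le_ofReal (hpt z hz)
      _ = ENNReal.ofReal (∫ z, a⁻¹ * -(A z + γ ^ 2 / 2 * ∑ i, pderT f z i ^ 2)
          ∂(spaceTime T ρ hρ)) := by
          refine (ofReal_integral_eq_lintegral_ofReal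
            ((hAi.add (hSi.const_mul _)).neg.const_mul _) ?_).symm
          filter_upwards [hae] with z hz
          exact (hW0 z).trans (hpt z hz)
      _ ≤ _ := ENNReal.ofReal_le_ofReal hneg
  have hUc := (contDiff_lyap hV γ).continuous
  have hEc := continuous_energyDensity (m := m) hV γ
  have hlim : ∀ z : ℝ × Phase d, Tendsto (fun k : ℕ => ENNReal.ofReal
      (((1 + 1 / ((k : ℝ) + 1) * lyap γ V z.2) ^ 2)⁻¹ * energyDensity m γ V z.2)) atTop
      (𝓝 (ENNReal.ofReal (energyDensity m γ V z.2))) := fun z => by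
    refine (ENNReal.continuous_ofReal.tendsto _).comp ?_
    have h1 := tendsto_one_div_add_atTop_nhds_zero_nat (𝕜 := ℝ)
    have h2 := ((((h1.mul_const (lyap γ V z.2)).const_add 1).pow 2).inv₀
      (by simp)).mul_const (energyDensity m γ V z.2)
    simpa using h2
  calc _ = ∫⁻ z, liminf (fun k : ℕ => ENNReal.ofReal
      (((1 + 1 / ((k : ℝ) + 1) * lyap γ V z.2) ^ 2)⁻¹ * energyDensity m γ V z.2)) atTop
      ∂(spaceTime T ρ hρ) := lintegral_congr fun z => (hlim z).liminf_eq.symm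
    _ ≤ liminf (fun k : ℕ => ∫⁻ z, ENNReal.ofReal
      (((1 + 1 / ((k : ℝ) + 1) * lyap γ V z.2) ^ 2)⁻¹ * energyDensity m γ V z.2)
      ∂(spaceTime T ρ hρ)) atTop := lintegral_liminf_le fun k => by
        have := hUc.measurable
        have := hEc.measurable
        fun_prop
    _ ≤ _ := liminf_le_of_frequently_le' (Frequently.of_forall fun k => main _ (by positivity))

include hV hK1 hK in
theorem lyap_le_phaseWeight {γ : ℝ} (hγ : 1 ≤ γ) (x : Phase d) :
    lyap γ V x ≤ 1 + (3 + 2 * d * K ^ 2) * phaseWeight V x := by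
  rw [lyap_eq, phaseWeight]
  have hp : ∀ j, (x.2 j / γ) ^ 2 ≤ x.2 j ^ 2 := fun j => by
    rw [div_pow]
    exact div_le_self (sq_nonneg _) (by nlinarith)
  have hP : ∑ j, (x.2 j / γ) ^ 2 ≤ ∑ j, x.2 j ^ 2 := Finset.sum_le_sum fun j _ => hp j
  have hn : ‖γ⁻¹ • x.2‖ ^ 2 ≤ ∑ j, x.2 j ^ 2 := by
    refine (sq_norm_le_sum_sq _).trans (le_trans (Finset.sum_le_sum fun j _ => ?_) hP)
    rw [Pi.smul_apply, smul_eq_mul, inv_mul_eq_div]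
  have hu : ∀ j, unitDiff V j (xiL γ x) ^ 2 ≤
      2 * unitDiff V j x.1 ^ 2 + 2 * (K ^ 2 * ∑ j, x.2 j ^ 2) := fun j => by
    have h1 : |unitDiff V j (xiL γ x) - unitDiff V j x.1| ≤ K * ‖γ⁻¹ • x.2‖ := by
      have := Convex.norm_image_sub_le_of_norm_fderiv_le (𝕜 := ℝ) (f := unitDiff V j) (C := K)
        (fun q _ => ((contDiff_unitDiff hV j).differentiable (by norm_num)) q)
        (fun q _ => norm_fderiv_unitDiff_le hV hK j q) convex_univ (mem_univ x.1)
        (mem_univ (xiL γ x))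
      rwa [xiL_eq, add_sub_cancel_left, Real.norm_eq_abs, ← xiL_eq] at this
    have h2 : (unitDiff V j (xiL γ x) - unitDiff V j x.1) ^ 2 ≤ K ^ 2 * ∑ j, x.2 j ^ 2 := by
      rw [← sq_abs]
      calc _ ≤ (K * ‖γ⁻¹ • x.2‖) ^ 2 := by gcongr
        _ = K ^ 2 * ‖γ⁻¹ • x.2‖ ^ 2 := by ring
        _ ≤ _ := by gcongr
    nlinarith [sq_nonneg (unitDiff V j (xiL γ x) - 2 * unitDiff V j x.1)]
  have hU : ∑ j, unitDiff V j (xiL γ x) ^ 2 ≤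
      2 * ∑ j, unitDiff V j x.1 ^ 2 + 2 * d * K ^ 2 * ∑ j, x.2 j ^ 2 := by
    refine (Finset.sum_le_sum fun j _ => hu j).trans_eq ?_
    rw [Finset.sum_add_distrib, ← Finset.mul_sum]
    simp
    ring
  have h0 : 0 ≤ ∑ j, unitDiff V j x.1 ^ 2 := Finset.sum_nonneg fun _ _ => sq_nonneg _
  have h1 : 0 ≤ ∑ j, x.2 j ^ 2 := Finset.sum_nonneg fun _ _ => sq_nonneg _
  have h2 : 0 ≤ 2 * d * K ^ 2 * ∑ j, unitDiff V j x.1 ^ 2 := by positivity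
  nlinarith

end Energy

/-- Uniform space-time energy bound for curves with bounded rate functional and initial free
energy. -/
theorem exists_uniform_energy_bound {d : ℕ} {m : ℝ} {V ψ : (Fin d → ℝ) → ℝ}
    (hyp : PotentialHyp d m V ψ) {T : ℝ} (hT : 0 < T) {C : ℝ≥0∞} (hC : C ≠ ⊤) :
    ∃ B : ℝ, ∀ (γ : ℝ), 1 ≤ γ → ∀ (ρ : ℝ → ProbabilityMeasure (Phase d)) (hρ : Continuous ρ),
      RateI m γ T V ψ ρ + FreeEnergy m V ψ (ρ 0 : Measure (Phase d)) ≤ C →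
      ∫⁻ z, ENNReal.ofReal (energyDensity m γ V z.2) ∂(spaceTime T ρ hρ) ≤
        ENNReal.ofReal B := by
  obtain ⟨K₁, hK₁⟩ := hyp.V_hess_bdd
  obtain ⟨K₂, hK₂⟩ := hyp.ψ_deriv_bdd
  set K := max 1 (max K₁ K₂)
  have hK1 : 1 ≤ K := le_max_left _ _
  have hK : ∀ q, ‖fderiv ℝ (fderiv ℝ V) q‖ ≤ K := fun q =>
    (hK₁ q).trans ((le_max_left _ _).trans (le_max_right _ _))
  have hψK : ∀ q, ‖fderiv ℝ ψ q‖ ≤ K := fun q =>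
    (hK₂ q).1.trans ((le_max_right _ _).trans (le_max_right _ _))
  obtain ⟨hfin, δ, hδ, hexp⟩ := integrable_exp_phaseWeight hyp
  have hwc : Continuous (phaseWeight V) := by
    have : ∀ i, Continuous (unitDiff V i) := fun i => (contDiff_unitDiff hyp.V_smooth i).continuous
    unfold phaseWeight
    fun_prop
  have hw0 : ∀ x, 0 ≤ phaseWeight V x := fun x =>
    add_nonneg (Finset.sum_nonneg fun _ _ => sq_nonneg _) (Finset.sum_nonneg fun _ _ => sq_nonneg _)
  obtain ⟨R, hR⟩ := exists_lintegral_le_of_relEntDV_le (S := fun x => δ * phaseWeight V x)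
    (by fun_prop) (fun x => mul_nonneg hδ.le (hw0 x)) hexp hC
  obtain ⟨B, hB⟩ := exists_lintegral_energyDensity_le hyp.V_smooth hK1 hK hyp.ψ_smooth hψK
    hyp.hm hT
  set A := (3 + 2 * d * K ^ 2) / δ with hA
  have hA0 : 0 ≤ A := by positivity
  refine ⟨B * (C.toReal + max (1 + A * max R 0) 0), fun γ hγ ρ hρ hb => ?_⟩
  refine hB (by linarith) hρ hC (le_self_add.trans hb) ?_
  have h1 : relEntDV (ρ 0 : Measure (Phase d)) (gibbs d m V) ≤ C :=
    (le_self_add.trans (le_add_self (a := FreeEnergy m V ψ (ρ 0 : Measure (Phase d))))).trans hb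
  have h2 := hR (ρ 0) h1
  calc ∫⁻ x, ENNReal.ofReal (lyap γ V x) ∂(ρ 0 : Measure (Phase d))
      ≤ ∫⁻ x, (1 + ENNReal.ofReal A * ENNReal.ofReal (δ * phaseWeight V x))
        ∂(ρ 0 : Measure (Phase d)) := by
        refine lintegral_mono fun x => ?_
        rw [← ENNReal.ofReal_mul hA0, ← ENNReal.ofReal_one, ← ENNReal.ofReal_add zero_le_one
          (mul_nonneg hA0 (mul_nonneg hδ.le (hw0 x)))]
        refine ENNReal.ofReal_le_ofReal ((lyap_le_phaseWeight hyp.V_smooth hK1 hK hγ x).trans_eq ?_)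
        rw [hA]; field_simp
    _ = 1 + ENNReal.ofReal A *
        ∫⁻ x, ENNReal.ofReal (δ * phaseWeight V x) ∂(ρ 0 : Measure (Phase d)) := by
        have := hwc.measurable
        rw [lintegral_add_left measurable_const, lintegral_const_mul _ (by fun_prop)]
        simp
    _ ≤ 1 + ENNReal.ofReal A * ENNReal.ofReal (max R 0) := by
        gcongr
        exact h2.trans (ENNReal.ofReal_le_ofReal (le_max_left _ _))
    _ = _ := by
        rw [← ENNReal.ofReal_mul hA0, ← ENNReal.ofReal_one, ← ENNReal.ofReal_add zero_le_one
          (mul_nonneg hA0 (le_max_right _ _))]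

section Config

variable {d : ℕ} {T : ℝ} {V ψ : (Fin d → ℝ) → ℝ}

/-- `(∂_i ψ ∗ ν)(q)` for a measure `ν` on configuration space. -/
def convGrad (ψ : (Fin d → ℝ) → ℝ) (ν : Measure (Fin d → ℝ)) (q : Fin d → ℝ) (i : Fin d) : ℝ :=
  ∫ q', fderiv ℝ ψ (q - q') (Pi.single i 1) ∂ν

/-- The integrand of the limiting functional without the quadratic term. -/
def limGen (V ψ : (Fin d → ℝ) → ℝ) (ν : Measure (Fin d → ℝ)) (g : ℝ × (Fin d → ℝ) → ℝ)
    (z : ℝ × (Fin d → ℝ)) : ℝ :=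
  tderQ g z - (∑ i, fderiv ℝ V z.2 (Pi.single i 1) * qderQ g z i)
    - (∑ i, convGrad ψ ν z.2 i * qderQ g z i) + laplQ g z

theorem abs_convGrad_le {K : ℝ} (hK : ∀ q, ‖fderiv ℝ ψ q‖ ≤ K) (ν : Measure (Fin d → ℝ))
    [IsProbabilityMeasure ν] (q : Fin d → ℝ) (i : Fin d) : |convGrad ψ ν q i| ≤ K := by
  have := norm_integral_le_of_norm_le_const (μ := ν)
    (f := fun y => fderiv ℝ ψ (q - y) (Pi.single i 1)) (C := K)
    (Eventually.of_forall fun y => abs_clm_single_le _ (hK _) i)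
  simpa [convGrad] using this

theorem measurable_convGrad {σ : ℝ → ProbabilityMeasure (Fin d → ℝ)} (hσ : Continuous σ)
    (hψ : ContDiff ℝ 2 ψ) (i : Fin d) :
    Measurable fun z : ℝ × (Fin d → ℝ) =>
      convGrad ψ (σ z.1 : Measure (Fin d → ℝ)) z.2 i := by
  have hc := continuous_fderiv_single hψ i
  have : Continuous fun y : (ℝ × (Fin d → ℝ)) × (Fin d → ℝ) =>
      fderiv ℝ ψ (y.1.2 - y.2) (Pi.single i 1) := by fun_prop
  exact (MeasureTheory.StronglyMeasurable.integral_kernel_prod_right'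
    (κ := (curveKernel σ hσ).comap Prod.fst measurable_fst)
    this.measurable.stronglyMeasurable).measurable

variable {g : ℝ × (Fin d → ℝ) → ℝ} (hg : ContDiff ℝ 2 g)

include hg in
theorem continuous_tderQ : Continuous (tderQ g) := continuous_fderiv_apply_of_contDiff hg _

include hg in
theorem continuous_qderQ (i : Fin d) : Continuous fun z => qderQ g z i :=
  continuous_fderiv_apply_of_contDiff hg _

include hg in
theorem continuous_laplQ : Continuous (laplQ g) :=
  continuous_finsetSum _ fun _ _ => continuous_fderiv_fderiv_apply hg _ _

theorem norm_dir_le_one (i : Fin d) :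
    ‖((0 : ℝ), (Pi.single i (1 : ℝ) : Fin d → ℝ))‖ ≤ 1 := by
  simp [Prod.norm_def, Pi.norm_single]

theorem abs_tderQ_le {M : ℝ} (hM : ∀ z, ‖fderiv ℝ g z‖ ≤ M) (z : ℝ × (Fin d → ℝ)) :
    |tderQ g z| ≤ M := by
  have := (fderiv ℝ g z).le_of_opNorm_le (hM z) (1, 0)
  simpa [tderQ, Prod.norm_def] using this

theorem abs_qderQ_le {M : ℝ} (hM : ∀ z, ‖fderiv ℝ g z‖ ≤ M) (z : ℝ × (Fin d → ℝ)) (i : Fin d) :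
    |qderQ g z i| ≤ M := by
  have := (fderiv ℝ g z).le_of_opNorm_le (hM z) (0, Pi.single i 1)
  simpa [qderQ, Prod.norm_def, Pi.norm_single] using this

include hg in
theorem abs_laplQ_le {M : ℝ} (hM : ∀ z, ‖fderiv ℝ (fderiv ℝ g) z‖ ≤ M)
    (z : ℝ × (Fin d → ℝ)) : |laplQ g z| ≤ d * M := by
  unfold laplQ qderQ
  refine (Finset.abs_sum_le_sum_abs _ _).trans ((Finset.sum_le_card_nsmul _ _ M fun i _ => ?_).trans_eq
    (by simp))
  rw [fderiv_fderiv_apply hg]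
  have := (fderiv ℝ (fderiv ℝ g) z).le_of_opNorm₂_le_of_le (hM z) (norm_dir_le_one i)
    (norm_dir_le_one i)
  simpa using this

/-- Convergence of the interaction term along narrowly convergent curves. -/
theorem tendsto_integral_convGrad_mul {σs : ℕ → ℝ → ProbabilityMeasure (Fin d → ℝ)}
    {σ : ℝ → ProbabilityMeasure (Fin d → ℝ)} (hs : ∀ n, Continuous (σs n)) (hσ : Continuous σ)
    (hconv : ∀ t ∈ Icc (0 : ℝ) T, Tendsto (fun n => σs n t) atTop (𝓝 (σ t)))
    (hψ : ContDiff ℝ 2 ψ) {K : ℝ} (hK : ∀ q, ‖fderiv ℝ ψ q‖ ≤ K) {h : ℝ × (Fin d → ℝ) → ℝ}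
    (hh : Continuous h) {M : ℝ} (hM : ∀ z, |h z| ≤ M) (i : Fin d) :
    Tendsto (fun n => ∫ z, convGrad ψ (σs n z.1 : Measure (Fin d → ℝ)) z.2 i * h z
      ∂(spaceTime T (σs n) (hs n))) atTop
      (𝓝 (∫ z, convGrad ψ (σ z.1 : Measure (Fin d → ℝ)) z.2 i * h z ∂(spaceTime T σ hσ))) := by
  have hK0 : 0 ≤ K := (norm_nonneg _).trans (hK 0)
  have hbd : ∀ (τ : ℝ → ProbabilityMeasure (Fin d → ℝ)) (z : ℝ × (Fin d → ℝ)),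
      |convGrad ψ (τ z.1 : Measure (Fin d → ℝ)) z.2 i * h z| ≤ K * M := fun τ z => by
    rw [abs_mul]
    gcongr
    exacts [abs_convGrad_le hK _ _ _, hM z]
  have hmeas : ∀ (τ : ℝ → ProbabilityMeasure (Fin d → ℝ)), Continuous τ →
      Measurable fun z : ℝ × (Fin d → ℝ) =>
        convGrad ψ (τ z.1 : Measure (Fin d → ℝ)) z.2 i * h z := fun τ hτ =>
    (measurable_convGrad hτ hψ i).mul hh.measurable
  have hint : ∀ (τ : ℝ → ProbabilityMeasure (Fin d → ℝ)) (hτ : Continuous τ),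
      Integrable (fun z : ℝ × (Fin d → ℝ) =>
        convGrad ψ (τ z.1 : Measure (Fin d → ℝ)) z.2 i * h z) (spaceTime T τ hτ) := fun τ hτ =>
    integrable_of_measurable_bdd (hmeas τ hτ) (hbd τ)
  rw [integral_spaceTime (hint _ _)]
  simp_rw [fun n => integral_spaceTime (hint (σs n) (hs n))]
  refine tendsto_integral_of_dominated_convergence (fun _ => K * M) (fun n => ?_)
    (integrable_const _) (fun n => ?_) ?_
  · exact (MeasureTheory.StronglyMeasurable.integral_kernel_prod_right'
      (κ := curveKernel (σs n) (hs n)) (hmeas (σs n) (hs n)).stronglyMeasurable).aestronglyMeasurable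
  · refine Eventually.of_forall fun t => ?_
    have := norm_integral_le_of_norm_le_const (μ := (σs n t : Measure (Fin d → ℝ)))
      (f := fun x => convGrad ψ (σs n t : Measure (Fin d → ℝ)) x i * h (t, x))
      (C := K * M) (Eventually.of_forall fun x => hbd (σs n) (t, x))
    simpa using this
  · filter_upwards [ae_restrict_mem measurableSet_Icc] with t ht
    have hc := continuous_fderiv_single hψ i
    have hFc : Continuous fun y : (Fin d → ℝ) × (Fin d → ℝ) =>
        fderiv ℝ ψ (y.1 - y.2) (Pi.single i 1) * h (t, y.1) := by fun_prop
    have hFb : ∀ y : (Fin d → ℝ) × (Fin d → ℝ),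
        |fderiv ℝ ψ (y.1 - y.2) (Pi.single i 1) * h (t, y.1)| ≤ K * M := fun y => by
      rw [abs_mul]
      gcongr
      exacts [abs_clm_single_le _ (hK _) i, hM _]
    have hprod : ∀ ν : ProbabilityMeasure (Fin d → ℝ),
        ∫ x, convGrad ψ (ν : Measure (Fin d → ℝ)) x i * h (t, x) ∂(ν : Measure (Fin d → ℝ)) =
        ∫ y : (Fin d → ℝ) × (Fin d → ℝ), fderiv ℝ ψ (y.1 - y.2) (Pi.single i 1) * h (t, y.1)
          ∂(ν.prod ν : ProbabilityMeasure _).toMeasure := fun ν => by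
      rw [ProbabilityMeasure.toMeasure_prod,
        integral_prod _ (integrable_of_measurable_bdd hFc.measurable hFb)]
      simp_rw [integral_mul_const]
      rfl
    simp_rw [hprod]
    have h1 : Tendsto (fun n => (σs n t).prod (σs n t)) atTop (𝓝 ((σ t).prod (σ t))) :=
      (ProbabilityMeasure.continuous_prod.tendsto (σ t, σ t)).comp
        ((hconv t ht).prodMk_nhds (hconv t ht))
    have h2 := ProbabilityMeasure.tendsto_iff_forall_integral_tendsto.1 h1
      (BoundedContinuousFunction.ofNormedAddCommGroup _ hFc (K * M) hFb)
    simpa using h2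

include hg in
/-- Convergence of the limiting generator along narrowly convergent curves with uniformly
bounded second moments of the force. -/
theorem tendsto_integral_limGen {σs : ℕ → ℝ → ProbabilityMeasure (Fin d → ℝ)}
    {σ : ℝ → ProbabilityMeasure (Fin d → ℝ)} (hs : ∀ n, Continuous (σs n)) (hσ : Continuous σ)
    (hconv : ∀ t ∈ Icc (0 : ℝ) T, Tendsto (fun n => σs n t) atTop (𝓝 (σ t)))
    (hψ : ContDiff ℝ 2 ψ) {K : ℝ} (hK : ∀ q, ‖fderiv ℝ ψ q‖ ≤ K) (hV : ContDiff ℝ 2 V)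
    {M : ℝ} (hM : ∀ z, ‖fderiv ℝ g z‖ ≤ M ∧ ‖fderiv ℝ (fderiv ℝ g) z‖ ≤ M) {B : ℝ}
    (hB : ∀ᶠ n in atTop, ∀ i, Integrable
      (fun z : ℝ × (Fin d → ℝ) => fderiv ℝ V z.2 (Pi.single i 1) ^ 2) (spaceTime T (σs n) (hs n)) ∧
      ∫ z, fderiv ℝ V z.2 (Pi.single i 1) ^ 2 ∂(spaceTime T (σs n) (hs n)) ≤ B) :
    Integrable (fun z => limGen V ψ (σ z.1 : Measure (Fin d → ℝ)) g z) (spaceTime T σ hσ) ∧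
    (∀ᶠ n in atTop, Integrable (fun z => limGen V ψ (σs n z.1 : Measure (Fin d → ℝ)) g z)
      (spaceTime T (σs n) (hs n))) ∧
    Tendsto (fun n => ∫ z, limGen V ψ (σs n z.1 : Measure (Fin d → ℝ)) g z
      ∂(spaceTime T (σs n) (hs n))) atTop
      (𝓝 (∫ z, limGen V ψ (σ z.1 : Measure (Fin d → ℝ)) g z ∂(spaceTime T σ hσ))) := by
  have hK0 : 0 ≤ K := (norm_nonneg _).trans (hK 0)
  have hM0 : 0 ≤ M := (norm_nonneg _).trans (hM 0).1
  have hq := fun z i => abs_qderQ_le (fun z => (hM z).1) z i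
  have hqc := fun i => continuous_qderQ hg i
  have hVc : ∀ i, Continuous fun z : ℝ × (Fin d → ℝ) =>
      fderiv ℝ V z.2 (Pi.single i 1) * qderQ g z i := fun i =>
    ((continuous_fderiv_single hV i).comp continuous_snd).mul (hqc i)
  have hbcc : ∀ F : ℝ × (Fin d → ℝ) → ℝ, Continuous F → (∃ M, ∀ y, |F y| ≤ M) →
      Tendsto (fun n => ∫ y, F y ∂(spaceTime T (σs n) (hs n))) atTop
        (𝓝 (∫ y, F y ∂(spaceTime T σ hσ))) := fun F hF ⟨M, hM⟩ =>
    tendsto_integral_spaceTime hs hσ hconv hF hM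
  -- the force term
  have hsq : ∀ᶠ n in atTop, ∀ i, Integrable (fun z : ℝ × (Fin d → ℝ) =>
      (fderiv ℝ V z.2 (Pi.single i 1) * qderQ g z i) ^ 2) (spaceTime T (σs n) (hs n)) ∧
      ∫ z, (fderiv ℝ V z.2 (Pi.single i 1) * qderQ g z i) ^ 2 ∂(spaceTime T (σs n) (hs n))
        ≤ M ^ 2 * B := by
    filter_upwards [hB] with n hn i
    have hle : ∀ z : ℝ × (Fin d → ℝ), (fderiv ℝ V z.2 (Pi.single i 1) * qderQ g z i) ^ 2 ≤
        M ^ 2 * fderiv ℝ V z.2 (Pi.single i 1) ^ 2 := fun z => by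
      rw [mul_pow, mul_comm]
      gcongr ?_ * _
      rw [sq_le_sq, abs_of_nonneg hM0]
      exact hq z i
    have h1 := (hn i).1.const_mul (M ^ 2)
    refine ⟨h1.mono' ((hVc i).pow 2).aestronglyMeasurable (Eventually.of_forall fun z => ?_), ?_⟩
    · rw [Real.norm_eq_abs, abs_of_nonneg (sq_nonneg _)]
      exact hle z
    · refine (integral_mono_of_nonneg (Eventually.of_forall fun z => sq_nonneg _) h1
        (Eventually.of_forall hle)).trans ?_
      rw [integral_const_mul]
      gcongr
      exact (hn i).2
  have hVt := fun i => tendsto_integral_of_sq_bound hbcc (hVc i) (hsq.mono fun n hn => hn i)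
  -- the bounded terms
  have hGc : Continuous fun z => tderQ g z + laplQ g z :=
    (continuous_tderQ hg).add (continuous_laplQ hg)
  have hGb : ∀ z, |tderQ g z + laplQ g z| ≤ M + d * M := fun z =>
    (abs_add_le _ _).trans (add_le_add (abs_tderQ_le (fun z => (hM z).1) z)
      (abs_laplQ_le hg (fun z => (hM z).2) z))
  have hGi : ∀ (τ : ℝ → ProbabilityMeasure (Fin d → ℝ)) (hτ : Continuous τ),
      Integrable (fun z => tderQ g z + laplQ g z) (spaceTime T τ hτ) := fun τ hτ =>
    integrable_of_measurable_bdd hGc.measurable hGb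
  have hψi : ∀ (τ : ℝ → ProbabilityMeasure (Fin d → ℝ)) (hτ : Continuous τ) (i : Fin d),
      Integrable (fun z => convGrad ψ (τ z.1 : Measure (Fin d → ℝ)) z.2 i * qderQ g z i)
        (spaceTime T τ hτ) := fun τ hτ i =>
    integrable_of_measurable_bdd (M := K * M)
      ((measurable_convGrad hτ hψ i).mul (hqc i).measurable) fun z => by
      rw [abs_mul]
      gcongr
      exacts [abs_convGrad_le hK _ _ _, hq z i]
  -- assembling
  have hdec : ∀ (τ : ℝ → ProbabilityMeasure (Fin d → ℝ)) (hτ : Continuous τ),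
      (∀ i, Integrable (fun z : ℝ × (Fin d → ℝ) =>
        fderiv ℝ V z.2 (Pi.single i 1) * qderQ g z i) (spaceTime T τ hτ)) →
      Integrable (fun z => limGen V ψ (τ z.1 : Measure (Fin d → ℝ)) g z) (spaceTime T τ hτ) ∧
      ∫ z, limGen V ψ (τ z.1 : Measure (Fin d → ℝ)) g z ∂(spaceTime T τ hτ) =
        ∫ z, (tderQ g z + laplQ g z) ∂(spaceTime T τ hτ)
        - ∑ i, ∫ z, fderiv ℝ V z.2 (Pi.single i 1) * qderQ g z i ∂(spaceTime T τ hτ)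
        - ∑ i, ∫ z, convGrad ψ (τ z.1 : Measure (Fin d → ℝ)) z.2 i * qderQ g z i
          ∂(spaceTime T τ hτ) := by
    intro τ hτ hi
    have e1 := integrable_finsetSum Finset.univ fun i _ => hi i
    have e2 := integrable_finsetSum Finset.univ fun i _ => hψi τ hτ i
    have e3 : (fun z => limGen V ψ (τ z.1 : Measure (Fin d → ℝ)) g z) = fun z =>
        (tderQ g z + laplQ g z) - (∑ i, fderiv ℝ V z.2 (Pi.single i 1) * qderQ g z i)
        - ∑ i, convGrad ψ (τ z.1 : Measure (Fin d → ℝ)) z.2 i * qderQ g z i := by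
      funext z; unfold limGen; ring
    rw [e3]
    have e4 : Integrable (fun z => (tderQ g z + laplQ g z)
        - ∑ i, fderiv ℝ V z.2 (Pi.single i 1) * qderQ g z i) (spaceTime T τ hτ) :=
      (hGi τ hτ).sub e1
    refine ⟨e4.sub e2, ?_⟩
    rw [integral_sub e4 e2, integral_sub (hGi τ hτ) e1,
      integral_finsetSum _ fun i _ => hi i, integral_finsetSum _ fun i _ => hψi τ hτ i]
  have hVi : ∀ᶠ n in atTop, ∀ i, Integrable (fun z : ℝ × (Fin d → ℝ) =>
      fderiv ℝ V z.2 (Pi.single i 1) * qderQ g z i) (spaceTime T (σs n) (hs n)) :=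
    hsq.mono fun n hn i => integrable_of_integrable_sq (hVc i).measurable (hn i).1
  refine ⟨(hdec σ hσ fun i => (hVt i).1).1, hVi.mono fun n hn => (hdec _ _ hn).1, ?_⟩
  rw [(hdec σ hσ fun i => (hVt i).1).2]
  refine (((hbcc _ hGc ⟨_, hGb⟩).sub (tendsto_finsetSum _ fun i _ => (hVt i).2)).sub
    (tendsto_finsetSum _ fun i _ => tendsto_integral_convGrad_mul hs hσ hconv hψ hK (hqc i)
      (fun z => hq z i) i)).congr' ?_
  filter_upwards [hVi] with n hn
  exact (hdec _ (hs n) hn).2.symm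

end Config

section Push

variable {X Y : Type*} [TopologicalSpace X] [MeasurableSpace X] [BorelSpace X]
  [HasOuterApproxClosed X] [TopologicalSpace Y] [MeasurableSpace Y] [BorelSpace Y]
  [HasOuterApproxClosed Y] {f : X → Y} {ρ : ℝ → ProbabilityMeasure X}

omit [HasOuterApproxClosed X] [HasOuterApproxClosed Y] in
theorem continuous_pushCurve (hf : Continuous f) (hρ : Continuous ρ) :
    Continuous (pushCurve f hf.measurable ρ) :=
  (ProbabilityMeasure.continuous_map hf).comp hρ

theorem spaceTime_pushCurve (T : ℝ) (hf : Continuous f) (hρ : Continuous ρ) :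
    spaceTime T (pushCurve f hf.measurable ρ) (continuous_pushCurve hf hρ) =
      (spaceTime T ρ hρ).map (Prod.map id f) := by
  unfold spaceTime
  rw [← Measure.compProd_map hf.measurable]
  congr 1
  ext t : 1
  rw [ProbabilityTheory.Kernel.map_apply _ hf.measurable]
  rfl

end Push

section CoarseGraining

variable {d : ℕ}

/-- The coarse-graining map `(t, q, p) ↦ (t, q + p/γ)` on space-time. -/
def coarse (d : ℕ) (γ : ℝ) : (ℝ × Phase d) →L[ℝ] (ℝ × (Fin d → ℝ)) :=
  (ContinuousLinearMap.id ℝ ℝ).prodMap (xiL γ)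

theorem coarse_apply (γ : ℝ) (z : ℝ × Phase d) : coarse d γ z = (z.1, xiL γ z.2) := rfl

variable {V ψ : (Fin d → ℝ) → ℝ} {g : ℝ × (Fin d → ℝ) → ℝ} {m γ : ℝ}

theorem pderT_comp_coarse (hg : ContDiff ℝ 2 g) (z : ℝ × Phase d) (i : Fin d) :
    pderT (fun y => g (coarse d γ y)) z i = γ⁻¹ * qderQ g (coarse d γ z) i := by
  unfold pderT qderQ
  rw [fderiv_comp_clm_apply _ ((hg.differentiable (by norm_num)) _), coarse_apply,
    coarse_apply]
  simp only [xiL_dirP]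
  rw [← smul_eq_mul, ← map_smul, Prod.smul_mk, smul_zero]

theorem laplPT_comp_coarse (hg : ContDiff ℝ 2 g) (z : ℝ × Phase d) :
    laplPT (fun y => g (coarse d γ y)) z = γ⁻¹ ^ 2 * laplQ g (coarse d γ z) := by
  unfold laplPT laplQ pderT qderQ
  rw [Finset.mul_sum]
  refine Finset.sum_congr rfl fun i _ => ?_
  have hs : coarse d γ (0, dirP i) = γ⁻¹ • (0, Pi.single i 1) := by
    rw [coarse_apply, xiL_dirP, Prod.smul_mk, smul_zero]
  have hgc : ContDiff ℝ 2 fun y => g (coarse d γ y) := hg.comp (coarse d γ).contDiff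
  rw [fderiv_fderiv_apply hgc, fderiv_fderiv_apply hg,
    fderiv_fderiv_comp_clm_apply _ hg, hs]
  simp only [map_smul, smul_eq_mul, _root_.smul_apply]
  ring

theorem generator_comp_coarse (hg : ContDiff ℝ 2 g) (hγ : 0 < γ) (ν : Measure (Phase d))
    (z : ℝ × Phase d) :
    tder (fun y => g (coarse d γ y)) z + Lop m γ V ψ ν (fun y => g (coarse d γ y)) z =
      tderQ g (coarse d γ z)
      - (∑ i, (fderiv ℝ V z.2.1 (Pi.single i 1) + convGradPsi ψ ν z.2.1 i) *
          qderQ g (coarse d γ z) i)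
      + laplQ g (coarse d γ z) := by
  have h1 : tder (fun y => g (coarse d γ y)) z = tderQ g (coarse d γ z) := by
    unfold tder tderQ
    rw [fderiv_comp_clm_apply _ ((hg.differentiable (by norm_num)) _), coarse_apply,
      coarse_apply]
    simp only [map_zero]
  have h2 : ∀ i, qderT (fun y => g (coarse d γ y)) z i = qderQ g (coarse d γ z) i := fun i => by
    unfold qderT qderQ
    rw [fderiv_comp_clm_apply _ ((hg.differentiable (by norm_num)) _), coarse_apply,
      coarse_apply]
    simp only [xiL_dirQ]
  unfold Lop
  simp_rw [h1, h2, pderT_comp_coarse hg, laplPT_comp_coarse hg, mul_left_comm _ γ⁻¹,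
    ← Finset.mul_sum]
  field_simp
  ring

/-- The error made by replacing the generator acting on a coarse-grained function by the limiting
generator. -/
def coarseError (m γ : ℝ) (V ψ : (Fin d → ℝ) → ℝ) (ν : Measure (Phase d))
    (g : ℝ × (Fin d → ℝ) → ℝ) (z : ℝ × Phase d) : ℝ :=
  (tder (fun y => g (coarse d γ y)) z + Lop m γ V ψ ν (fun y => g (coarse d γ y)) z) -
    limGen V ψ (ν.map (xiL γ)) g (coarse d γ z)

theorem norm_sub_xiL (hγ : 0 < γ) (x : Phase d) : ‖x.1 - xiL γ x‖ = γ⁻¹ * ‖x.2‖ := by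
  rw [xiL_eq, sub_add_cancel_left, norm_neg, norm_smul, Real.norm_eq_abs,
    abs_of_pos (inv_pos.2 hγ)]

theorem abs_fderiv_single_sub_le {W : (Fin d → ℝ) → ℝ} (hW : ContDiff ℝ 2 W) {K : ℝ}
    (hK : ∀ q, ‖fderiv ℝ (fderiv ℝ W) q‖ ≤ K) (x y : Fin d → ℝ) (i : Fin d) :
    |fderiv ℝ W x (Pi.single i 1) - fderiv ℝ W y (Pi.single i 1)| ≤ K * ‖x - y‖ := by
  rw [← _root_.sub_apply]
  exact abs_clm_single_le _ (norm_fderiv_sub_le_of_second hW hK x y) i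

theorem enorm_coarseError_le (hV : ContDiff ℝ 2 V) (hψ : ContDiff ℝ 2 ψ) {K : ℝ}
    (hVK : ∀ q, ‖fderiv ℝ (fderiv ℝ V) q‖ ≤ K) (hψK : ∀ q, ‖fderiv ℝ ψ q‖ ≤ K)
    (hψK2 : ∀ q, ‖fderiv ℝ (fderiv ℝ ψ) q‖ ≤ K) (hg : ContDiff ℝ 2 g) {M : ℝ}
    (hM : ∀ z, ‖fderiv ℝ g z‖ ≤ M) (hγ : 0 < γ) (ν : Measure (Phase d)) [IsProbabilityMeasure ν]
    (z : ℝ × Phase d) :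
    ‖coarseError m γ V ψ ν g z‖ₑ ≤ ENNReal.ofReal (d * (K * γ⁻¹ * M)) *
      (2 * ‖z.2.2‖ₑ + ∫⁻ y, ‖y.2‖ₑ ∂ν) := by
  have hK0 : 0 ≤ K := (norm_nonneg _).trans (hψK 0)
  have hM0 : 0 ≤ M := (norm_nonneg _).trans (hM 0)
  have hc := fun i => continuous_fderiv_single hψ i
  have hconv : ∀ i, convGrad ψ (ν.map (xiL γ)) (xiL γ z.2) i =
      ∫ y, fderiv ℝ ψ (xiL γ z.2 - xiL γ y) (Pi.single i 1) ∂ν := fun i => by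
    unfold convGrad
    rw [integral_map (xiL γ).continuous.aemeasurable]
    have := hc i
    exact Continuous.aestronglyMeasurable (by fun_prop)
  have hE : coarseError m γ V ψ ν g z = -∑ i,
      ((fderiv ℝ V z.2.1 (Pi.single i 1) - fderiv ℝ V (xiL γ z.2) (Pi.single i 1)) +
        (convGradPsi ψ ν z.2.1 i - convGrad ψ (ν.map (xiL γ)) (xiL γ z.2) i)) *
          qderQ g (coarse d γ z) i := by
    unfold coarseError limGen
    rw [generator_comp_coarse hg hγ]
    simp only [coarse_apply, add_mul, sub_mul, Finset.sum_add_distrib, Finset.sum_sub_distrib]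
    ring
  have h1 : ∀ i, ‖fderiv ℝ V z.2.1 (Pi.single i 1) - fderiv ℝ V (xiL γ z.2) (Pi.single i 1)‖ₑ ≤
      ENNReal.ofReal (K * γ⁻¹) * ‖z.2.2‖ₑ := fun i => by
    rw [← ofReal_norm, ← ofReal_norm, ← ENNReal.ofReal_mul (by positivity)]
    refine ENNReal.ofReal_le_ofReal ((abs_fderiv_single_sub_le hV hVK _ _ i).trans_eq ?_)
    rw [norm_sub_xiL hγ, mul_assoc]
  have h2 : ∀ i, ‖convGradPsi ψ ν z.2.1 i - convGrad ψ (ν.map (xiL γ)) (xiL γ z.2) i‖ₑ ≤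
      ENNReal.ofReal (K * γ⁻¹) * (‖z.2.2‖ₑ + ∫⁻ y, ‖y.2‖ₑ ∂ν) := fun i => by
    have hci := hc i
    rw [hconv]
    unfold convGradPsi
    rw [← integral_sub]
    rotate_left
    · exact integrable_of_measurable_bdd (M := K)
        (Continuous.measurable (by fun_prop)) fun y => abs_clm_single_le _ (hψK _) i
    · exact integrable_of_measurable_bdd (M := K)
        (Continuous.measurable (by fun_prop)) fun y => abs_clm_single_le _ (hψK _) i
    refine (enorm_integral_le_lintegral_enorm _).trans ?_
    calc _ ≤ ∫⁻ y, ENNReal.ofReal (K * γ⁻¹) * (‖z.2.2‖ₑ + ‖y.2‖ₑ) ∂ν := by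
          refine lintegral_mono fun y => ?_
          simp only [← ofReal_norm]
          rw [← ENNReal.ofReal_add (by positivity) (by positivity),
            ← ENNReal.ofReal_mul (by positivity)]
          refine ENNReal.ofReal_le_ofReal ((abs_fderiv_single_sub_le hψ hψK2 _ _ i).trans ?_)
          rw [mul_assoc]
          gcongr
          have : z.2.1 - y.1 - (xiL γ z.2 - xiL γ y) = (z.2 - y).1 - xiL γ (z.2 - y) := by
            rw [map_sub, Prod.fst_sub]
          rw [this, norm_sub_xiL hγ]
          gcongr
          exact norm_sub_le _ _
      _ = _ := by
          rw [lintegral_const_mul _ (by fun_prop), lintegral_add_left (by fun_prop)]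
          simp
  rw [hE, enorm_neg]
  refine (enorm_sum_le _ _).trans ((Finset.sum_le_card_nsmul _ _ (ENNReal.ofReal (K * γ⁻¹) *
    (2 * ‖z.2.2‖ₑ + ∫⁻ y, ‖y.2‖ₑ ∂ν) * ENNReal.ofReal M) fun i _ => ?_).trans_eq ?_)
  · rw [enorm_mul]
    gcongr
    · refine (enorm_add_le _ _).trans ((add_le_add (h1 i) (h2 i)).trans_eq ?_)
      ring
    · rw [← ofReal_norm]
      exact ENNReal.ofReal_le_ofReal (abs_qderQ_le hM _ i)
  · rw [ENNReal.ofReal_mul d.cast_nonneg, ENNReal.ofReal_mul (p := K * γ⁻¹) (by positivity)]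
    simp only [Finset.card_univ, Fintype.card_fin, nsmul_eq_mul, ENNReal.ofReal_natCast]
    ring

end CoarseGraining

theorem integrable_and_abs_integral_le {Y : Type*} [MeasurableSpace Y] {μ : Measure Y}
    {F : Y → ℝ} (hF : Measurable F) {R : ℝ} (hR : 0 ≤ R)
    (h : ∫⁻ y, ‖F y‖ₑ ∂μ ≤ ENNReal.ofReal R) : Integrable F μ ∧ |∫ y, F y ∂μ| ≤ R := by
  refine ⟨⟨hF.aestronglyMeasurable, h.trans_lt ENNReal.ofReal_lt_top⟩, ?_⟩
  have := (enorm_integral_le_lintegral_enorm F).trans h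
  rwa [← ofReal_norm, ENNReal.ofReal_le_ofReal_iff hR] at this

section EnergyConsequences

variable {d : ℕ} {T : ℝ} {V ψ : (Fin d → ℝ) → ℝ} {m γ : ℝ}

theorem enorm_mom_le (hm : 0 < m) (x : Phase d) :
    ‖x.2‖ₑ ≤ ENNReal.ofReal (1 + m / 2) * ENNReal.ofReal (energyDensity m γ V x) := by
  rw [← ofReal_norm, ← ENNReal.ofReal_mul (by positivity)]
  refine ENNReal.ofReal_le_ofReal ?_
  have h1 := sq_norm_le_sum_sq x.2
  have h2 := one_le_lyap (V := V) γ x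
  have h3 : (1 + m / 2) * energyDensity m γ V x = lyap γ V x + m / 2 * lyap γ V x +
      2 / m * ∑ i, x.2 i ^ 2 + ∑ i, x.2 i ^ 2 := by
    unfold energyDensity; field_simp; ring
  have h4 : 0 ≤ ∑ i, x.2 i ^ 2 := (sq_nonneg _).trans h1
  have h5 : 0 ≤ 2 / m * ∑ i, x.2 i ^ 2 := by positivity
  have h6 : 0 ≤ m / 2 * lyap γ V x := by positivity
  rw [h3]
  nlinarith [sq_nonneg (‖x.2‖ - 1)]

theorem sq_fderiv_xiL_le (hm : 0 < m) (hV : ContDiff ℝ 2 V) {K : ℝ}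
    (hVK : ∀ q, ‖fderiv ℝ (fderiv ℝ V) q‖ ≤ K) (x : Phase d) (i : Fin d) :
    fderiv ℝ V (xiL γ x) (Pi.single i 1) ^ 2 ≤ (1 + K) ^ 2 * energyDensity m γ V x := by
  have hK0 : 0 ≤ K := (norm_nonneg _).trans (hVK 0)
  have h1 := abs_unitDiff_sub_le hV hVK i (xiL γ x)
  have h2 := abs_unitDiff_xiL_le (V := V) γ x i
  have h3 := one_le_sqrt_lyap (V := V) γ x
  have h4 : |fderiv ℝ V (xiL γ x) (Pi.single i 1)| ≤ (1 + K) * √(lyap γ V x) := by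
    rw [abs_le] at *
    constructor <;> nlinarith
  have h5 : lyap γ V x ≤ energyDensity m γ V x := by
    have : 0 ≤ 2 / m * ∑ i, x.2 i ^ 2 :=
      mul_nonneg (by positivity) (Finset.sum_nonneg fun _ _ => sq_nonneg _)
    unfold energyDensity
    linarith
  have h6 := one_le_lyap (V := V) γ x
  calc _ = |fderiv ℝ V (xiL γ x) (Pi.single i 1)| ^ 2 := (sq_abs _).symm
    _ ≤ ((1 + K) * √(lyap γ V x)) ^ 2 := by gcongr
    _ = (1 + K) ^ 2 * lyap γ V x := by rw [mul_pow, Real.sq_sqrt (by linarith)]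
    _ ≤ _ := by gcongr

variable {ρ : ℝ → ProbabilityMeasure (Phase d)} (hρ : Continuous ρ) {B : ℝ}
  (hB : ∫⁻ z, ENNReal.ofReal (energyDensity m γ V z.2) ∂(spaceTime T ρ hρ) ≤ ENNReal.ofReal B)

include hB in
theorem integrable_energyDensity (hm : 0 < m) (hV : ContDiff ℝ 2 V) :
    Integrable (fun z => energyDensity m γ V z.2) (spaceTime T ρ hρ) := by
  refine ⟨((continuous_energyDensity hV γ).comp continuous_snd).aestronglyMeasurable, ?_⟩
  have h0 : ∀ z : ℝ × Phase d, 0 ≤ energyDensity m γ V z.2 := fun z =>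
    energyDensity_nonneg hm γ z.2
  rw [hasFiniteIntegral_iff_ofReal (Eventually.of_forall h0)]
  exact hB.trans_lt ENNReal.ofReal_lt_top

include hB in
theorem integral_energyDensity_le (hm : 0 < m) (hV : ContDiff ℝ 2 V) (hB0 : 0 ≤ B) :
    ∫ z, energyDensity m γ V z.2 ∂(spaceTime T ρ hρ) ≤ B := by
  have h0 : ∀ z : ℝ × Phase d, 0 ≤ energyDensity m γ V z.2 := fun z =>
    energyDensity_nonneg hm γ z.2
  rw [integral_eq_lintegral_of_nonneg_ae (Eventually.of_forall h0)
    (integrable_energyDensity hρ hB hm hV).aestronglyMeasurable]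
  exact ENNReal.toReal_le_of_le_ofReal hB0 hB

include hB in
/-- Uniform second moments of the force along the coarse-grained curve. -/
theorem force_sq_pushCurve (hm : 0 < m) (hV : ContDiff ℝ 2 V) (hB0 : 0 ≤ B) {K : ℝ}
    (hVK : ∀ q, ‖fderiv ℝ (fderiv ℝ V) q‖ ≤ K) (i : Fin d) :
    Integrable (fun z : ℝ × (Fin d → ℝ) => fderiv ℝ V z.2 (Pi.single i 1) ^ 2)
      (spaceTime T (pushCurve (xiL γ) (xiL γ).continuous.measurable ρ)
        (continuous_pushCurve (xiL γ).continuous hρ)) ∧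
    ∫ z : ℝ × (Fin d → ℝ), fderiv ℝ V z.2 (Pi.single i 1) ^ 2
      ∂(spaceTime T (pushCurve (xiL γ) (xiL γ).continuous.measurable ρ)
        (continuous_pushCurve (xiL γ).continuous hρ)) ≤ (1 + K) ^ 2 * B := by
  have hc : Continuous fun z : ℝ × (Fin d → ℝ) => fderiv ℝ V z.2 (Pi.single i 1) ^ 2 :=
    ((continuous_fderiv_single hV i).comp continuous_snd).pow 2
  have hm' : Measurable (Prod.map id (xiL γ) : ℝ × Phase d → ℝ × (Fin d → ℝ)) :=
    measurable_id.prodMap (xiL γ).continuous.measurable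
  have hi := (integrable_energyDensity hρ hB hm hV).const_mul ((1 + K) ^ 2)
  rw [spaceTime_pushCurve T (xiL γ).continuous hρ]
  constructor
  · rw [integrable_map_measure hc.aestronglyMeasurable hm'.aemeasurable]
    refine hi.mono' (hc.measurable.comp hm').aestronglyMeasurable (Eventually.of_forall fun z => ?_)
    rw [Real.norm_eq_abs, abs_of_nonneg (sq_nonneg _)]
    exact sq_fderiv_xiL_le hm hV hVK z.2 i
  · rw [integral_map hm'.aemeasurable hc.aestronglyMeasurable]
    refine (integral_mono_of_nonneg (Eventually.of_forall fun z => sq_nonneg _) hi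
      (Eventually.of_forall fun z => sq_fderiv_xiL_le hm hV hVK z.2 i)).trans ?_
    rw [integral_const_mul]
    gcongr
    exact integral_energyDensity_le hρ hB hm hV hB0

theorem measurable_limGen {σ : ℝ → ProbabilityMeasure (Fin d → ℝ)} (hσ : Continuous σ)
    (hV : ContDiff ℝ 2 V) (hψ : ContDiff ℝ 2 ψ) {g : ℝ × (Fin d → ℝ) → ℝ} (hg : ContDiff ℝ 2 g) :
    Measurable fun z => limGen V ψ (σ z.1 : Measure (Fin d → ℝ)) g z := by
  have h1 := (continuous_tderQ hg).measurable
  have h2 := fun i => (continuous_qderQ hg i).measurable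
  have h3 := (continuous_laplQ hg).measurable
  have h4 := fun i => measurable_convGrad hσ hψ i
  have h5 : ∀ i, Measurable fun z : ℝ × (Fin d → ℝ) => fderiv ℝ V z.2 (Pi.single i 1) :=
    fun i => ((continuous_fderiv_single hV i).comp continuous_snd).measurable
  unfold limGen
  fun_prop

include hρ in
theorem measurable_coarseError (hV : ContDiff ℝ 2 V) (hψ : ContDiff ℝ 2 ψ)
    {g : ℝ × (Fin d → ℝ) → ℝ} (hg : ContDiff ℝ 2 g) :
    Measurable fun z => coarseError m γ V ψ (ρ z.1 : Measure (Phase d)) g z := by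
  have hgc : ContDiff ℝ 2 fun y => g (coarse d γ y) := hg.comp (coarse d γ).contDiff
  have h1 := measurable_generator (m := m) (γ := γ) hρ hV hψ hgc
  have h2 := (measurable_limGen (continuous_pushCurve (xiL γ).continuous hρ) hV hψ hg).comp
    (coarse d γ).continuous.measurable
  exact h1.sub h2

include hB in
theorem lintegral_enorm_mom_le (hm : 0 < m) (hV : ContDiff ℝ 2 V) :
    ∫⁻ z, ‖z.2.2‖ₑ ∂(spaceTime T ρ hρ) ≤ ENNReal.ofReal ((1 + m / 2) * B) := by
  have := (continuous_energyDensity (m := m) hV γ).measurable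
  calc _ ≤ ∫⁻ z, ENNReal.ofReal (1 + m / 2) * ENNReal.ofReal (energyDensity m γ V z.2)
        ∂(spaceTime T ρ hρ) := lintegral_mono fun z => enorm_mom_le hm z.2
    _ = ENNReal.ofReal (1 + m / 2) *
        ∫⁻ z, ENNReal.ofReal (energyDensity m γ V z.2) ∂(spaceTime T ρ hρ) :=
      lintegral_const_mul _ (by fun_prop)
    _ ≤ _ := by
      rw [ENNReal.ofReal_mul (by positivity)]
      gcongr

include hρ in
theorem measurable_lintegral_mom :
    Measurable fun z : ℝ × Phase d => ∫⁻ y, ‖y.2‖ₑ ∂(ρ z.1 : Measure (Phase d)) :=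
  (Measurable.lintegral_kernel (κ := curveKernel ρ hρ)
    (f := fun y : Phase d => ‖y.2‖ₑ) (by fun_prop)).comp measurable_fst

theorem lintegral_lintegral_mom :
    ∫⁻ z, (∫⁻ y, ‖y.2‖ₑ ∂(ρ z.1 : Measure (Phase d))) ∂(spaceTime T ρ hρ) =
      ∫⁻ z, ‖z.2.2‖ₑ ∂(spaceTime T ρ hρ) := by
  unfold spaceTime
  rw [Measure.lintegral_compProd (measurable_lintegral_mom hρ),
    Measure.lintegral_compProd (by fun_prop)]
  simp

include hB in
theorem lintegral_coarseError_le (hm : 0 < m) (hV : ContDiff ℝ 2 V) (hψ : ContDiff ℝ 2 ψ) {K : ℝ}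
    (hVK : ∀ q, ‖fderiv ℝ (fderiv ℝ V) q‖ ≤ K) (hψK : ∀ q, ‖fderiv ℝ ψ q‖ ≤ K)
    (hψK2 : ∀ q, ‖fderiv ℝ (fderiv ℝ ψ) q‖ ≤ K) {g : ℝ × (Fin d → ℝ) → ℝ}
    (hg : ContDiff ℝ 2 g) {M : ℝ} (hM : ∀ z, ‖fderiv ℝ g z‖ ≤ M) (hγ : 0 < γ) :
    ∫⁻ z, ‖coarseError m γ V ψ (ρ z.1 : Measure (Phase d)) g z‖ₑ ∂(spaceTime T ρ hρ) ≤
      ENNReal.ofReal (d * (K * M) * (3 * ((1 + m / 2) * B)) * γ⁻¹) := by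
  have hK0 : 0 ≤ K := (norm_nonneg _).trans (hψK 0)
  have hM0 : 0 ≤ M := (norm_nonneg _).trans (hM 0)
  have hp := lintegral_enorm_mom_le hρ hB hm hV
  calc _ ≤ ∫⁻ z, ENNReal.ofReal (d * (K * γ⁻¹ * M)) * (2 * ‖z.2.2‖ₑ +
          ∫⁻ y, ‖y.2‖ₑ ∂(ρ z.1 : Measure (Phase d))) ∂(spaceTime T ρ hρ) :=
        lintegral_mono fun z => enorm_coarseError_le hV hψ hVK hψK hψK2 hg hM hγ _ z
    _ = ENNReal.ofReal (d * (K * γ⁻¹ * M)) * (3 * ∫⁻ z, ‖z.2.2‖ₑ ∂(spaceTime T ρ hρ)) := by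
        rw [lintegral_const_mul' _ _ ENNReal.ofReal_ne_top, lintegral_add_left (by fun_prop),
          lintegral_const_mul _ (by fun_prop), lintegral_lintegral_mom]
        ring
    _ ≤ ENNReal.ofReal (d * (K * γ⁻¹ * M)) * (3 * ENNReal.ofReal ((1 + m / 2) * B)) := by
        gcongr
    _ = _ := by
        have h3 : (3 : ℝ≥0∞) = ENNReal.ofReal 3 := by simp
        rw [h3, ← ENNReal.ofReal_mul (by norm_num), ← ENNReal.ofReal_mul (by positivity)]
        congr 1
        ring

include hB in
/-- The coarse-graining error is of order `1/γ`. -/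
theorem integrable_coarseError (hm : 0 < m) (hV : ContDiff ℝ 2 V) (hψ : ContDiff ℝ 2 ψ) {K : ℝ}
    (hVK : ∀ q, ‖fderiv ℝ (fderiv ℝ V) q‖ ≤ K) (hψK : ∀ q, ‖fderiv ℝ ψ q‖ ≤ K)
    (hψK2 : ∀ q, ‖fderiv ℝ (fderiv ℝ ψ) q‖ ≤ K) {g : ℝ × (Fin d → ℝ) → ℝ}
    (hg : ContDiff ℝ 2 g) {M : ℝ} (hM : ∀ z, ‖fderiv ℝ g z‖ ≤ M) (hγ : 0 < γ) (hB0 : 0 ≤ B) :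
    Integrable (fun z => coarseError m γ V ψ (ρ z.1 : Measure (Phase d)) g z)
      (spaceTime T ρ hρ) ∧
    |∫ z, coarseError m γ V ψ (ρ z.1 : Measure (Phase d)) g z ∂(spaceTime T ρ hρ)| ≤
      d * (K * M) * (3 * ((1 + m / 2) * B)) * γ⁻¹ := by
  have hK0 : 0 ≤ K := (norm_nonneg _).trans (hψK 0)
  have hM0 : 0 ≤ M := (norm_nonneg _).trans (hM 0)
  refine integrable_and_abs_integral_le (measurable_coarseError hρ hV hψ hg) ?_
    (lintegral_coarseError_le hρ hB hm hV hψ hVK hψK hψK2 hg hM hγ)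
  have : 0 ≤ γ⁻¹ := inv_nonneg.2 hγ.le
  positivity

end EnergyConsequences

section Liminf

variable {d : ℕ} {m T : ℝ} {V ψ : (Fin d → ℝ) → ℝ}

/-- The functional whose supremum over test functions defines `LimRate`. -/
def limFunctional (T : ℝ) (V ψ : (Fin d → ℝ) → ℝ) (g : ℝ × (Fin d → ℝ) → ℝ)
    (σ : ℝ → ProbabilityMeasure (Fin d → ℝ)) (hσ : Continuous σ) : ℝ :=
  (∫ q, g (T, q) ∂(σ T : Measure (Fin d → ℝ))) - (∫ q, g (0, q) ∂(σ 0 : Measure (Fin d → ℝ)))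
    - (∫ z, limGen V ψ (σ z.1 : Measure (Fin d → ℝ)) g z ∂(spaceTime T σ hσ))
    - (1 / 2) * ∫ z, (∑ i, qderQ g z i ^ 2) ∂(spaceTime T σ hσ)

theorem continuous_sum_sq_qderQ {g : ℝ × (Fin d → ℝ) → ℝ} (hg : ContDiff ℝ 2 g) :
    Continuous fun z => ∑ i, qderQ g z i ^ 2 :=
  continuous_finsetSum _ fun i _ => (continuous_qderQ hg i).pow 2

theorem abs_sum_sq_qderQ_le {g : ℝ × (Fin d → ℝ) → ℝ} {M : ℝ} (hM : ∀ z, ‖fderiv ℝ g z‖ ≤ M)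
    (z : ℝ × (Fin d → ℝ)) : |∑ i, qderQ g z i ^ 2| ≤ d * M ^ 2 := by
  rw [abs_of_nonneg (Finset.sum_nonneg fun _ _ => sq_nonneg _)]
  refine (Finset.sum_le_card_nsmul _ _ (M ^ 2) fun i _ => ?_).trans_eq (by simp)
  have := abs_qderQ_le hM z i
  rw [sq_le_sq, abs_of_nonneg ((abs_nonneg _).trans this)]
  exact this

/-- The coarse-grained functional, up to the coarse-graining error, is bounded by the rate
functional. -/
theorem ofReal_limFunctional_sub_le_rateI {γ : ℝ} (hγ : 0 < γ)
    {ρ : ℝ → ProbabilityMeasure (Phase d)} (hρ : Continuous ρ)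
    {g : ℝ × (Fin d → ℝ) → ℝ} (hg : IsCb2 g)
    (hL : Integrable (fun z => limGen V ψ (pushCurve (xiL γ) (xiL γ).continuous.measurable ρ z.1 :
      Measure (Fin d → ℝ)) g z) (spaceTime T (pushCurve (xiL γ) (xiL γ).continuous.measurable ρ)
        (continuous_pushCurve (xiL γ).continuous hρ)))
    (hE : Integrable (fun z => coarseError m γ V ψ (ρ z.1 : Measure (Phase d)) g z)
      (spaceTime T ρ hρ)) :
    ENNReal.ofReal (limFunctional T V ψ g (pushCurve (xiL γ) (xiL γ).continuous.measurable ρ)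
        (continuous_pushCurve (xiL γ).continuous hρ) -
      ∫ z, coarseError m γ V ψ (ρ z.1 : Measure (Phase d)) g z ∂(spaceTime T ρ hρ)) ≤
    RateI m γ T V ψ ρ := by
  have hm' : Measurable (Prod.map id (xiL γ) : ℝ × Phase d → ℝ × (Fin d → ℝ)) :=
    measurable_id.prodMap (xiL γ).continuous.measurable
  have hend : ∀ t, ∫ q, g (t, q)
      ∂(pushCurve (xiL γ) (xiL γ).continuous.measurable ρ t : Measure (Fin d → ℝ)) =
      ∫ x, g (coarse d γ (t, x)) ∂(ρ t : Measure (Phase d)) := fun t => by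
    have : Continuous g := hg.1.continuous
    exact integral_map (xiL γ).continuous.aemeasurable
      (Continuous.aestronglyMeasurable (by fun_prop))
  have hsq := continuous_sum_sq_qderQ hg.1
  rw [spaceTime_pushCurve T (xiL γ).continuous hρ] at hL
  have hL' : Integrable (fun z => limGen V ψ ((ρ z.1 : Measure (Phase d)).map (xiL γ)) g
      (coarse d γ z)) (spaceTime T ρ hρ) :=
    (integrable_map_measure hL.aestronglyMeasurable hm'.aemeasurable).1 hL
  have hA : (fun z => tder (fun y => g (coarse d γ y)) z +
      Lop m γ V ψ (ρ z.1 : Measure (Phase d)) (fun y => g (coarse d γ y)) z) =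
      fun z => limGen V ψ ((ρ z.1 : Measure (Phase d)).map (xiL γ)) g (coarse d γ z) +
        coarseError m γ V ψ (ρ z.1 : Measure (Phase d)) g z := by
    funext z; unfold coarseError; ring
  have key := ofReal_le_rateI (m := m) (γ := γ) (T := T) (V := V) (ψ := ψ) hρ
    (hg.comp_clm (coarse d γ)) (by rw [hA]; exact hL'.add hE)
  refine le_trans (ENNReal.ofReal_le_ofReal (le_of_eq ?_)) key
  rw [hA, integral_add hL' hE]
  unfold limFunctional
  rw [hend, hend, spaceTime_pushCurve T (xiL γ).continuous hρ,
    integral_map hm'.aemeasurable hL.aestronglyMeasurable,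
    integral_map hm'.aemeasurable hsq.aestronglyMeasurable]
  have h1 : γ ^ 2 / 2 * ∫ z, ∑ i, pderT (fun y => g (coarse d γ y)) z i ^ 2 ∂(spaceTime T ρ hρ) =
      1 / 2 * ∫ z, ∑ i, qderQ g (coarse d γ z) i ^ 2 ∂(spaceTime T ρ hρ) := by
    simp_rw [pderT_comp_coarse hg.1, mul_pow, ← Finset.mul_sum]
    rw [integral_const_mul]
    field_simp
  rw [h1]
  have h2 : ∀ z : ℝ × Phase d, Prod.map id (xiL γ) z = coarse d γ z := fun z => rfl
  simp only [h2]
  have h3 : ∫ z, limGen V ψ ((pushCurve (xiL γ) (xiL γ).continuous.measurable ρ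
      (coarse d γ z).1 : ProbabilityMeasure (Fin d → ℝ)) : Measure (Fin d → ℝ)) g (coarse d γ z)
        ∂(spaceTime T ρ hρ) =
      ∫ z, limGen V ψ ((ρ z.1 : Measure (Phase d)).map (xiL γ)) g (coarse d γ z)
        ∂(spaceTime T ρ hρ) := rfl
  rw [h3]
  ring

theorem limRate_le_liminf_of_continuous (hyp : PotentialHyp d m V ψ) (hT : 0 < T)
    {γs : ℕ → ℝ} (hγpos : ∀ n, 0 < γs n) (hγ : Tendsto γs atTop atTop)
    {ρs : ℕ → ℝ → ProbabilityMeasure (Phase d)} (hρ : ∀ n, Continuous (ρs n))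
    {C : ℝ≥0∞} (hC : C ≠ ⊤)
    (hbound : ∀ n, RateI m (γs n) T V ψ (ρs n)
      + FreeEnergy m V ψ (ρs n 0 : Measure (Phase d)) ≤ C)
    {σ : ℝ → ProbabilityMeasure (Fin d → ℝ)} (hσ : Continuous σ)
    (hconv : ∀ t ∈ Icc (0 : ℝ) T, Tendsto (fun n =>
      pushCurve (xiL (γs n)) (xiL (γs n)).continuous.measurable (ρs n) t) atTop (𝓝 (σ t))) :
    LimRate T V ψ σ ≤ Filter.liminf (fun n => RateI m (γs n) T V ψ (ρs n)) atTop := by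
  obtain ⟨K₁, hVK⟩ := hyp.V_hess_bdd
  obtain ⟨K₂, hK₂⟩ := hyp.ψ_deriv_bdd
  set K := max K₁ K₂
  replace hVK : ∀ q, ‖fderiv ℝ (fderiv ℝ V) q‖ ≤ K := fun q => (hVK q).trans (le_max_left _ _)
  have hψK : ∀ q, ‖fderiv ℝ ψ q‖ ≤ K := fun q => (hK₂ q).1.trans (le_max_right _ _)
  have hψK2 : ∀ q, ‖fderiv ℝ (fderiv ℝ ψ) q‖ ≤ K := fun q => (hK₂ q).2.trans (le_max_right _ _)
  have hB : ∃ B : ℝ, 0 ≤ B ∧ ∀ᶠ n in atTop,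
      ∫⁻ z, ENNReal.ofReal (energyDensity m (γs n) V z.2) ∂(spaceTime T (ρs n) (hρ n)) ≤
        ENNReal.ofReal B := by
    obtain ⟨B, hB⟩ := exists_uniform_energy_bound hyp hT hC
    refine ⟨max B 0, le_max_right _ _, ?_⟩
    filter_upwards [hγ.eventually_ge_atTop 1] with n hn
    exact (hB _ hn _ (hρ n) (hbound n)).trans (ENNReal.ofReal_le_ofReal (le_max_left _ _))
  obtain ⟨B, hB0, hB⟩ := hB
  set τ : ℕ → ℝ → ProbabilityMeasure (Fin d → ℝ) := fun n =>
    pushCurve (xiL (γs n)) (xiL (γs n)).continuous.measurable (ρs n) with hτ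
  have hτc : ∀ n, Continuous (τ n) := fun n =>
    continuous_pushCurve (xiL (γs n)).continuous (hρ n)
  refine iSup_le fun ⟨g, hg⟩ => ?_
  obtain ⟨hg2, M, hM⟩ := hg
  obtain ⟨hLσ, hLτ, hLt⟩ := tendsto_integral_limGen hg2 hτc hσ hconv hyp.ψ_smooth hψK hyp.V_smooth
    (M := M) (fun z => (hM z).2) (hB.mono fun n hn i =>
      force_sq_pushCurve (hρ n) hn hyp.hm hyp.V_smooth hB0 hVK i)
  have hE := hB.mono fun n hn => integrable_coarseError (hρ n) hn hyp.hm hyp.V_smooth hyp.ψ_smooth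
    hVK hψK hψK2 hg2 (fun z => (hM z).2.1) (hγpos n) hB0
  have hEt : Tendsto (fun n => ∫ z, coarseError m (γs n) V ψ (ρs n z.1 : Measure (Phase d)) g z
      ∂(spaceTime T (ρs n) (hρ n))) atTop (𝓝 0) := by
    have h1 : Tendsto (fun n => d * (K * M) * (3 * ((1 + m / 2) * B)) * (γs n)⁻¹) atTop (𝓝 0) := by
      simpa using (tendsto_inv_atTop_zero.comp hγ).const_mul
        (d * (K * M) * (3 * ((1 + m / 2) * B)))
    exact squeeze_zero_norm' (hE.mono fun n hn => hn.2) h1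
  have hend : ∀ t ∈ Icc (0 : ℝ) T, Tendsto (fun n => ∫ q, g (t, q) ∂(τ n t : Measure (Fin d → ℝ)))
      atTop (𝓝 (∫ q, g (t, q) ∂(σ t : Measure (Fin d → ℝ)))) := fun t ht => by
    have hgc : Continuous g := hg2.continuous
    have h2 := ProbabilityMeasure.tendsto_iff_forall_integral_tendsto.1 (hconv t ht)
      (BoundedContinuousFunction.ofNormedAddCommGroup (fun q => g (t, q)) (by fun_prop) M
        fun q => (hM _).1)
    simpa using h2
  have hsq := tendsto_integral_spaceTime hτc hσ hconv (continuous_sum_sq_qderQ hg2)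
    (abs_sum_sq_qderQ_le fun z => (hM z).2.1)
  have hF : Tendsto (fun n => limFunctional T V ψ g (τ n) (hτc n) -
      ∫ z, coarseError m (γs n) V ψ (ρs n z.1 : Measure (Phase d)) g z
        ∂(spaceTime T (ρs n) (hρ n))) atTop (𝓝 (limFunctional T V ψ g σ hσ - 0)) :=
    ((((hend T ⟨hT.le, le_rfl⟩).sub (hend 0 ⟨le_rfl, hT.le⟩)).sub hLt).sub
      (hsq.const_mul _)).sub hEt
  rw [sub_zero] at hF
  have hle : ∀ᶠ n in atTop, ENNReal.ofReal (limFunctional T V ψ g (τ n) (hτc n) -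
      ∫ z, coarseError m (γs n) V ψ (ρs n z.1 : Measure (Phase d)) g z
        ∂(spaceTime T (ρs n) (hρ n))) ≤ RateI m (γs n) T V ψ (ρs n) := by
    filter_upwards [hLτ, hE] with n hn hEn
    exact ofReal_limFunctional_sub_le_rateI (hγpos n) (hρ n) ⟨hg2, M, hM⟩ hn hEn.1
  have hlim : ENNReal.ofReal (limFunctional T V ψ g σ hσ) ≤
      Filter.liminf (fun n => RateI m (γs n) T V ψ (ρs n)) atTop := by
    rw [← (ENNReal.tendsto_ofReal hF).liminf_eq]
    exact liminf_le_liminf hle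
  refine le_trans (le_of_eq ?_) hlim
  unfold limFunctional
  rw [integral_spaceTime hLσ, integral_spaceTime (integrable_of_measurable_bdd
    (continuous_sum_sq_qderQ hg2).measurable (abs_sum_sq_qderQ_le fun z => (hM z).2.1))]
  rfl

/-- A locally uniform narrow limit of continuous curves is continuous. -/
theorem continuousOn_of_tendstoUniformlyOn_integral {X : Type*} [TopologicalSpace X]
    [MeasurableSpace X] [OpensMeasurableSpace X] {s : Set ℝ} {τ : ℕ → ℝ → ProbabilityMeasure X}
    {σ : ℝ → ProbabilityMeasure X} (hτ : ∀ n, ContinuousOn (τ n) s)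
    (h : ∀ g : BoundedContinuousFunction X ℝ, TendstoUniformlyOn
      (fun n t => ∫ x, g x ∂(τ n t : Measure X)) (fun t => ∫ x, g x ∂(σ t : Measure X)) atTop s) :
    ContinuousOn σ s := by
  intro t ht
  refine ProbabilityMeasure.tendsto_iff_forall_integral_tendsto.2 fun g => ?_
  exact (h g).continuousOn (Frequently.of_forall fun n =>
    (ProbabilityMeasure.continuous_integral_boundedContinuousFunction g).comp_continuousOn (hτ n))
    t ht

end Liminf

end Auxiliary

/-- Theorem 2.6, liminf inequality: under the a priori bound and the
convergences `ρ^{γ_n} → ρ`, `ξ^{γ_n}_#ρ^{γ_n} → ξ_#ρ =: σ`, one has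
`liminf_n I^{γ_n}(ρ^{γ_n}) ≥ I(σ)`. -/
theorem stmt6 {d : ℕ} {m : ℝ} (V ψ : (Fin d → ℝ) → ℝ)
    (hyp : PotentialHyp d m V ψ)
    (T : ℝ) (hT : 0 < T)
    (γs : ℕ → ℝ) (hγpos : ∀ n, 0 < γs n) (hγ : Tendsto γs atTop atTop)
    (ρseq : ℕ → ℝ → ProbabilityMeasure (Phase d))
    (hρcont : ∀ n, ContinuousOn (ρseq n) (Icc 0 T))
    (C : ℝ≥0∞) (hC : C ≠ ⊤)
    (hbound : ∀ n, RateI m (γs n) T V ψ (ρseq n)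
      + FreeEnergy m V ψ (ρseq n 0 : Measure (Phase d)) ≤ C)
    (ρ : ℝ → ProbabilityMeasure (Phase d))
    (σ : ℝ → ProbabilityMeasure (Fin d → ℝ))
    (hσ : ∀ t ∈ Icc (0 : ℝ) T,
      (σ t : Measure (Fin d → ℝ))
        = (ρ t : Measure (Phase d)).map (fun x : Phase d => x.1))
    (hconv : ∀ F : BoundedContinuousFunction (ℝ × Phase d) ℝ,
      Tendsto
        (fun n => ∫ t in Icc (0 : ℝ) T,
          (∫ x, F (t, x) ∂(ρseq n t : Measure (Phase d))))
        atTop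
        (𝓝 (∫ t in Icc (0 : ℝ) T, (∫ x, F (t, x) ∂(ρ t : Measure (Phase d))))))
    (hconvξ : ∀ g : BoundedContinuousFunction (Fin d → ℝ) ℝ,
      TendstoUniformlyOn
        (fun n t => ∫ x, g (xiGamma (γs n) x) ∂(ρseq n t : Measure (Phase d)))
        (fun t => ∫ q, g q ∂(σ t : Measure (Fin d → ℝ)))
        atTop (Icc 0 T)) :
    LimRate T V ψ σ ≤ Filter.liminf (fun n => RateI m (γs n) T V ψ (ρseq n)) atTop := by
  have hpush : ∀ (g : BoundedContinuousFunction (Fin d → ℝ) ℝ) (n : ℕ) (t : ℝ),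
      ∫ q, g q ∂(pushCurve (xiL (γs n)) (xiL (γs n)).continuous.measurable (ρseq n) t :
        Measure (Fin d → ℝ)) =
      ∫ x, g (xiGamma (γs n) x) ∂(ρseq n t : Measure (Phase d)) := fun g n t => by
    simp_rw [← xiL_apply]
    exact integral_map (xiL (γs n)).continuous.aemeasurable g.continuous.aestronglyMeasurable
  simp_rw [← hpush] at hconvξ
  have hσc : ContinuousOn σ (Icc 0 T) := continuousOn_of_tendstoUniformlyOn_integral
    (fun n => (ProbabilityMeasure.continuous_map (xiL (γs n)).continuous).comp_continuousOn
      (hρcont n)) hconvξ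
  have hproj : ∀ t ∈ Icc (0 : ℝ) T, (projIcc 0 T hT.le t : ℝ) = t := fun t ht => by
    rw [projIcc_of_mem hT.le ht]
  have hcont : ∀ {X : Type} [TopologicalSpace X] {τ : ℝ → X}, ContinuousOn τ (Icc 0 T) →
      Continuous fun t => τ (projIcc 0 T hT.le t) := fun h =>
    h.comp_continuous (continuous_subtype_val.comp continuous_projIcc) fun t => Subtype.prop _
  have hrate : ∀ n, RateI m (γs n) T V ψ (ρseq n) =
      RateI m (γs n) T V ψ fun t => ρseq n (projIcc 0 T hT.le t) := fun n =>
    rateI_congr hT.le fun t ht => by rw [hproj t ht]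
  rw [limRate_congr hT.le (σ' := fun t => σ (projIcc 0 T hT.le t))
    fun t ht => by rw [hproj t ht]]
  simp_rw [hrate] at hbound ⊢
  refine limRate_le_liminf_of_continuous hyp hT hγpos hγ (fun n => hcont (hρcont n)) hC
    (fun n => ?_) (hcont hσc) fun t ht => ?_
  · rw [hproj 0 ⟨le_rfl, hT.le⟩]
    exact hbound n
  · refine ProbabilityMeasure.tendsto_iff_forall_integral_tendsto.2 fun g => ?_
    have := (hconvξ g).tendsto_at ht
    rw [← hproj t ht] at this
    exact this

end
end

section
/- (Lions) Let F be a real Hilbert space with norm ‖·‖_F, and let Θ ⊆ F be a linear subspace endowed with a prehilbertian norm ‖·‖_Θ such that the inclusion Θ ↪ F is continuous. Let E : F × Θ → ℝ be bilinear, such that for each fixed φ ∈ Θ the map g ↦ E(g,φ) is continuous on F, and such that there is α > 0 with |E(φ,φ)| ≥ α ‖φ‖_Θ² for all φ ∈ Θ. Then for every linear form L on Θ that is continuous with respect to ‖·‖_Θ, there exists g ∈ F such that E(g,φ) = L(φ) for all φ ∈ Θ. -/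
open Real

noncomputable section

/-- A linear form dominated by the norm of a linear map `T` into a real normed space factors
through `T` via a continuous linear form. -/
theorem exists_continuousLinearMap_comp_eq_of_bound {V F : Type*} [AddCommGroup V] [Module ℝ V]
    [NormedAddCommGroup F] [NormedSpace ℝ F] (T : V →ₗ[ℝ] F) (L : V →ₗ[ℝ] ℝ) (C : ℝ)
    (h : ∀ v, |L v| ≤ C * ‖T v‖) : ∃ f : F →L[ℝ] ℝ, ∀ v, f (T v) = L v := by
  have hL : L ∈ LinearMap.range T.dualMap := by
    rw [LinearMap.range_dualMap_eq_dualAnnihilator_ker, Submodule.mem_dualAnnihilator]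
    intro v hv
    have hv' := h v
    rw [LinearMap.mem_ker.mp hv, norm_zero, mul_zero] at hv'
    exact abs_nonpos_iff.mp hv'
  obtain ⟨f₀, hf₀⟩ := hL
  have hf₀T (v : V) : f₀ (T v) = L v := DFunLike.congr_fun hf₀ v
  let f₁ : LinearMap.range T →L[ℝ] ℝ := (f₀.domRestrict (LinearMap.range T)).mkContinuous C <| by
    rintro ⟨_, v, rfl⟩
    simpa [hf₀T] using h v
  obtain ⟨f, hf, -⟩ := exists_extension_norm_eq (LinearMap.range T) f₁
  exact ⟨f, fun v => (hf ⟨T v, v, rfl⟩).trans (hf₀T v)⟩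

/-- A bilinear form on `F × V`, continuous in its variable in the Hilbert space `F`, is of the form
`(g, v) ↦ ⟪T v, g⟫` with `T` linear. -/
theorem exists_linearMap_inner_eq {V F : Type*} [AddCommGroup V] [Module ℝ V]
    [NormedAddCommGroup F] [InnerProductSpace ℝ F] [CompleteSpace F] (E : F →ₗ[ℝ] V →ₗ[ℝ] ℝ)
    (hE : ∀ v, Continuous fun g => E g v) :
    ∃ T : V →ₗ[ℝ] F, ∀ v g, inner ℝ (T v) g = E g v := by
  let K : V → F := fun v => (InnerProductSpace.toDual ℝ F).symm ⟨E.flip v, hE v⟩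
  have hK (v : V) (g : F) : inner ℝ (K v) g = E g v := InnerProductSpace.toDual_symm_apply
  refine ⟨⟨⟨K, fun v w => ?_⟩, fun r v => ?_⟩, hK⟩
  · exact ext_inner_right ℝ fun g => by simp only [inner_add_left, hK, map_add]
  · exact ext_inner_right ℝ fun g => by
      simp only [RingHom.id_apply, real_inner_smul_left, hK, map_smul, smul_eq_mul]

/-- Theorem B.9, Lions: let `F` be a (real) Hilbert space and `Θ ⊆ F`
a subspace endowed with a prehilbertian norm `‖φ‖_Θ = √(ip φ φ)` making the inclusion
`Θ ↪ F` continuous. Let `E : F × Θ → ℝ` be bilinear, continuous on `F` for each fixed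
`φ ∈ Θ`, and coercive: `|E(φ,φ)| ≥ α‖φ‖_Θ²`. Then every linear form `L` on `Θ` that is
continuous for `‖·‖_Θ` is represented: there exists `g ∈ F` with `E(g,φ) = L(φ)` for all
`φ ∈ Θ`. -/
theorem stmt10 {F : Type*} [NormedAddCommGroup F] [InnerProductSpace ℝ F]
    [CompleteSpace F]
    (Θ : Submodule ℝ F)
    (ip : Θ →ₗ[ℝ] Θ →ₗ[ℝ] ℝ)
    (ip_symm : ∀ a b : Θ, ip a b = ip b a)
    (ip_nonneg : ∀ a : Θ, 0 ≤ ip a a)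
    (ip_definite : ∀ a : Θ, ip a a = 0 → a = 0)
    (c : ℝ) (hc : 0 < c)
    (h_incl : ∀ a : Θ, ‖(a : F)‖ ≤ c * Real.sqrt (ip a a))
    (E : F →ₗ[ℝ] Θ →ₗ[ℝ] ℝ)
    (hE_cont : ∀ φ : Θ, Continuous fun g : F => E g φ)
    (α : ℝ) (hα : 0 < α)
    (h_coercive : ∀ φ : Θ, α * ip φ φ ≤ |E (φ : F) φ|)
    (L : Θ →ₗ[ℝ] ℝ)
    (cL : ℝ) (hL : ∀ φ : Θ, |L φ| ≤ cL * Real.sqrt (ip φ φ)) :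
    ∃ g : F, ∀ φ : Θ, E g φ = L φ := by
  obtain ⟨T, hT⟩ := exists_linearMap_inner_eq E hE_cont
  have hbound (φ : Θ) : √(ip φ φ) ≤ c / α * ‖T φ‖ := by
    rw [div_mul_eq_mul_div, le_div_iff₀ hα]
    rcases (Real.sqrt_nonneg (ip φ φ)).eq_or_lt with h0 | h0
    · rw [← h0, zero_mul]
      positivity
    · refine le_of_mul_le_mul_right ?_ h0
      calc √(ip φ φ) * α * √(ip φ φ) = α * ip φ φ := by
            rw [mul_comm _ α, mul_assoc, Real.mul_self_sqrt (ip_nonneg φ)]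
        _ ≤ |E (φ : F) φ| := h_coercive φ
        _ ≤ ‖T φ‖ * ‖(φ : F)‖ := by
            rw [← hT]
            exact abs_real_inner_le_norm _ _
        _ ≤ ‖T φ‖ * (c * √(ip φ φ)) := by
            gcongr
            exact h_incl φ
        _ = c * ‖T φ‖ * √(ip φ φ) := by ring
  obtain ⟨f, hf⟩ := exists_continuousLinearMap_comp_eq_of_bound T L (|cL| * (c / α)) fun φ => by
    calc |L φ| ≤ cL * √(ip φ φ) := hL φ
      _ ≤ |cL| * (c / α * ‖T φ‖) :=
          mul_le_mul (le_abs_self cL) (hbound φ) (Real.sqrt_nonneg _) (abs_nonneg cL)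
      _ = |cL| * (c / α) * ‖T φ‖ := (mul_assoc _ _ _).symm
  refine ⟨(InnerProductSpace.toDual ℝ F).symm f, fun φ => ?_⟩
  rw [← hT, real_inner_comm, InnerProductSpace.toDual_symm_apply, hf]

end
end
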